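/- (Theorem 2.8, main result for the general case.) The closure of the Blaschke–Santaló diagram 𝓔 is exactly the strip [π·λ₁(𝔻), +∞) × [0, π·μ₁(𝔻)], i.e. closure(𝓔) = { (x,y) ∈ ℝ² : x ≥ π·λ₁(𝔻) and 0 ≤ y ≤ π·μ₁(𝔻) }, where 𝔻 is the open unit disc. -/

import Mathlib

open MeasureTheory Filter Set Real RealInnerProductSpace

noncomputable section

abbrev E2 : Type := EuclideanSpace ℝ (Fin 2)

/-- First Dirichlet eigenvalue, variational characterization. -/
noncomputable def dEig1 (Ω : Set E2) : ℝ :=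
  sInf { R : ℝ | ∃ u : E2 → ℝ, ContDiff ℝ (⊤ : ℕ∞) u ∧ HasCompactSupport u ∧
    tsupport u ⊆ Ω ∧ (∫ x, (u x)^2) ≠ 0 ∧
    R = (∫ x, ‖fderiv ℝ u x‖^2) / (∫ x, (u x)^2) }

/-- First nontrivial Neumann eigenvalue, variational characterization. -/
noncomputable def nEig1 (Ω : Set E2) : ℝ :=
  sInf { R : ℝ | ∃ u : E2 → ℝ, ContDiff ℝ (⊤ : ℕ∞) u ∧ (∫ x in Ω, u x) = 0 ∧
    (∫ x in Ω, (u x)^2) ≠ 0 ∧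
    R = (∫ x in Ω, ‖fderiv ℝ u x‖^2) / (∫ x in Ω, (u x)^2) }

/-- The cone C(y, ξ, ε). -/
def coneSet (y ξ : E2) (ε : ℝ) : Set E2 :=
  { z | Real.cos ε * ‖z - y‖ ≤ ⟪z - y, ξ⟫ ∧ 0 < ‖z - y‖ ∧ ‖z - y‖ < ε }

/-- The uniform ε-cone property. -/
def ConeProperty (Ω : Set E2) (ε : ℝ) : Prop :=
  ∀ x ∈ frontier Ω, ∃ ξ : E2, ‖ξ‖ = 1 ∧
    ∀ y ∈ closure Ω ∩ Metric.ball x ε, coneSet y ξ ε ⊆ Ω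

/-- The Blaschke–Santaló diagram 𝓔 for general (cone-property, i.e. Lipschitz) open sets. -/
def diagE : Set (ℝ × ℝ) :=
  { p | ∃ Ω : Set E2, Ω.Nonempty ∧ IsOpen Ω ∧ Bornology.IsBounded Ω ∧
      (∃ ε > 0, ConeProperty Ω ε) ∧
      p = ((volume Ω).toReal * dEig1 Ω, (volume Ω).toReal * nEig1 Ω) }

/-- The open unit disc in the plane. -/
def unitDisc : Set E2 := Metric.ball 0 1

noncomputable section


/-- Nonempty bounded open sets. -/
structure Dom (Ω : Set E2) : Prop where
  ne : Ω.Nonempty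
  op : IsOpen Ω
  bd : Bornology.IsBounded Ω

abbrev SmoothF (u : E2 → ℝ) : Prop := ContDiff ℝ (⊤ : ℕ∞) u

/-- area -/
def area (Ω : Set E2) : ℝ := (volume Ω).toReal

lemma Dom.meas {Ω} (h : Dom Ω) : MeasurableSet Ω := h.op.measurableSet

lemma Dom.fin {Ω} (h : Dom Ω) : volume Ω < ⊤ := h.bd.measure_lt_top

lemma Dom.pos {Ω} (h : Dom Ω) : 0 < area Ω :=
  ENNReal.toReal_pos (h.op.measure_pos volume h.ne).ne' h.fin.ne

lemma Dom.intOn {Ω} (h : Dom Ω) {f : E2 → ℝ} (hf : Continuous f) : IntegrableOn f Ω :=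
  (hf.continuousOn.integrableOn_compact h.bd.isCompact_closure).mono_set subset_closure

lemma SmoothF.cont_fd {u} (hu : SmoothF u) : Continuous (fun x => fderiv ℝ u x) :=
  hu.continuous_fderiv (by simp)

lemma SmoothF.cont_grad {u} (hu : SmoothF u) : Continuous (fun x => ‖fderiv ℝ u x‖^2) :=
  (hu.cont_fd.norm.pow 2)

lemma dual_norm_sq (L : E2 →L[ℝ] ℝ) :
    ‖L‖^2 = (L (EuclideanSpace.single 0 1))^2 + (L (EuclideanSpace.single 1 1))^2 := by
  obtain ⟨v, rfl⟩ := (InnerProductSpace.toDual ℝ E2).surjective L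
  rw [LinearIsometryEquiv.norm_map, EuclideanSpace.norm_sq_eq]
  simp [EuclideanSpace.inner_single_right]

lemma nEig1_nonneg (Ω : Set E2) : 0 ≤ nEig1 Ω := by
  apply Real.sInf_nonneg
  rintro R ⟨u, -, -, -, rfl⟩
  exact div_nonneg (integral_nonneg fun x => by positivity) (integral_nonneg fun x => by positivity)

lemma dEig1_nonneg (Ω : Set E2) : 0 ≤ dEig1 Ω := by
  apply Real.sInf_nonneg
  rintro R ⟨u, -, -, -, -, rfl⟩
  exact div_nonneg (integral_nonneg fun x => by positivity) (integral_nonneg fun x => by positivity)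

lemma nEig1_le {Ω : Set E2} {u : E2 → ℝ} (hu : SmoothF u) (h0 : (∫ x in Ω, u x) = 0) :
    nEig1 Ω * (∫ x in Ω, (u x)^2) ≤ ∫ x in Ω, ‖fderiv ℝ u x‖^2 := by
  have hE : 0 ≤ ∫ x in Ω, ‖fderiv ℝ u x‖^2 := integral_nonneg fun x => by positivity
  by_cases h : (∫ x in Ω, (u x)^2) = 0
  · rw [h]; simpa using hE
  have hp : 0 < ∫ x in Ω, (u x)^2 :=
    lt_of_le_of_ne (integral_nonneg fun x => by positivity) (Ne.symm h)
  rw [← le_div_iff₀ hp]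
  apply csInf_le
  · refine ⟨0, ?_⟩
    rintro R ⟨u, -, -, -, rfl⟩
    exact div_nonneg (integral_nonneg fun x => by positivity)
      (integral_nonneg fun x => by positivity)
  · exact ⟨u, hu, h0, h, rfl⟩

lemma dEig1_le {Ω : Set E2} {u : E2 → ℝ} (hu : SmoothF u) (hc : HasCompactSupport u)
    (hs : tsupport u ⊆ Ω) :
    dEig1 Ω * (∫ x, (u x)^2) ≤ ∫ x, ‖fderiv ℝ u x‖^2 := by
  have hE : 0 ≤ ∫ x, ‖fderiv ℝ u x‖^2 := integral_nonneg fun x => by positivity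
  by_cases h : (∫ x, (u x)^2) = 0
  · rw [h]; simpa using hE
  have hp : 0 < ∫ x, (u x)^2 :=
    lt_of_le_of_ne (integral_nonneg fun x => by positivity) (Ne.symm h)
  rw [← le_div_iff₀ hp]
  apply csInf_le
  · refine ⟨0, ?_⟩
    rintro R ⟨u, -, -, -, -, rfl⟩
    exact div_nonneg (integral_nonneg fun x => by positivity)
      (integral_nonneg fun x => by positivity)
  · exact ⟨u, hu, hc, hs, h, rfl⟩

lemma int_sub_const {Ω} (h : Dom Ω) {u : E2 → ℝ} (hu : Continuous u) (c : ℝ) :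
    (∫ x in Ω, (u x - c)) = (∫ x in Ω, u x) - c * area Ω := by
  rw [integral_sub (h.intOn hu) (h.intOn continuous_const)]
  simp [area, Measure.real, mul_comm]

lemma int_sub_const_sq {Ω} (h : Dom Ω) {u : E2 → ℝ} (hu : Continuous u) (c : ℝ) :
    (∫ x in Ω, (u x - c)^2) = (∫ x in Ω, (u x)^2) - 2 * c * (∫ x in Ω, u x) + c^2 * area Ω := by
  have : ∀ x, (u x - c)^2 = (u x)^2 - (2 * c) * u x + c^2 := fun x => by ring
  simp_rw [this]
  have h1 : IntegrableOn (fun x => (u x)^2) Ω := h.intOn (by fun_prop)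
  have h2 : IntegrableOn (fun x => (2 * c) * u x) Ω := h.intOn (by fun_prop)
  have h3 : IntegrableOn (fun _ : E2 => c^2) Ω := h.intOn (by fun_prop)
  have h4 : IntegrableOn (fun x => (u x)^2 - (2 * c) * u x) Ω := h.intOn (by fun_prop)
  rw [integral_add h4 h3, integral_sub h1 h2, integral_const_mul]
  simp [area, Measure.real, mul_comm]

/-- mean value -/
def mean (Ω : Set E2) (u : E2 → ℝ) : ℝ := (∫ x in Ω, u x) / area Ω

lemma nEig1_le_mean {Ω : Set E2} (h : Dom Ω) {u : E2 → ℝ} (hu : SmoothF u) :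
    nEig1 Ω * (∫ x in Ω, (u x - mean Ω u)^2) ≤ ∫ x in Ω, ‖fderiv ℝ u x‖^2 := by
  have h1 := nEig1_le (Ω := Ω) (u := fun x => u x - mean Ω u) (hu.sub contDiff_const) (by
    rw [int_sub_const h hu.continuous, mean, div_mul_cancel₀ _ h.pos.ne', sub_self])
  simpa [fderiv_sub_const] using h1

lemma nEig1_le_var {Ω : Set E2} (h : Dom Ω) {u : E2 → ℝ} (hu : SmoothF u) :
    nEig1 Ω * ((∫ x in Ω, (u x)^2) - (∫ x in Ω, u x)^2 / area Ω)
      ≤ ∫ x in Ω, ‖fderiv ℝ u x‖^2 := by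
  have h1 := nEig1_le_mean h hu
  rw [int_sub_const_sq h hu.continuous] at h1
  have h2 : 2 * mean Ω u * (∫ x in Ω, u x) - (mean Ω u)^2 * area Ω
      = (∫ x in Ω, u x)^2 / area Ω := by
    rw [mean]; have := h.pos.ne'; field_simp; ring
  have h3 : (∫ x in Ω, (u x)^2) - (∫ x in Ω, u x)^2 / area Ω = (∫ x in Ω, (u x)^2)
    - 2 * mean Ω u * (∫ x in Ω, u x) + (mean Ω u)^2 * area Ω := by rw [← h2]; ring
  rw [h3]; exact h1

lemma sq_int_pos {Ω : Set E2} (h : Dom Ω) {u : E2 → ℝ} (hu : Continuous u) {x : E2} (hx : x ∈ Ω)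
    (hux : u x ≠ 0) : 0 < ∫ x in Ω, (u x)^2 := by
  have h1 : IntegrableOn (fun x => (u x)^2) Ω := h.intOn (by fun_prop)
  rw [setIntegral_pos_iff_support_of_nonneg_ae (ae_of_all _ fun x => by positivity) h1]
  have hop : IsOpen ((Function.support fun x => (u x)^2) ∩ Ω) :=
    (isOpen_ne_fun (hu.pow 2) continuous_const).inter h.op
  exact hop.measure_pos volume ⟨x, by simpa using hux, hx⟩

lemma smooth_coord (i : Fin 2) : SmoothF (fun x => x i) := by
  have : (fun x : E2 => x i) = (EuclideanSpace.proj (𝕜 := ℝ) i : E2 →L[ℝ] ℝ) := by ext; rfl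
  rw [this]; exact ContinuousLinearMap.contDiff _

lemma exists_nontriv {Ω : Set E2} (h : Dom Ω) : ∃ u : E2 → ℝ, SmoothF u ∧ (∫ x in Ω, u x) = 0 ∧
    (∫ x in Ω, (u x)^2) ≠ 0 := by
  let w : E2 → ℝ := fun x => x 0
  have hw : SmoothF w := smooth_coord 0
  refine ⟨fun x => w x - mean Ω w, hw.sub contDiff_const, ?_, ?_⟩
  · rw [int_sub_const h hw.continuous, mean, div_mul_cancel₀ _ h.pos.ne', sub_self]
  · obtain ⟨x, hx⟩ := h.ne
    have hcw : Continuous fun x => w x - mean Ω w := hw.continuous.sub continuous_const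
    by_cases h0 : w x - mean Ω w = 0
    · obtain ⟨r, hr, hb⟩ := Metric.isOpen_iff.1 h.op x hx
      have hy : x + EuclideanSpace.single 0 (r/2) ∈ Ω := by
        apply hb
        simp [abs_of_pos hr]; linarith
      refine (sq_int_pos h hcw hy ?_).ne'
      simp only [w, PiLp.add_apply] at h0 ⊢
      simp
      intro h2; linarith
    · exact (sq_int_pos h hcw hx h0).ne'

lemma nEig1_ge {Ω : Set E2} (h : Dom Ω) {C : ℝ}
    (H : ∀ u : E2 → ℝ, SmoothF u → (∫ x in Ω, u x) = 0 →
      C * (∫ x in Ω, (u x)^2) ≤ ∫ x in Ω, ‖fderiv ℝ u x‖^2) : C ≤ nEig1 Ω := by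
  obtain ⟨u, hu, h0, h1⟩ := exists_nontriv h
  refine le_csInf (s := { R : ℝ | _ }) ⟨_, ⟨u, hu, h0, h1, rfl⟩⟩ ?_
  rintro R ⟨u, hu, h0, h1, rfl⟩
  rw [le_div_iff₀ (lt_of_le_of_ne (integral_nonneg fun x => by positivity) (Ne.symm h1))]
  exact H u hu h0

lemma int_sq_le_sub_const {Ω} (h : Dom Ω) {u : E2 → ℝ} (hu : Continuous u)
    (h0 : (∫ x in Ω, u x) = 0) (c : ℝ) : (∫ x in Ω, (u x)^2) ≤ ∫ x in Ω, (u x - c)^2 := by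
  rw [int_sub_const_sq h hu, h0]
  have := mul_nonneg (sq_nonneg c) h.pos.le
  linarith

lemma nEig1_near {Ω : Set E2} (h : Dom Ω) {δ : ℝ} (hδ : 0 < δ) :
    ∃ u : E2 → ℝ, SmoothF u ∧ (∫ x in Ω, u x) = 0 ∧ 0 < (∫ x in Ω, (u x)^2) ∧
      (∫ x in Ω, ‖fderiv ℝ u x‖^2) ≤ (nEig1 Ω + δ) * (∫ x in Ω, (u x)^2) := by
  obtain ⟨u, hu, h0, h1⟩ := exists_nontriv h
  obtain ⟨R, ⟨v, hv, hv0, hv1, rfl⟩, hR⟩ :=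
    exists_lt_of_csInf_lt (s := { R : ℝ | ∃ u : E2 → ℝ, ContDiff ℝ (⊤ : ℕ∞) u ∧
    (∫ x in Ω, u x) = 0 ∧ (∫ x in Ω, (u x)^2) ≠ 0 ∧
    R = (∫ x in Ω, ‖fderiv ℝ u x‖^2) / (∫ x in Ω, (u x)^2) }) (b := nEig1 Ω + δ) ⟨_, u, hu, h0, h1, rfl⟩ (lt_add_of_pos_right _ hδ)
  have hp := lt_of_le_of_ne (integral_nonneg fun x => by positivity) (Ne.symm hv1)
  exact ⟨v, hv, hv0, hp, ((div_lt_iff₀ hp).1 hR).le⟩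

lemma exists_nontrivD {Ω : Set E2} (h : Dom Ω) : ∃ u : E2 → ℝ, SmoothF u ∧ HasCompactSupport u ∧
    tsupport u ⊆ Ω ∧ (∫ x, (u x)^2) ≠ 0 := by
  obtain ⟨x, hx⟩ := h.ne
  obtain ⟨r, hr, hb⟩ := Metric.isOpen_iff.1 h.op x hx
  let f : ContDiffBump x := ⟨r/4, r/2, by positivity, by linarith⟩
  refine ⟨f, f.contDiff, f.hasCompactSupport, ?_, ?_⟩
  · rw [f.tsupport_eq]
    exact (Metric.closedBall_subset_ball (by simp [f]; linarith)).trans hb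
  · have hc : Continuous f := f.continuous
    have h1 : Integrable (fun x => (f x)^2) := by
      apply Continuous.integrable_of_hasCompactSupport (by fun_prop)
      have := f.hasCompactSupport.mul_left (f := f)
      simp only [sq]; exact this
    apply ne_of_gt
    rw [integral_pos_iff_support_of_nonneg (fun x => by positivity) h1]
    refine (isOpen_ne_fun (by fun_prop) continuous_const).measure_pos volume ⟨x, ?_⟩
    have : f x = 1 := f.one_of_mem_closedBall (by simp [f]; positivity)
    simp [this]

lemma dEig1_ge {Ω : Set E2} (h : Dom Ω) {C : ℝ}
    (H : ∀ u : E2 → ℝ, SmoothF u → HasCompactSupport u → tsupport u ⊆ Ω →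
      C * (∫ x, (u x)^2) ≤ ∫ x, ‖fderiv ℝ u x‖^2) : C ≤ dEig1 Ω := by
  obtain ⟨u, hu, h0, h2, h1⟩ := exists_nontrivD h
  refine le_csInf (s := { R : ℝ | _ }) ⟨_, ⟨u, hu, h0, h2, h1, rfl⟩⟩ ?_
  rintro R ⟨u, hu, h0, h2, h1, rfl⟩
  rw [le_div_iff₀ (lt_of_le_of_ne (integral_nonneg fun x => by positivity) (Ne.symm h1))]
  exact H u hu h0 h2

lemma dEig1_near {Ω : Set E2} (h : Dom Ω) {δ : ℝ} (hδ : 0 < δ) :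
    ∃ u : E2 → ℝ, SmoothF u ∧ HasCompactSupport u ∧ tsupport u ⊆ Ω ∧ 0 < (∫ x, (u x)^2) ∧
      (∫ x, ‖fderiv ℝ u x‖^2) ≤ (dEig1 Ω + δ) * (∫ x, (u x)^2) := by
  obtain ⟨u, hu, h0, h2, h1⟩ := exists_nontrivD h
  obtain ⟨R, ⟨v, hv, hv0, hv2, hv1, rfl⟩, hR⟩ :=
    exists_lt_of_csInf_lt (s := { R : ℝ | ∃ u : E2 → ℝ, ContDiff ℝ (⊤ : ℕ∞) u ∧
      HasCompactSupport u ∧ tsupport u ⊆ Ω ∧ (∫ x, (u x)^2) ≠ 0 ∧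
      R = (∫ x, ‖fderiv ℝ u x‖^2) / (∫ x, (u x)^2) }) (b := dEig1 Ω + δ) ⟨_, u, hu, h0, h2, h1, rfl⟩
      (lt_add_of_pos_right _ hδ)
  have hp := lt_of_le_of_ne (integral_nonneg fun x => by positivity) (Ne.symm hv1)
  exact ⟨v, hv, hv0, hv2, hp, ((div_lt_iff₀ hp).1 hR).le⟩

lemma dEig1_mono {Ω Ω' : Set E2} (h : Dom Ω) (hs : Ω ⊆ Ω') : dEig1 Ω' ≤ dEig1 Ω :=
  dEig1_ge h fun _ hu hc ht => dEig1_le hu hc (ht.trans hs)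

lemma cs_sq_int {u : E2 → ℝ} (hu : SmoothF u) (hc : HasCompactSupport u) :
    Integrable (fun x => (u x)^2) := by
  have hcu := hu.continuous
  apply Continuous.integrable_of_hasCompactSupport (by fun_prop)
  have := hc.mul_left (f := u)
  simp only [sq]; exact this

lemma cs_grad_int {u : E2 → ℝ} (hu : SmoothF u) (hc : HasCompactSupport u) :
    Integrable (fun x => ‖fderiv ℝ u x‖^2) := by
  apply Continuous.integrable_of_hasCompactSupport hu.cont_grad
  have := (hc.fderiv ℝ).norm
  have := this.mul_left (f := fun x => ‖fderiv ℝ u x‖)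
  simp only [sq]; exact this

open Pointwise in
lemma Dom.smul {Ω} (h : Dom Ω) {c : ℝ} (hc : 0 < c) : Dom (c • Ω) :=
  ⟨h.ne.smul_set, h.op.smul₀ hc.ne', h.bd.smul₀ c⟩

open Pointwise in
lemma area_smul {c : ℝ} (hc : 0 < c) (Ω : Set E2) : area (c • Ω) = c^2 * area Ω := by
  simp [area, Measure.addHaar_smul, abs_of_pos hc, ENNReal.toReal_mul, ENNReal.toReal_ofReal,
    hc.le]

lemma fderiv_comp_smul' {u : E2 → ℝ} (c : ℝ) (x : E2) :
    fderiv ℝ (fun x => u (c • x)) x = c • fderiv ℝ u (c • x) := by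
  have := fderiv_comp_smul (𝕜 := ℝ) (f := u) c (x := x)
  simpa using this

open Pointwise in
lemma int_smul {Ω : Set E2} {c : ℝ} (hc : 0 < c) (f : E2 → ℝ) :
    ∫ x in Ω, f (c • x) = (c^2)⁻¹ * ∫ x in c • Ω, f x := by
  rw [Measure.setIntegral_comp_smul _ _ _ hc.ne']
  simp [abs_of_pos hc]

open Pointwise in
lemma nEig1_smul_le {Ω} (h : Dom Ω) {c : ℝ} (hc : 0 < c) : c^2 * nEig1 (c • Ω) ≤ nEig1 Ω := by
  apply nEig1_ge h
  intro u hu h0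
  have hinv : ∀ x : E2, c⁻¹ • c • x = x := fun x => inv_smul_smul₀ hc.ne' x
  have hs : SmoothF (fun x => u (c⁻¹ • x)) := hu.comp (contDiff_const_smul c⁻¹)
  have e0 := int_smul (Ω := Ω) hc (fun x => u (c⁻¹ • x))
  have e1 := int_smul (Ω := Ω) hc (fun x => u (c⁻¹ • x)^2)
  have e2 := int_smul (Ω := Ω) hc (fun x => ‖fderiv ℝ (fun x => u (c⁻¹ • x)) x‖^2)
  simp only [fderiv_comp_smul', hinv, norm_smul, mul_pow, integral_const_mul] at e0 e1 e2
  have hc2 : 0 < c^2 := by positivity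
  have k := nEig1_le (Ω := c • Ω) hs (by
    rw [h0] at e0
    rcases mul_eq_zero.1 e0.symm with h | h
    · exact absurd h (by positivity)
    · exact h)
  simp only [fderiv_comp_smul', norm_smul, mul_pow, integral_const_mul] at k
  have e3 : ∫ x in c • Ω, u (c⁻¹ • x)^2 = c^2 * ∫ x in Ω, u x ^2 := by
    rw [e1]; field_simp
  have e4 : ‖c⁻¹‖^2 = (c^2)⁻¹ := by simp [abs_of_pos hc]
  rw [e4] at e2 k
  rw [e3] at k
  calc c^2 * nEig1 (c • Ω) * ∫ x in Ω, u x ^2 = nEig1 (c • Ω) * (c^2 * ∫ x in Ω, u x ^2) := by ring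
    _ ≤ _ := k
    _ = _ := by rw [← mul_right_inj' (inv_ne_zero hc2.ne'), e2]

open Pointwise in
lemma nEig1_smul {Ω} (h : Dom Ω) {c : ℝ} (hc : 0 < c) : c^2 * nEig1 (c • Ω) = nEig1 Ω := by
  apply le_antisymm (nEig1_smul_le h hc)
  have := nEig1_smul_le (h.smul hc) (inv_pos.2 hc)
  rw [inv_smul_smul₀ hc.ne', inv_pow, inv_mul_le_iff₀ (by positivity)] at this
  exact this

lemma int_smul_univ {c : ℝ} (_hc : 0 < c) (f : E2 → ℝ) :
    ∫ x, f (c • x) = (c^2)⁻¹ * ∫ x, f x := by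
  rw [Measure.integral_comp_smul]
  simp

open Pointwise in
lemma dEig1_smul_le {Ω} (h : Dom Ω) {c : ℝ} (hc : 0 < c) : c^2 * dEig1 (c • Ω) ≤ dEig1 Ω := by
  apply dEig1_ge h
  intro u hu hcs hts
  have hinv : ∀ x : E2, c⁻¹ • c • x = x := fun x => inv_smul_smul₀ hc.ne' x
  have hs : SmoothF (fun x => u (c⁻¹ • x)) := hu.comp (contDiff_const_smul c⁻¹)
  have e1 := int_smul_univ hc (fun x => u (c⁻¹ • x)^2)
  have e2 := int_smul_univ hc (fun x => ‖fderiv ℝ (fun x => u (c⁻¹ • x)) x‖^2)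
  simp only [fderiv_comp_smul', hinv, norm_smul, mul_pow, integral_const_mul] at e1 e2
  have hc2 : 0 < c^2 := by positivity
  have k := dEig1_le (Ω := c • Ω) hs (hcs.comp_homeomorph (Homeomorph.smulOfNeZero c⁻¹ (inv_ne_zero hc.ne'))) (by
    have := tsupport_comp_eq_preimage u (Homeomorph.smulOfNeZero c⁻¹ (inv_ne_zero hc.ne') : E2 ≃ₜ E2)
    intro x hx
    have hx : x ∈ (Homeomorph.smulOfNeZero c⁻¹ (inv_ne_zero hc.ne') : E2 ≃ₜ E2) ⁻¹' tsupport u := by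
      rw [← this]; exact hx
    rw [mem_smul_set_iff_inv_smul_mem₀ hc.ne']
    exact hts hx)
  simp only [fderiv_comp_smul', norm_smul, mul_pow, integral_const_mul] at k
  have e3 : ∫ x, u (c⁻¹ • x)^2 = c^2 * ∫ x, u x ^2 := by
    rw [e1]; field_simp
  have e4 : ‖c⁻¹‖^2 = (c^2)⁻¹ := by simp [abs_of_pos hc]
  rw [e4] at e2 k
  rw [e3] at k
  calc c^2 * dEig1 (c • Ω) * ∫ x, u x ^2 = dEig1 (c • Ω) * (c^2 * ∫ x, u x ^2) := by ring
    _ ≤ _ := k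
    _ = _ := by rw [← mul_right_inj' (inv_ne_zero hc2.ne'), e2]

open Pointwise in
lemma dEig1_smul {Ω} (h : Dom Ω) {c : ℝ} (hc : 0 < c) : c^2 * dEig1 (c • Ω) = dEig1 Ω := by
  apply le_antisymm (dEig1_smul_le h hc)
  have := dEig1_smul_le (h.smul hc) (inv_pos.2 hc)
  rw [inv_smul_smul₀ hc.ne', inv_pow, inv_mul_le_iff₀ (by positivity)] at this
  exact this

lemma unitDisc_dom : Dom unitDisc :=
  ⟨⟨0, by simp [unitDisc]⟩, Metric.isOpen_ball, Metric.isBounded_ball⟩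

lemma area_ball (c : E2) {r : ℝ} (hr : 0 ≤ r) : area (Metric.ball c r) = π * r^2 := by
  simp [area, EuclideanSpace.volume_ball_fin_two, hr, mul_comm, pi_pos.le]

lemma area_unitDisc : area unitDisc = π := by simp [unitDisc, area_ball]

/-- Segment inequality. -/
lemma seg_ineq {u : E2 → ℝ} (hu : SmoothF u) (p v : E2) :
    (u (p + v) - u p)^2 ≤ ‖v‖^2 * ∫ τ in (0:ℝ)..1, ‖fderiv ℝ u (p + τ • v)‖^2 := by
  have hd : ∀ τ ∈ uIcc (0:ℝ) 1, HasDerivAt (fun τ : ℝ => u (p + τ • v)) (fderiv ℝ u (p + τ • v) v) τ := by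
    intro τ _
    have h1 : HasFDerivAt u (fderiv ℝ u (p + τ • v)) (p + τ • v) :=
      (hu.differentiable (by simp) _).hasFDerivAt
    have h2 : HasDerivAt (fun τ : ℝ => p + τ • v) v τ := by
      simpa using ((hasDerivAt_id τ).smul_const v).const_add p
    exact h1.comp_hasDerivAt τ h2
  have hcf := hu.cont_fd
  have hc : Continuous fun τ : ℝ => fderiv ℝ u (p + τ • v) v := by fun_prop
  have hcg : Continuous fun τ : ℝ => ‖fderiv ℝ u (p + τ • v)‖^2 := by fun_prop
  have e := intervalIntegral.integral_eq_sub_of_hasDerivAt hd (hc.intervalIntegrable _ _)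
  simp only [one_smul, zero_smul, add_zero] at e
  rw [← e]
  set I := ∫ τ in (0:ℝ)..1, fderiv ℝ u (p + τ • v) v
  have h2 : 0 ≤ ∫ τ in (0:ℝ)..1, (fderiv ℝ u (p + τ • v) v - I)^2 :=
    intervalIntegral.integral_nonneg zero_le_one fun _ _ => sq_nonneg _
  have h3 : ∫ τ in (0:ℝ)..1, (fderiv ℝ u (p + τ • v) v - I)^2
      = (∫ τ in (0:ℝ)..1, (fderiv ℝ u (p + τ • v) v)^2) - I^2 := by
    have : ∀ τ : ℝ, (fderiv ℝ u (p + τ • v) v - I)^2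
      = (fderiv ℝ u (p + τ • v) v)^2 - 2 * I * (fderiv ℝ u (p + τ • v) v) + I^2 := fun τ => by ring
    simp_rw [this]
    rw [intervalIntegral.integral_add, intervalIntegral.integral_sub,
      intervalIntegral.integral_const_mul]
    · simp; ring
    all_goals exact Continuous.intervalIntegrable (by fun_prop) _ _
  have h4 : (∫ τ in (0:ℝ)..1, (fderiv ℝ u (p + τ • v) v)^2)
      ≤ ∫ τ in (0:ℝ)..1, ‖v‖^2 * ‖fderiv ℝ u (p + τ • v)‖^2 := by
    apply intervalIntegral.integral_mono_on zero_le_one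
    · exact Continuous.intervalIntegrable (by fun_prop) _ _
    · exact Continuous.intervalIntegrable (by fun_prop) _ _
    · intro τ _
      have := (fderiv ℝ u (p + τ • v)).le_opNorm v
      rw [← mul_pow, mul_comm ‖v‖, ← sq_abs, ← Real.norm_eq_abs]
      gcongr
  rw [intervalIntegral.integral_const_mul] at h4
  linarith

end

noncomputable section

/-! ### Brunn–Minkowski in the plane -/
open Pointwise in
lemma bm_one_compact {K L : Set ℝ} (hK : IsCompact K) (hL : IsCompact L) (hKn : K.Nonempty)
    (hLn : L.Nonempty) : volume K + volume L ≤ volume (K + L) := by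
  obtain ⟨a, ha, ha'⟩ := hK.exists_isGreatest hKn
  obtain ⟨b, hb, hb'⟩ := hL.exists_isLeast hLn
  have h1 : (fun x => x + b) '' K ∪ (fun x => a + x) '' L ⊆ K + L := by
    rintro x (⟨y, hy, rfl⟩ | ⟨y, hy, rfl⟩)
    · exact add_mem_add hy hb
    · exact add_mem_add ha hy
  have hm : MeasurableSet ((fun x => a + x) '' L) := (hL.image (by fun_prop)).measurableSet
  have hd : AEDisjoint volume ((fun x => x + b) '' K) ((fun x => a + x) '' L) := by
    refine measure_mono_null (t := {a + b}) ?_ (by simp)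
    rintro x ⟨⟨y, hy, rfl⟩, ⟨z, hz, hzy⟩⟩
    have := ha' hy; have := hb' hz
    simp only [mem_singleton_iff] at *
    linarith
  calc volume K + volume L = volume ((fun x => x + b) '' K) + volume ((fun x => a + x) '' L) := by
        simp
    _ = volume ((fun x => x + b) '' K ∪ (fun x => a + x) '' L) :=
        (measure_union₀ hm.nullMeasurableSet hd).symm
    _ ≤ _ := measure_mono h1

open Pointwise in
lemma bm_one {X Y : Set ℝ} (hX : IsOpen X) (hY : IsOpen Y) (hXn : X.Nonempty)
    (hYn : Y.Nonempty) : volume X + volume Y ≤ volume (X + Y) := by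
  obtain ⟨x, hx⟩ := hXn
  obtain ⟨y, hy⟩ := hYn
  rw [hX.measure_eq_iSup_isCompact, hY.measure_eq_iSup_isCompact]
  simp only [iSup_and']
  rw [iSup_subtype', iSup_subtype']
  have : Nonempty { K : Set ℝ // K ⊆ X ∧ IsCompact K } := ⟨∅, empty_subset _, isCompact_empty⟩
  have : Nonempty { K : Set ℝ // K ⊆ Y ∧ IsCompact K } := ⟨∅, empty_subset _, isCompact_empty⟩
  apply ENNReal.iSup_add_iSup_le
  rintro ⟨K, hK, hKc⟩ ⟨L, hL, hLc⟩
  calc volume K + volume L ≤ volume (insert x K) + volume (insert y L) := by gcongr <;> simp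
    _ ≤ volume (insert x K + insert y L) := bm_one_compact (hKc.insert x) (hLc.insert y)
        (insert_nonempty _ _) (insert_nonempty _ _)
    _ ≤ _ := measure_mono (add_subset_add (insert_subset hx hK) (insert_subset hy hL))

/-- slice length -/
def slice (A : Set (ℝ × ℝ)) (x : ℝ) : ℝ := (volume (Prod.mk x ⁻¹' A)).toReal

lemma slice_lt_top {A : Set (ℝ × ℝ)} (hb : Bornology.IsBounded A) (x : ℝ) :
    volume (Prod.mk x ⁻¹' A) < ⊤ := by
  have : Bornology.IsBounded (Prod.mk x ⁻¹' A) := by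
    refine (hb.image_snd).subset ?_
    intro y hy; exact ⟨(x, y), hy, rfl⟩
  exact this.measure_lt_top

lemma slice_open {A : Set (ℝ × ℝ)} (hA : IsOpen A) (hb : Bornology.IsBounded A) {c : ℝ}
    (hc : 0 ≤ c) : IsOpen {x | c < slice A x} := by
  rw [isOpen_iff_mem_nhds]
  intro x hx
  have hop : IsOpen (Prod.mk x ⁻¹' A) := hA.preimage (by fun_prop)
  have hlt : ENNReal.ofReal c < volume (Prod.mk x ⁻¹' A) := by
    rwa [ENNReal.ofReal_lt_iff_lt_toReal hc (slice_lt_top hb x).ne]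
  obtain ⟨K, hK, hKc, hKv⟩ := hop.exists_lt_isCompact hlt
  obtain ⟨U, V, hU, hV, hxU, hKV, hUV⟩ := generalized_tube_lemma (isCompact_singleton (x := x)) hKc hA
    (by rintro ⟨a, b⟩ ⟨ha, hb⟩; simp only [mem_singleton_iff] at ha; subst ha; exact hK hb)
  filter_upwards [hU.mem_nhds (hxU rfl)] with z hz
  rw [slice, ← ENNReal.ofReal_lt_iff_lt_toReal hc (slice_lt_top hb z).ne]
  exact hKv.trans_le (measure_mono fun y hy => hUV ⟨hz, hKV hy⟩)

lemma slice_meas {A : Set (ℝ × ℝ)} (hA : IsOpen A) : Measurable (slice A) :=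
  (measurable_measure_prodMk_left hA.measurableSet).ennreal_toReal

lemma slice_lintegral {A : Set (ℝ × ℝ)} (hA : IsOpen A) (hb : Bornology.IsBounded A) {M : ℝ}
    (hM : 0 < M) :
    ∫⁻ s in Ioi 0, volume {x | s * M < slice A x} = volume A / ENNReal.ofReal M := by
  have h1 := lintegral_eq_lintegral_meas_lt volume (f := fun x => slice A x / M)
    (ae_of_all _ fun x => div_nonneg ENNReal.toReal_nonneg hM.le)
    ((slice_meas hA).div_const M).aemeasurable
  simp only [lt_div_iff₀ hM] at h1
  rw [← h1, Measure.volume_eq_prod, Measure.prod_apply hA.measurableSet, div_eq_mul_inv,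
    ← lintegral_mul_const _ (measurable_measure_prodMk_left hA.measurableSet)]
  congr 1; ext x
  rw [ENNReal.ofReal_div_of_pos hM, slice, ENNReal.ofReal_toReal (slice_lt_top hb x).ne,
    div_eq_mul_inv]

lemma slice_bdd {A : Set (ℝ × ℝ)} (hb : Bornology.IsBounded A) : BddAbove (range (slice A)) := by
  have h2 := hb.image_snd
  refine ⟨(volume (Prod.snd '' A)).toReal, ?_⟩
  rintro _ ⟨x, rfl⟩
  refine ENNReal.toReal_mono h2.measure_lt_top.ne (measure_mono ?_)
  intro y hy; exact ⟨(x, y), hy, rfl⟩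

lemma slice_sup_pos {A : Set (ℝ × ℝ)} (hA : IsOpen A) (hb : Bornology.IsBounded A)
    (hn : A.Nonempty) : 0 < ⨆ x, slice A x := by
  obtain ⟨⟨x, y⟩, h⟩ := hn
  refine lt_of_lt_of_le ?_ (le_ciSup (slice_bdd hb) x)
  exact ENNReal.toReal_pos ((hA.preimage (by fun_prop)).measure_pos volume ⟨y, h⟩).ne'
    (slice_lt_top hb x).ne

open Pointwise in
lemma bm_two {A B : Set (ℝ × ℝ)} (hA : IsOpen A) (hB : IsOpen B) (hAb : Bornology.IsBounded A)
    (hBb : Bornology.IsBounded B) (hAn : A.Nonempty) (hBn : B.Nonempty) :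
    (√(volume A).toReal + √(volume B).toReal)^2 ≤ (volume (A + B)).toReal := by
  set M := ⨆ x, slice A x with hMdef
  set N := ⨆ x, slice B x with hNdef
  have hM : 0 < M := slice_sup_pos hA hAb hAn
  have hN : 0 < N := slice_sup_pos hB hBb hBn
  have hC : IsOpen (A + B) := hA.add_right
  have hCb : Bornology.IsBounded (A + B) := hAb.add hBb
  have key : ∀ s ∈ Ioo (0:ℝ) 1, volume {x | s * M < slice A x} + volume {x | s * N < slice B x}
      ≤ volume {x | s * (M + N) < slice (A + B) x} := by
    rintro s ⟨hs0, hs1⟩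
    obtain ⟨x, hx⟩ := exists_lt_of_lt_ciSup (show s * M < ⨆ x, slice A x by nlinarith)
    obtain ⟨y, hy⟩ := exists_lt_of_lt_ciSup (show s * N < ⨆ x, slice B x by nlinarith)
    refine (bm_one (slice_open hA hAb (by positivity)) (slice_open hB hBb (by positivity))
      ⟨x, hx⟩ ⟨y, hy⟩).trans (measure_mono ?_)
    rintro _ ⟨a, ha, b, hb, rfl⟩
    simp only [mem_ofPred_eq] at *
    have hane : (Prod.mk a ⁻¹' A).Nonempty := by
      by_contra h
      rw [not_nonempty_iff_eq_empty] at h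
      rw [slice, h] at ha; simp at ha; nlinarith
    have hbne : (Prod.mk b ⁻¹' B).Nonempty := by
      by_contra h
      rw [not_nonempty_iff_eq_empty] at h
      rw [slice, h] at hb; simp at hb; nlinarith
    have h1 := bm_one (hA.preimage (Continuous.prodMk_right a))
      (hB.preimage (Continuous.prodMk_right b)) hane hbne
    have h2 : volume (Prod.mk a ⁻¹' A + Prod.mk b ⁻¹' B) ≤ volume (Prod.mk (a + b) ⁻¹' (A + B)) := by
      refine measure_mono ?_
      rintro _ ⟨p, hp, q, hq, rfl⟩
      exact ⟨(a, p), hp, (b, q), hq, rfl⟩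
    have h3 := ENNReal.toReal_mono (slice_lt_top hCb (a + b)).ne (h1.trans h2)
    rw [ENNReal.toReal_add (slice_lt_top hAb a).ne (slice_lt_top hBb b).ne] at h3
    simp only [slice] at *
    linarith
  have hz : ∀ {A : Set (ℝ × ℝ)} (_ : Bornology.IsBounded A) {M : ℝ}, M = (⨆ x, slice A x) → 0 < M →
      ∫⁻ s in Ioi 0, volume {x | s * M < slice A x}
        = ∫⁻ s in Ioo 0 1, volume {x | s * M < slice A x} := by
    intro A hb M hM hMp
    rw [← lintegral_inter_add_diff (B := Ioo (0:ℝ) 1) _ (Ioi 0) measurableSet_Ioo,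
      inter_eq_self_of_subset_right Ioo_subset_Ioi_self,
      setLIntegral_congr_fun (g := fun _ => 0) (measurableSet_Ioi.diff measurableSet_Ioo)]
    · simp
    rintro s ⟨hs, hs1⟩
    have hs1 : 1 ≤ s := by
      by_contra h; exact hs1 ⟨hs, not_le.1 h⟩
    convert measure_empty (μ := volume)
    rw [eq_empty_iff_forall_notMem]
    intro x hx
    have h1 : slice A x ≤ M := hM ▸ le_ciSup (slice_bdd hb) x
    simp only [mem_ofPred_eq] at hx
    nlinarith
  have hmeas : ∀ {A : Set (ℝ × ℝ)} (M : ℝ) , 0 < M →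
      Measurable fun s : ℝ => volume {x | s * M < slice A x} := by
    intro A M hM
    apply Antitone.measurable
    intro s t hst
    refine measure_mono fun x hx => ?_
    simp only [mem_ofPred_eq] at *
    nlinarith
  have h1 : volume A / ENNReal.ofReal M + volume B / ENNReal.ofReal N
      ≤ volume (A + B) / ENNReal.ofReal (M + N) := by
    rw [← slice_lintegral hA hAb hM, ← slice_lintegral hB hBb hN,
      ← slice_lintegral hC hCb (add_pos hM hN), hz hAb hMdef hM, hz hBb hNdef hN,
      ← lintegral_add_left (hmeas _ hM)]
    refine (setLIntegral_mono' measurableSet_Ioo key).trans ?_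
    exact lintegral_mono_set Ioo_subset_Ioi_self
  set a := (volume A).toReal with ha
  set b := (volume B).toReal with hb
  have ha0 : 0 ≤ a := ENNReal.toReal_nonneg
  have hb0 : 0 ≤ b := ENNReal.toReal_nonneg
  have h2 : a / M + b / N ≤ (volume (A + B)).toReal / (M + N) := by
    have h3 := ENNReal.toReal_mono (ENNReal.div_ne_top hCb.measure_lt_top.ne
      (by simp; positivity)) h1
    rw [ENNReal.toReal_add (ENNReal.div_ne_top hAb.measure_lt_top.ne (by simp; positivity))
      (ENNReal.div_ne_top hBb.measure_lt_top.ne (by simp; positivity))] at h3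
    simpa [ENNReal.toReal_div, ENNReal.toReal_ofReal, hM.le, hN.le, (add_pos hM hN).le] using h3
  rw [le_div_iff₀ (by positivity)] at h2
  refine le_trans ?_ h2
  have e : (a / M + b / N) * (M + N) = a + b + (a * N / M + b * M / N) := by field_simp; ring
  have h5 : 2 * (√a * √b) ≤ a * N / M + b * M / N := by
    have h6 : 0 ≤ (√a * √(N / M) - √b * √(M / N))^2 := sq_nonneg _
    have e1 : √(N / M) * √(M / N) = 1 := by
      rw [← Real.sqrt_mul (by positivity)]
      rw [div_mul_div_cancel₀ hM.ne', div_self hN.ne']; simp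
    have e2 : (√a * √(N / M) - √b * √(M / N))^2
      = √a^2 * √(N/M)^2 + √b^2 * √(M/N)^2 - 2 * (√a * √b) * (√(N / M) * √(M / N)) := by ring
    rw [e2, e1, Real.sq_sqrt ha0, Real.sq_sqrt hb0, Real.sq_sqrt (by positivity),
      Real.sq_sqrt (by positivity)] at h6
    have : a * (N / M) + b * (M / N) = a * N / M + b * M / N := by ring
    linarith
  rw [e]
  have : (√a + √b)^2 = √a^2 + √b^2 + 2 * (√a * √b) := by ring
  rw [this, Real.sq_sqrt ha0, Real.sq_sqrt hb0]
  linarith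

/-- coordinates -/
def toProd (x : E2) : ℝ × ℝ := (x 0, x 1)

lemma toProd_mp : MeasurePreserving toProd := by
  have := (volume_preserving_finTwoArrow ℝ).comp (PiLp.volume_preserving_ofLp (Fin 2))
  exact this

/-- coordinates as a linear equivalence -/
def prodE : E2 ≃L[ℝ] ℝ × ℝ :=
  LinearEquiv.toContinuousLinearEquiv
    { toFun := toProd
      invFun := fun p => !₂[p.1, p.2]
      map_add' := fun x y => by simp [toProd]
      map_smul' := fun c x => by simp [toProd]
      left_inv := fun x => by ext i; fin_cases i <;> simp [toProd]
      right_inv := fun p => by simp [toProd] }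

lemma prodE_apply (x : E2) : prodE x = (x 0, x 1) := rfl
lemma prodE_symm_apply (p : ℝ × ℝ) : prodE.symm p = !₂[p.1, p.2] := rfl

lemma prodE_mp : MeasurePreserving prodE := toProd_mp

lemma prodE_symm_mp : MeasurePreserving prodE.symm :=
  MeasurePreserving.symm prodE.toHomeomorph.toMeasurableEquiv prodE_mp

lemma vol_image_prodE (A : Set E2) : volume (prodE '' A) = volume A := by
  have h := prodE_symm_mp.measure_preimage_emb (f := prodE.symm)
    prodE.symm.toHomeomorph.measurableEmbedding A
  rw [← h]; congr 1
  exact prodE.toEquiv.image_eq_preimage_symm A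

open Pointwise in
lemma bm_ball {A : Set E2} (h : Dom A) {ε : ℝ} (hε : 0 < ε) :
    area A + 2 * √π * ε * √(area A) ≤ area (Metric.thickening ε A) := by
  have h1 := bm_two (A := prodE '' A) (B := prodE '' Metric.ball 0 ε)
    (prodE.toHomeomorph.isOpenMap _ h.op) (prodE.toHomeomorph.isOpenMap _ Metric.isOpen_ball)
    (prodE.lipschitz.isBounded_image h.bd) (prodE.lipschitz.isBounded_image Metric.isBounded_ball)
    (h.ne.image _) ((Metric.nonempty_ball.2 hε).image _)
  rw [← image_add, vol_image_prodE, vol_image_prodE, vol_image_prodE, add_ball,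
    show (volume (Metric.ball (0:E2) ε)).toReal = π * ε^2 from area_ball 0 hε.le, zero_vadd,
    Real.sqrt_mul pi_pos.le, Real.sqrt_sq hε.le] at h1
  change (√(area A) + √π * ε)^2 ≤ area (Metric.thickening ε A) at h1
  have h2 : (√(area A) + √π * ε)^2 = √(area A)^2 + 2 * √π * ε * √(area A) + (√π * ε)^2 := by ring
  rw [h2, Real.sq_sqrt h.pos.le] at h1
  nlinarith [sq_nonneg (√π * ε)]
end

noncomputable section

lemma cs_bdd_fd {u : E2 → ℝ} (hu : SmoothF u) (hc : HasCompactSupport u) :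
    ∃ L, 0 < L ∧ ∀ x, ‖fderiv ℝ u x‖ ≤ L := by
  obtain ⟨L, hL⟩ := (hc.fderiv ℝ).exists_bound_of_continuous hu.cont_fd
  exact ⟨max L 1, by positivity, fun x => (hL x).trans (le_max_left _ _)⟩

lemma level_bdd {u : E2 → ℝ} (hc : HasCompactSupport u) {t : ℝ} (ht : 0 < t) :
    Bornology.IsBounded {x | t ≤ |u x|} := by
  refine hc.isCompact.isBounded.subset fun x hx => subset_tsupport _ ?_
  intro h0
  simp only [mem_ofPred_eq, h0, abs_zero] at hx
  linarith

lemma slab_meas {u : E2 → ℝ} (hcu : Continuous u) (a b : ℝ) :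
    MeasurableSet {x | a ≤ |u x| ∧ |u x| < b} := by
  have h1 : MeasurableSet {x | a ≤ |u x|} :=
    (isClosed_le (by fun_prop) (by fun_prop)).measurableSet
  have h2 : MeasurableSet {x | |u x| < b} := (isOpen_lt (by fun_prop) (by fun_prop)).measurableSet
  have e : {x | a ≤ |u x| ∧ |u x| < b} = {x | a ≤ |u x|} ∩ {x | |u x| < b} := by ext; simp
  rw [e]; exact h1.inter h2

lemma slab_aux {u : E2 → ℝ} (hu : SmoothF u) (hc : HasCompactSupport u) {t h σ ω : ℝ}
    (hσ : 0 < σ) (hσt : σ < t) (hh : 0 < h) (hω : 0 < ω) :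
    2 * √π * h * √(area {x | t + h ≤ |u x|})
      ≤ ∫ x in {x | σ ≤ |u x| ∧ |u x| < t + h}, (‖fderiv ℝ u x‖ + ω) := by
  have hcu := hu.continuous
  have hcf := hu.cont_fd
  set m := area {x | t + h ≤ |u x|} with hm
  rcases ENNReal.toReal_nonneg.eq_or_lt with h0 | hmpos
  · rw [hm, area, ← h0]
    simp only [Real.sqrt_zero, mul_zero]
    exact integral_nonneg fun x => by positivity
  obtain ⟨L, hL0, hL⟩ := cs_bdd_fd hu hc
  obtain ⟨ε₁, hε₁, huc⟩ := Metric.uniformContinuous_iff.1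
    ((hc.fderiv ℝ).uniformContinuous_of_continuous hcf) ω hω
  obtain ⟨ε, hε0, hε₁', hε₂⟩ : ∃ ε > 0, ε ≤ ε₁ ∧ ε * (L + ω) ≤ t - σ := by
    refine ⟨min ε₁ ((t - σ) / (L + ω)), ?_, min_le_left _ _, ?_⟩
    · have : 0 < t - σ := by linarith
      positivity
    · rw [← le_div_iff₀ (by positivity)]; exact min_le_right _ _
  have hmv : ∀ x y, dist y x < ε → |u y| ≤ |u x| + ε * (‖fderiv ℝ u x‖ + ω) := by
    intro x y hxy
    have h1 := (convex_ball x ε).norm_image_sub_le_of_norm_fderiv_le (𝕜 := ℝ) (f := u)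
      (C := ‖fderiv ℝ u x‖ + ω) (x := x) (y := y) (fun z _ => hu.differentiable (by simp) z)
      (fun z hz => by
        have := huc (a := z) (b := x) (lt_of_lt_of_le hz hε₁')
        rw [dist_eq_norm] at this
        have := norm_le_norm_add_norm_sub' (fderiv ℝ u z) (fderiv ℝ u x)
        linarith)
      (Metric.mem_ball_self hε0) hxy
    have h2 : |u y| ≤ |u x| + ‖u y - u x‖ := by
      have := norm_le_norm_add_norm_sub' (u y) (u x)
      simpa using this
    have h3 : (‖fderiv ℝ u x‖ + ω) * ‖y - x‖ ≤ (‖fderiv ℝ u x‖ + ω) * ε := by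
      rw [← dist_eq_norm]; gcongr
    linarith
  let S : Set (E2 × ℝ) := {p | p.2 ∈ Ioo t (t + h)} ∩ {p | |u p.1| ≤ p.2} ∩
    (⋃ y, Metric.ball y ε ×ˢ Iio (|u y|))
  have hS : MeasurableSet S := by
    refine ((measurableSet_Ioo.preimage measurable_snd).inter ?_).inter ?_
    · exact (isClosed_le (by fun_prop) (by fun_prop)).measurableSet
    · exact (isOpen_iUnion fun y => Metric.isOpen_ball.prod isOpen_Iio).measurableSet
  have hmb : Bornology.IsBounded {x | t + h ≤ |u x|} := level_bdd hc (by linarith)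
  -- lower bound
  have h1 : ENNReal.ofReal (2 * √π * ε * √m) * ENNReal.ofReal h ≤ (volume.prod volume) S := by
    rw [Measure.prod_apply_symm hS]
    calc ENNReal.ofReal (2 * √π * ε * √m) * ENNReal.ofReal h
        = ∫⁻ τ in Ioo t (t + h), ENNReal.ofReal (2 * √π * ε * √m) := by simp
      _ ≤ ∫⁻ τ in Ioo t (t + h), volume ((fun x => (x, τ)) ⁻¹' S) := by
          refine setLIntegral_mono' measurableSet_Ioo fun τ hτ => ?_
          have hd : Dom {x | τ < |u x|} := by
            refine ⟨?_, isOpen_lt (by fun_prop) (by fun_prop), ?_⟩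
            · have : ({x | t + h ≤ |u x|}).Nonempty := by
                by_contra h
                rw [not_nonempty_iff_eq_empty] at h
                rw [h] at hmpos; simp at hmpos
              obtain ⟨x, hx⟩ := this
              exact ⟨x, lt_of_lt_of_le hτ.2 hx⟩
            · exact (level_bdd hc (t := t) (by linarith)).subset fun x hx => (hτ.1.trans hx).le
          have hb := bm_ball hd hε0
          have hmA : m ≤ area {x | τ < |u x|} :=
            ENNReal.toReal_mono hd.fin.ne (measure_mono fun x hx => lt_of_lt_of_le hτ.2 hx)
          have hsub : Metric.thickening ε {x | τ < |u x|} \ {x | τ < |u x|} ⊆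
              (fun x => (x, τ)) ⁻¹' S := by
            rintro x ⟨hx1, hx2⟩
            obtain ⟨y, hy, hxy⟩ := Metric.mem_thickening_iff.1 hx1
            exact ⟨⟨hτ, show |u x| ≤ τ from not_lt.1 hx2⟩, mem_iUnion.2 ⟨y, hxy, hy⟩⟩
          refine le_trans ?_ (measure_mono hsub)
          have hbd : Bornology.IsBounded (Metric.thickening ε {x | τ < |u x|}) := hd.bd.thickening
          have hsub2 : {x | τ < |u x|} ⊆ Metric.thickening ε {x | τ < |u x|} :=
            Metric.self_subset_thickening hε0 _
          rw [measure_sdiff hsub2 hd.meas.nullMeasurableSet hd.fin.ne]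
          apply ENNReal.ofReal_le_of_le_toReal
          rw [ENNReal.toReal_sub_of_le (measure_mono hsub2) hbd.measure_lt_top.ne]
          have : √m ≤ √(area {x | τ < |u x|}) := Real.sqrt_le_sqrt hmA
          have : 2 * √π * ε * √m ≤ 2 * √π * ε * √(area {x | τ < |u x|}) := by gcongr
          simp only [area] at *
          linarith
      _ ≤ _ := setLIntegral_le_lintegral _ _
  have hmeasA : MeasurableSet {x | σ ≤ |u x| ∧ |u x| < t + h} := slab_meas hcu _ _
  have hbA : Bornology.IsBounded {x | σ ≤ |u x| ∧ |u x| < t + h} :=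
    (level_bdd hc hσ).subset fun x hx => hx.1
  have h2 : (volume.prod volume) S ≤ ∫⁻ x in {x | σ ≤ |u x| ∧ |u x| < t + h},
      ENNReal.ofReal (ε * (‖fderiv ℝ u x‖ + ω)) := by
    rw [Measure.prod_apply hS, ← lintegral_indicator hmeasA]
    refine lintegral_mono fun x => ?_
    by_cases hx : x ∈ {x | σ ≤ |u x| ∧ |u x| < t + h}
    · rw [indicator_of_mem hx]
      refine (measure_mono (t := Icc (|u x|) (|u x| + ε * (‖fderiv ℝ u x‖ + ω))) ?_).trans ?_
      · rintro τ ⟨⟨h3, h4⟩, h5⟩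
        obtain ⟨y, hy1, hy2⟩ := mem_iUnion.1 h5
        have hy1 : dist y x < ε := by rw [dist_comm]; exact hy1
        exact ⟨h4, (le_of_lt hy2).trans (hmv x y hy1)⟩
      · simp
    · rw [indicator_of_notMem hx]
      have : Prod.mk x ⁻¹' S = ∅ := by
        rw [eq_empty_iff_forall_notMem]
        rintro τ ⟨⟨h3, h4⟩, h5⟩
        obtain ⟨y, hy1, hy2⟩ := mem_iUnion.1 h5
        have hy1 : dist y x < ε := by rw [dist_comm]; exact hy1
        have hy2 : τ < |u y| := hy2
        have h4 : |u x| ≤ τ := h4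
        have h6 := hmv x y hy1
        have h7 : ε * (‖fderiv ℝ u x‖ + ω) ≤ ε * (L + ω) := by gcongr; exact hL x
        exact hx ⟨by linarith [h3.1], by linarith [h3.2]⟩
      rw [this]; simp
  have hi : IntegrableOn (fun x => ε * (‖fderiv ℝ u x‖ + ω)) {x | σ ≤ |u x| ∧ |u x| < t + h} :=
    ((Continuous.continuousOn (by fun_prop)).integrableOn_compact hbA.isCompact_closure).mono_set
      subset_closure
  have h3 := h1.trans h2
  rw [← ENNReal.ofReal_mul (by positivity), ← ofReal_integral_eq_lintegral_ofReal hi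
    (ae_of_all _ fun x => by positivity), ENNReal.ofReal_le_ofReal_iff
    (integral_nonneg fun x => by positivity), integral_const_mul] at h3
  have h4 : ε * (2 * √π * h * √m) ≤ ε * ∫ x in {x | σ ≤ |u x| ∧ |u x| < t + h},
      (‖fderiv ℝ u x‖ + ω) := by linarith
  exact le_of_mul_le_mul_left h4 hε0

lemma slab {u : E2 → ℝ} (hu : SmoothF u) (hc : HasCompactSupport u) {t h : ℝ}
    (ht : 0 < t) (hh : 0 < h) :
    2 * √π * h * √(area {x | t + h ≤ |u x|})
      ≤ ∫ x in {x | t ≤ |u x| ∧ |u x| < t + h}, ‖fderiv ℝ u x‖ := by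
  have hcu := hu.continuous
  have hcf := hu.cont_fd
  have hmeasA : ∀ σ, MeasurableSet {x | σ ≤ |u x| ∧ |u x| < t + h} := fun σ =>
    slab_meas hcu _ _
  have hbA : ∀ σ, 0 < σ → Bornology.IsBounded {x | σ ≤ |u x| ∧ |u x| < t + h} := fun σ hσ =>
    (level_bdd hc hσ).subset fun x hx => hx.1
  have hi : ∀ σ, 0 < σ → IntegrableOn (fun x => ‖fderiv ℝ u x‖) {x | σ ≤ |u x| ∧ |u x| < t + h} :=
    fun σ hσ => ((Continuous.continuousOn (by fun_prop)).integrableOn_compact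
      (hbA σ hσ).isCompact_closure).mono_set subset_closure
  have h1 : ∀ σ, 0 < σ → σ < t → 2 * √π * h * √(area {x | t + h ≤ |u x|})
      ≤ ∫ x in {x | σ ≤ |u x| ∧ |u x| < t + h}, ‖fderiv ℝ u x‖ := by
    intro σ hσ hσt
    set V := area {x | σ ≤ |u x| ∧ |u x| < t + h} with hV
    have hV0 : 0 ≤ V := ENNReal.toReal_nonneg
    refine le_of_forall_pos_le_add fun ω hω => ?_
    have := slab_aux hu hc hσ hσt hh (ω := ω / (V + 1)) (by positivity)
    rw [integral_add (hi σ hσ) (integrableOn_const (hbA σ hσ).measure_lt_top.ne)] at this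
    simp only [integral_const, MeasurableSet.univ, measureReal_restrict_apply, univ_inter,
      smul_eq_mul] at this
    have h2 : volume.real {x | σ ≤ |u x| ∧ |u x| < t + h} * (ω / (V + 1)) ≤ ω := by
      change V * (ω / (V + 1)) ≤ ω
      rw [← mul_div_assoc, div_le_iff₀ (by positivity)]; nlinarith
    linarith
  have h2 := tendsto_setIntegral_of_antitone (μ := volume) (f := fun x => ‖fderiv ℝ u x‖)
    (s := fun n : ℕ => {x | t - t / ((n:ℝ) + 2) ≤ |u x| ∧ |u x| < t + h}) (fun n => hmeasA _)
    (by
      intro a b hab x hx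
      refine ⟨le_trans ?_ hx.1, hx.2⟩
      have : (a:ℝ) ≤ b := by exact_mod_cast hab
      gcongr)
    ⟨0, hi _ (by simp; linarith)⟩
  have h3 : (⋂ n : ℕ, {x | t - t / ((n:ℝ) + 2) ≤ |u x| ∧ |u x| < t + h})
      = {x | t ≤ |u x| ∧ |u x| < t + h} := by
    ext x
    simp only [mem_iInter, mem_ofPred_eq]
    constructor
    · intro H
      refine ⟨?_, (H 0).2⟩
      have ht1 : Tendsto (fun n : ℕ => t - t / ((n:ℝ) + 2)) atTop (nhds (t - 0)) := by
        apply Tendsto.sub tendsto_const_nhds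
        apply Tendsto.div_atTop tendsto_const_nhds
        exact tendsto_atTop_add_const_right _ _ tendsto_natCast_atTop_atTop
      rw [sub_zero] at ht1
      exact le_of_tendsto' ht1 fun n => (H n).1
    · intro H n
      refine ⟨le_trans ?_ H.1, H.2⟩
      have : 0 ≤ t / ((n:ℝ) + 2) := by positivity
      linarith
  rw [h3] at h2
  refine ge_of_tendsto' h2 fun n => h1 _ ?_ ?_
  · have : t / ((n:ℝ) + 2) < t := by
      rw [div_lt_iff₀ (by positivity)]; nlinarith [(Nat.cast_nonneg n : (0:ℝ) ≤ n)]
    linarith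
  · have : 0 < t / ((n:ℝ) + 2) := by positivity
    linarith

/-- Cauchy–Schwarz on a slab -/
lemma slab_cs {u : E2 → ℝ} (hu : SmoothF u) (hc : HasCompactSupport u) {t h : ℝ}
    (ht : 0 < t) (hh : 0 < h) :
    4 * π * h^2 * area {x | t + h ≤ |u x|} ≤ (area {x | t ≤ |u x|} - area {x | t + h ≤ |u x|}) *
      ∫ x in {x | t ≤ |u x| ∧ |u x| < t + h}, ‖fderiv ℝ u x‖^2 := by
  have hcu := hu.continuous
  have hcf := hu.cont_fd
  set A := {x | t ≤ |u x| ∧ |u x| < t + h} with hA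
  have hbA : Bornology.IsBounded A := (level_bdd hc ht).subset fun x hx => hx.1
  have h_int : ∀ f : E2 → ℝ, Continuous f → IntegrableOn f A := fun f hf =>
    (hf.continuousOn.integrableOn_compact hbA.isCompact_closure).mono_set subset_closure
  have hV : area {x | t ≤ |u x|} - area {x | t + h ≤ |u x|} = volume.real A := by
    have hs : {x | t + h ≤ |u x|} ⊆ {x | t ≤ |u x|} := fun x hx => by
      simp only [mem_ofPred_eq] at *; linarith
    have : A = {x | t ≤ |u x|} \ {x | t + h ≤ |u x|} := by
      ext x; simp [hA]
    rw [this, measureReal_sdiff hs (isClosed_le (by fun_prop) (by fun_prop)).measurableSet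
      (level_bdd hc (by linarith)).measure_lt_top.ne]
    rfl
  rw [hV]
  set g : E2 → ℝ := fun x => ‖fderiv ℝ u x‖
  have hg : Continuous g := by fun_prop
  set V := volume.real A
  set I := ∫ x in A, g x
  set J := ∫ x in A, (g x)^2
  have hV0 : 0 ≤ V := measureReal_nonneg
  have h0 : 0 ≤ ∫ x in A, (V * g x - I)^2 := integral_nonneg fun x => sq_nonneg _
  have h1 : ∫ x in A, (V * g x - I)^2 = V * (V * J - I^2) := by
    have : ∀ x, (V * g x - I)^2 = V^2 * (g x)^2 - (2 * V * I) * g x + I^2 := fun x => by ring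
    simp_rw [this]
    have i1 := h_int (fun x => V^2 * (g x)^2) (by fun_prop)
    have i2 := h_int (fun x => (2 * V * I) * g x) (by fun_prop)
    have i3 := h_int (fun x => V^2 * (g x)^2 - (2 * V * I) * g x) (by fun_prop)
    rw [integral_add i3 (h_int _ continuous_const), integral_sub i1 i2, integral_const_mul,
      integral_const_mul]
    simp; ring
  have h2 : I^2 ≤ V * J := by
    rcases hV0.eq_or_lt with hv | hv
    · have : I = 0 := by
        apply setIntegral_measure_zero
        rcases (ENNReal.toReal_eq_zero_iff _).1 hv.symm with h | h
        · exact h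
        · exact absurd h hbA.measure_lt_top.ne
      rw [this, ← hv]; simp
    · rw [h1] at h0
      have := (mul_nonneg_iff_of_pos_left hv).1 h0
      linarith
  have h3 := slab hu hc ht hh
  refine le_trans ?_ h2
  have h4 := pow_le_pow_left₀ (by positivity) h3 2
  refine le_trans (le_of_eq ?_) h4
  rw [mul_pow, mul_pow, mul_pow, Real.sq_sqrt pi_pos.le, Real.sq_sqrt (show 0 ≤ area {x | t + h ≤ |u x|} from ENNReal.toReal_nonneg)]
  ring

end

noncomputable section

lemma int_radial (g : ℝ → ℝ) : ∫ x : E2, g (‖x‖^2) = π * ∫ s in Ioi 0, g s := by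
  have h1 := integral_fun_norm_addHaar (volume : Measure E2) (fun r => g (r^2))
  have h2 := integral_comp_rpow_Ioi (fun s => (π:ℝ) * g s) (p := 2) (by norm_num)
  simp only [smul_eq_mul] at h1 h2
  rw [h1, ← integral_const_mul (r := (π:ℝ)) (f := g), ← h2]
  have h3 : (volume (Metric.ball (0:E2) 1)).toReal = π := area_unitDisc
  simp only [finrank_euclideanSpace, Fintype.card_fin, Measure.real, h3]
  rw [nsmul_eq_mul, ← mul_assoc, ← integral_const_mul]
  refine setIntegral_congr_fun measurableSet_Ioi fun r hr => ?_
  simp only [Nat.cast_ofNat, abs_two, rpow_ofNat]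
  norm_num
  ring

structure Step (ε : ℝ) where
  φ : ℝ → ℝ
  σ : ℝ → ℝ
  smooth : ContDiff ℝ (⊤ : ℕ∞) σ
  der : ∀ x, HasDerivAt σ (φ x) x
  cont : Continuous φ
  nn : ∀ x, 0 ≤ φ x
  le : ∀ x, φ x ≤ 1 + ε
  z0 : ∀ x, x ≤ 0 → φ x = 0
  z1 : ∀ x, 1 ≤ x → φ x = 0
  s0 : ∀ x, x ≤ 0 → σ x = 0
  s1 : ∀ x, 1 ≤ x → σ x = 1
  snn : ∀ x, 0 ≤ σ x
  sle : ∀ x, σ x ≤ 1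
  int : ∫ x, φ x = 1

lemma exists_step {ε : ℝ} (hε : 0 < ε) : Nonempty (Step ε) := by
  set a : ℝ := 1 / (1 + ε) with ha
  have ha1 : a < 1 := by rw [ha, div_lt_one (by positivity)]; linarith
  have ha0 : 0 < a := by positivity
  let f : ContDiffBump (1/2 : ℝ) := ⟨a/2, 1/2, by positivity, by linarith⟩
  set φ : ℝ → ℝ := f.normed volume with hφ
  have hs : ContDiff ℝ (⊤ : ℕ∞) φ := f.contDiff_normed
  have hc : Continuous φ := hs.continuous
  have hsupp : Function.support φ = Metric.ball (1/2) (1/2) := f.support_normed_eq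
  have hz : ∀ x, x ∉ Ioo (0:ℝ) 1 → φ x = 0 := by
    intro x hx
    by_contra h
    have : x ∈ Function.support φ := h
    rw [hsupp, Real.ball_eq_Ioo] at this
    norm_num at this
    exact hx this
  have hnn : ∀ x, 0 ≤ φ x := fun x => f.nonneg_normed x
  have hi : ∫ x, φ x = 1 := f.integral_normed
  have hii : Integrable φ := f.integrable_normed
  have hder : ∀ x, HasDerivAt (fun x => ∫ t in (0:ℝ)..x, φ t) (φ x) x := fun x =>
    intervalIntegral.integral_hasDerivAt_right (hc.intervalIntegrable _ _)
      hc.stronglyMeasurable.stronglyMeasurableAtFilter hc.continuousAt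
  have h01 : ∫ t in (0:ℝ)..1, φ t = 1 := by
    rw [intervalIntegral.integral_of_le zero_le_one, integral_Ioc_eq_integral_Ioo]
    exact (setIntegral_eq_integral_of_forall_compl_eq_zero hz).trans hi
  have hmono : Monotone (fun x => ∫ t in (0:ℝ)..x, φ t) := by
    apply monotone_of_deriv_nonneg (fun x => (hder x).differentiableAt)
    intro x; rw [(hder x).deriv]; exact hnn x
  have hs0 : ∀ x, x ≤ 0 → ∫ t in (0:ℝ)..x, φ t = 0 := by
    intro x hx
    rw [intervalIntegral.integral_congr (g := fun _ => 0)]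
    · simp
    · intro t ht
      rw [uIcc_of_ge hx] at ht
      exact hz t fun h => by linarith [h.1, ht.2]
  have hs1 : ∀ x, 1 ≤ x → ∫ t in (0:ℝ)..x, φ t = 1 := by
    intro x hx
    rw [← intervalIntegral.integral_add_adjacent_intervals (b := 1) (hc.intervalIntegrable _ _)
      (hc.intervalIntegrable _ _), h01, intervalIntegral.integral_congr (g := fun _ => 0)]
    · simp
    · intro t ht
      rw [uIcc_of_le hx] at ht
      exact hz t fun h => by linarith [h.2, ht.1]
  refine ⟨⟨φ, fun x => ∫ t in (0:ℝ)..x, φ t, ?_, hder, hc, hnn, ?_, fun x hx => hz x fun h => by linarith [h.1],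
    fun x hx => hz x fun h => by linarith [h.2], hs0, hs1, ?_, ?_, hi⟩⟩
  · rw [contDiff_infty_iff_deriv]
    refine ⟨fun x => (hder x).differentiableAt, ?_⟩
    have : deriv (fun x => ∫ t in (0:ℝ)..x, φ t) = φ := by ext x; exact (hder x).deriv
    rw [this]; exact hs
  · intro x
    refine (f.normed_le_div_measure_closedBall_rIn volume x).trans ?_
    have : f.rIn = a/2 := rfl
    simp only [this, Measure.real, Real.volume_closedBall]
    rw [ENNReal.toReal_ofReal (by positivity), ha]
    field_simp; exact le_rfl
  · intro x
    rcases le_total x 0 with h | h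
    · exact (hs0 x h).ge
    · have := hmono h; simpa using this
  · intro x
    rcases le_total x 1 with h | h
    · have := hmono h; simp only [h01] at this; exact this
    · exact (hs1 x h).le

lemma sum_sq_of_disj {n : ℕ} {a : ℕ → ℝ} (h : ∀ i j, i < j → j < n → a i * a j = 0) :
    (∑ i ∈ Finset.range n, a i)^2 = ∑ i ∈ Finset.range n, (a i)^2 := by
  rw [sq, Finset.sum_mul_sum]
  refine Finset.sum_congr rfl fun i hi => ?_
  rw [Finset.sum_eq_single i]
  · ring
  · intro j hj hij
    rw [Finset.mem_range] at hi hj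
    rcases lt_or_gt_of_ne hij with h1 | h1
    · rw [mul_comm]; exact h j i h1 hi
    · exact h i j h1 hj
  · intro h1; exact absurd hi h1

/-- Radial competitor. -/
lemma competitor {ε h R : ℝ} (hε : 0 < ε) (hh : 0 < h) {K : ℕ} {s : ℕ → ℝ}
    (hs : ∀ k < K, s (k+1) < s k) (hsK : 0 ≤ s K) (hR : s 0 < R^2) (hR0 : 0 < R) :
    ∃ v : E2 → ℝ, SmoothF v ∧ HasCompactSupport v ∧ tsupport v ⊆ Metric.ball 0 R ∧
      (∀ x, v x ≤ K * h) ∧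
      (∀ x, h * (∑ k ∈ Finset.range K, if ‖x‖^2 ≤ s (k+1) then 1 else 0) ≤ v x) ∧
      ∫ x, ‖fderiv ℝ v x‖^2 ≤
        (1 + ε) * ∑ k ∈ Finset.range K, 4 * π * h^2 * (s k / (s k - s (k+1))) := by
  obtain ⟨S⟩ := exists_step hε
  have hanti : ∀ i j, i ≤ j → j ≤ K → s j ≤ s i := by
    intro i j hij
    induction j, hij using Nat.le_induction with
    | base => intro _; exact le_rfl
    | succ j hj ih => intro hjK; exact (hs j (by omega)).le.trans (ih (by omega))
  set F : ℝ → ℝ := fun r => ∑ k ∈ Finset.range K, h * S.σ ((s k - r) / (s k - s (k+1))) with hF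
  set F' : ℝ → ℝ := fun r => ∑ k ∈ Finset.range K,
    h * (S.φ ((s k - r) / (s k - s (k+1))) * (-1 / (s k - s (k+1)))) with hF'
  have hFs : ContDiff ℝ (⊤ : ℕ∞) F := by
    apply ContDiff.sum
    intro k _
    apply contDiff_const.mul
    apply S.smooth.comp
    fun_prop
  have hFd : ∀ r, HasDerivAt F (F' r) r := by
    intro r
    apply HasDerivAt.fun_sum
    intro k _
    apply HasDerivAt.const_mul
    refine (S.der _).comp r ?_
    have := ((hasDerivAt_id r).const_sub (s k)).div_const (s k - s (k+1))
    simpa using this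
  have hsm : SmoothF (fun x : E2 => F (‖x‖^2)) := hFs.comp (contDiff_norm_sq ℝ)
  have hzero : ∀ x : E2, s 0 < ‖x‖^2 → F (‖x‖^2) = 0 := by
    intro x hx
    apply Finset.sum_eq_zero
    intro k hk
    rw [Finset.mem_range] at hk
    rw [S.s0, mul_zero]
    apply div_nonpos_of_nonpos_of_nonneg
    · have := hanti 0 k (by omega) (by omega); linarith
    · linarith [hs k hk]
  obtain ⟨R1, hR1, hR1R, hR1s⟩ : ∃ R1, 0 ≤ R1 ∧ R1 < R ∧ s 0 ≤ R1^2 := by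
    have h0 : 0 ≤ s 0 := hsK.trans (hanti 0 K (by omega) le_rfl)
    refine ⟨√(s 0), Real.sqrt_nonneg _, ?_, (Real.sq_sqrt h0).ge⟩
    rw [Real.sqrt_lt' hR0]; exact hR
  have hts : tsupport (fun x : E2 => F (‖x‖^2)) ⊆ Metric.closedBall 0 R1 := by
    apply closure_minimal _ Metric.isClosed_closedBall
    intro x hx
    rw [mem_closedBall_zero_iff]
    by_contra hlt
    push Not at hlt
    exact hx (hzero x (by nlinarith))
  refine ⟨fun x => F (‖x‖^2), hsm, ?_, hts.trans (Metric.closedBall_subset_ball hR1R), ?_, ?_, ?_⟩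
  · exact (isCompact_closedBall _ _).of_isClosed_subset (isClosed_tsupport _) hts
  · intro x
    calc F (‖x‖^2) ≤ ∑ k ∈ Finset.range K, h := by
          apply Finset.sum_le_sum; intro k _
          have := S.sle ((s k - ‖x‖^2) / (s k - s (k+1)))
          nlinarith
      _ = K * h := by simp
  · intro x
    rw [Finset.mul_sum]
    apply Finset.sum_le_sum; intro k hk
    rw [Finset.mem_range] at hk
    split_ifs with hx
    · rw [S.s1]
      rw [le_div_iff₀ (by linarith [hs k hk])]; linarith
    · simpa using mul_nonneg hh.le (S.snn _)
  · have hgrad : ∀ x : E2, ‖fderiv ℝ (fun x : E2 => F (‖x‖^2)) x‖^2 = 4 * ‖x‖^2 * (F' (‖x‖^2))^2 := by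
      intro x
      have h1 : HasFDerivAt (fun x : E2 => F (‖x‖^2)) (F' (‖x‖^2) • (2 • innerSL ℝ x)) x :=
        (hFd _).comp_hasFDerivAt x (hasStrictFDerivAt_norm_sq x).hasFDerivAt
      rw [h1.fderiv, norm_smul, mul_pow, ← Nat.cast_smul_eq_nsmul ℝ 2, norm_smul]
      simp only [Nat.cast_ofNat, norm_ofNat, innerSL_apply_norm, Real.norm_eq_abs, sq_abs]
      ring
    simp_rw [hgrad]
    rw [int_radial (fun r => 4 * r * (F' r)^2)]
    have hφi : Integrable S.φ := by
      apply S.cont.integrable_of_hasCompactSupport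
      apply HasCompactSupport.intro (isCompact_Icc (a := (0:ℝ)) (b := 1))
      intro x hx
      rcases le_or_gt x 0 with h1 | h1
      · exact S.z0 x h1
      · refine S.z1 x ?_
        by_contra h2; exact hx ⟨h1.le, (not_le.1 h2).le⟩
    have hφk : ∀ k < K, Integrable (fun r => S.φ ((s k - r) / (s k - s (k+1)))) ∧
        ∫ r, S.φ ((s k - r) / (s k - s (k+1))) = s k - s (k+1) := by
      intro k hk
      have hpos : 0 < s k - s (k+1) := by linarith [hs k hk]
      constructor
      · exact (hφi.comp_div hpos.ne').comp_sub_left (s k)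
      · rw [integral_sub_left_eq_self (fun r => S.φ (r / (s k - s (k+1)))) volume (s k),
          Measure.integral_comp_div, S.int, abs_of_pos hpos]
        simp
    set G : ℝ → ℝ := fun r => ∑ k ∈ Finset.range K, (4 * s k * h^2 * (1 + ε) / (s k - s (k+1))^2) *
      S.φ ((s k - r) / (s k - s (k+1))) with hG
    have hGi : Integrable G := by
      apply integrable_finsetSum
      intro k hk
      exact (hφk k (Finset.mem_range.1 hk)).1.const_mul _
    have hsn : ∀ k ≤ K, 0 ≤ s k := fun k hk => hsK.trans (hanti k K hk le_rfl)
    have hG0 : ∀ r, 0 ≤ G r := by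
      intro r
      apply Finset.sum_nonneg
      intro k hk
      have := hsn k (Finset.mem_range.1 hk).le
      have := S.nn ((s k - r) / (s k - s (k+1)))
      positivity
    have hle : ∀ r ∈ Ioi (0:ℝ), 4 * r * (F' r)^2 ≤ G r := by
      intro r hr
      have hr : 0 < r := hr
      rw [hF', sum_sq_of_disj]
      · rw [Finset.mul_sum]
        apply Finset.sum_le_sum
        intro k hk
        rw [Finset.mem_range] at hk
        have hpos : 0 < s k - s (k+1) := by linarith [hs k hk]
        set p := S.φ ((s k - r) / (s k - s (k+1))) with hp
        have hp0 : 0 ≤ p := S.nn _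
        have hp1 : p ≤ 1 + ε := S.le _
        by_cases hrs : s k ≤ r
        · have : p = 0 := S.z0 _ (div_nonpos_of_nonpos_of_nonneg (by linarith) hpos.le)
          rw [this]; simp
        · push Not at hrs
          have e : 4 * r * (h * (p * (-1 / (s k - s (k+1)))))^2
            = 4 * h^2 / (s k - s (k+1))^2 * (r * (p * p)) := by field_simp
          have e2 : 4 * s k * h^2 * (1 + ε) / (s k - s (k+1))^2 * p
            = 4 * h^2 / (s k - s (k+1))^2 * (s k * ((1 + ε) * p)) := by field_simp
          rw [e, e2]
          have := hsn k hk.le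
          gcongr
      · intro i j hij hj
        have hi : 0 < s i - s (i+1) := by linarith [hs i (by omega)]
        have hj' : 0 < s j - s (j+1) := by linarith [hs j hj]
        have hij' := hanti (i+1) j (by omega) hj.le
        by_cases hrs : s j ≤ r
        · have : S.φ ((s j - r) / (s j - s (j+1))) = 0 :=
            S.z0 _ (div_nonpos_of_nonpos_of_nonneg (by linarith) hj'.le)
          rw [this]; simp
        · have : S.φ ((s i - r) / (s i - s (i+1))) = 0 :=
            S.z1 _ (by rw [le_div_iff₀ hi]; push Not at hrs; linarith)
          rw [this]; simp
    calc π * ∫ r in Ioi 0, 4 * r * (F' r)^2 ≤ π * ∫ r in Ioi 0, G r := by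
          refine mul_le_mul_of_nonneg_left ?_ pi_pos.le
          apply integral_mono_of_nonneg
          · filter_upwards [self_mem_ae_restrict measurableSet_Ioi] with r hr
            have : 0 < r := hr
            simp only [Pi.zero_apply]; positivity
          · exact hGi.integrableOn
          · filter_upwards [self_mem_ae_restrict measurableSet_Ioi] with r hr using hle r hr
      _ ≤ π * ∫ r, G r := by
          refine mul_le_mul_of_nonneg_left ?_ pi_pos.le
          exact setIntegral_le_integral hGi (ae_of_all _ hG0)
      _ = _ := by
          rw [hG, integral_finsetSum _ (fun k hk => (hφk k (Finset.mem_range.1 hk)).1.const_mul _),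
            Finset.mul_sum, Finset.mul_sum]
          refine Finset.sum_congr rfl fun k hk => ?_
          have hpos : 0 < s k - s (k+1) := by linarith [hs k (Finset.mem_range.1 hk)]
          rw [integral_const_mul, (hφk k (Finset.mem_range.1 hk)).2]
          field_simp

end

noncomputable section

lemma sum_sq_nested (K : ℕ) (p : ℕ → Prop) [DecidablePred p] (hp : ∀ k, p (k+1) → p k) :
    (∑ k ∈ Finset.range K, if p k then (1:ℝ) else 0)^2
      = ∑ k ∈ Finset.range K, (2 * k + 1) * if p k then (1:ℝ) else 0 := by
  have hp' : ∀ i j, i ≤ j → p j → p i := by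
    intro i j hij
    induction j, hij using Nat.le_induction with
    | base => exact id
    | succ j _ ih => exact fun h => ih (hp j h)
  induction K with
  | zero => simp
  | succ K ih =>
    rw [Finset.sum_range_succ, Finset.sum_range_succ, ← ih]
    by_cases h : p K
    · have : ∑ k ∈ Finset.range K, (if p k then (1:ℝ) else 0) = K := by
        rw [Finset.sum_congr rfl (g := fun _ => (1:ℝ))]
        · simp
        · intro k hk
          rw [if_pos (hp' k K (Finset.mem_range.1 hk).le h)]
      rw [this]; simp [h]; ring
    · simp [h]

lemma level_count (K : ℕ) {h w : ℝ} (h0 : 0 < h) (hw : w < (K + 1) * h) :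
    w ≤ ((∑ k ∈ Finset.range K, if (k + 1) * h ≤ w then (1:ℝ) else 0) + 1) * h := by
  induction K with
  | zero => simp at hw ⊢; exact hw.le
  | succ K ih =>
    rw [Finset.sum_range_succ]
    by_cases hK : (K + 1) * h ≤ w
    · have : ∑ k ∈ Finset.range K, (if (k + 1) * h ≤ w then (1:ℝ) else 0) = K := by
        rw [Finset.sum_congr rfl (g := fun _ => (1:ℝ))]
        · simp
        · intro k hk
          have : (k:ℝ) ≤ K := by exact_mod_cast (Finset.mem_range.1 hk).le
          rw [if_pos (by nlinarith)]
      rw [this, if_pos hK]; push_cast at hw; linarith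
    · rw [if_neg hK, add_zero]; exact ih (not_le.1 hK)

lemma int_indicator_sum {A : Set E2} (hAf : volume A ≠ ⊤) (K : ℕ)
    (c : ℕ → ℝ) (T : ℕ → Set E2) (hT : ∀ k, MeasurableSet (T k)) (hTA : ∀ k, T k ⊆ A) :
    IntegrableOn (fun x => ∑ k ∈ Finset.range K, c k * (T k).indicator 1 x) A ∧
    ∫ x in A, (∑ k ∈ Finset.range K, c k * (T k).indicator 1 x)
      = ∑ k ∈ Finset.range K, c k * area (T k) := by
  have hi : ∀ k, IntegrableOn (fun x => c k * (T k).indicator (1 : E2 → ℝ) x) A := by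
    intro k
    apply Integrable.const_mul
    rw [integrable_indicator_iff (hT k)]
    exact integrableOn_const (by
      rw [Measure.restrict_apply (hT k)]
      exact ((measure_mono inter_subset_right).trans_lt hAf.lt_top).ne)
  refine ⟨integrable_finsetSum _ fun k _ => hi k, ?_⟩
  rw [integral_finsetSum _ fun k _ => hi k]
  refine Finset.sum_congr rfl fun k _ => ?_
  rw [integral_const_mul, integral_indicator_one (hT k), measureReal_restrict_apply (hT k),
    inter_eq_self_of_subset_left (hTA k)]
  rfl

lemma ite_indicator (p : E2 → Prop) [DecidablePred p] (x : E2) :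
    (if p x then (1:ℝ) else 0) = ({x | p x}).indicator 1 x := by
  simp [indicator]

open Pointwise in
lemma ball_eq_smul {R : ℝ} (hR : 0 < R) : Metric.ball (0:E2) R = R • unitDisc := by
  rw [unitDisc, smul_ball hR.ne']; simp [abs_of_pos hR]

lemma dEig1_ball {R : ℝ} (hR : 0 < R) : R^2 * dEig1 (Metric.ball 0 R) = dEig1 unitDisc := by
  rw [ball_eq_smul hR]; exact dEig1_smul unitDisc_dom hR

set_option maxHeartbeats 1000000 in
lemma fk_aux {Ω : Set E2} (hΩ : Dom Ω) {u : E2 → ℝ} (hu : SmoothF u) (hc : HasCompactSupport u)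
    (hts : tsupport u ⊆ Ω) {W R ε h : ℝ} (hW : ∀ x, |u x| ≤ W) (hε : 0 < ε) (hh : 0 < h)
    (hR : 0 < R) (hRA : area Ω < π * R^2) :
    dEig1 unitDisc / R^2 * ((∫ x, (u x)^2) - (2 * W * h + h^2) * (area Ω + π * R^2)) ≤
      (1 + ε) * ((∫ x, ‖fderiv ℝ u x‖^2) + 4 * π * h * W) := by
  classical
  have hcu := hu.continuous
  have hW0 : 0 ≤ W := (abs_nonneg _).trans (hW 0)
  set Lv : ℕ → Set E2 := fun k => {x | (k + 1) * h ≤ |u x|} with hLv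
  have hLm : ∀ k, MeasurableSet (Lv k) := fun k =>
    (isClosed_le (by fun_prop) (by fun_prop)).measurableSet
  have hLΩ : ∀ k, Lv k ⊆ Ω := by
    intro k x hx
    apply hts; apply subset_tsupport
    intro h0
    simp only [hLv, mem_ofPred_eq, h0, abs_zero] at hx
    have : 0 < ((k:ℝ) + 1) * h := by positivity
    linarith
  set m : ℕ → ℝ := fun k => area (Lv k) with hm
  have hm0 : ∀ k, 0 ≤ m k := fun k => ENNReal.toReal_nonneg
  have hex : ∃ k, m k = 0 := by
    obtain ⟨k, hk⟩ := exists_nat_gt (W / h)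
    refine ⟨k, ?_⟩
    have : Lv k = ∅ := by
      rw [eq_empty_iff_forall_notMem]
      intro x hx
      simp only [hLv, mem_ofPred_eq] at hx
      rw [div_lt_iff₀ hh] at hk
      nlinarith [hW x]
    simp [hm, this, area]
  set K := Nat.find hex with hK
  have hmK : m K = 0 := Nat.find_spec hex
  have hmk : ∀ k < K, 0 < m k := fun k hk => lt_of_le_of_ne (hm0 k) (Ne.symm (Nat.find_min hex hk))
  have hKW : K * h ≤ W := by
    rcases Nat.eq_zero_or_pos K with h0 | h0
    · rw [h0]; simpa using hW0
    · have h1 := hmk (K - 1) (by omega)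
      have : (Lv (K-1)).Nonempty := by
        by_contra hne
        rw [not_nonempty_iff_eq_empty] at hne
        simp [hm, hne, area] at h1
      obtain ⟨x, hx⟩ := this
      have e : ((K - 1 : ℕ) : ℝ) + 1 = K := by
        have : K - 1 + 1 = K := by omega
        exact_mod_cast this
      simp only [hLv, mem_ofPred_eq, e] at hx
      exact hx.trans (hW x)
  set Ek : ℕ → ℝ := fun k => ∫ x in {x | (k+1) * h ≤ |u x| ∧ |u x| < (k+1) * h + h}, ‖fderiv ℝ u x‖^2
    with hEk
  have hEk0 : ∀ k, 0 ≤ Ek k := fun k => integral_nonneg fun x => by positivity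
  have hcs : ∀ k, 4 * π * h^2 * m (k+1) ≤ (m k - m (k+1)) * Ek k := by
    intro k
    have := slab_cs hu hc (t := (k+1) * h) (by positivity) hh
    have e : ((k+1 : ℕ) : ℝ) + 1 = k + 1 + 1 := by push_cast; ring
    have e2 : Lv (k+1) = {x | (k+1) * h + h ≤ |u x|} := by
      simp only [hLv, e]; congr 1; ext x; rw [add_mul ((k:ℝ)+1) 1 h, one_mul]
    simp only [hm, e2]; exact this
  have hdec : ∀ k < K, m (k+1) < m k := by
    intro k hk
    by_cases h1 : k + 1 < K
    · have h2 := hmk (k+1) h1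
      have h3 : 0 < 4 * π * h^2 * m (k+1) := by positivity
      have h4 := h3.trans_le (hcs k)
      by_contra h5
      push Not at h5
      have := mul_nonpos_of_nonpos_of_nonneg (sub_nonpos.2 h5) (hEk0 k)
      linarith
    · have : k + 1 = K := by omega
      rw [this, hmK]; exact hmk k hk
  set s : ℕ → ℝ := fun k => m k / π with hs
  have hπ := pi_pos
  obtain ⟨v, hv, hvc, hvt, hvle, hvge, hvE⟩ := competitor (s := s) (K := K) (R := R) hε hh
    (fun k hk => by simp only [hs]; gcongr; exact hdec k hk) (by simp [hs, hmK])
    (by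
      simp only [hs]; rw [div_lt_iff₀ hπ, mul_comm]
      refine lt_of_le_of_lt ?_ hRA
      exact ENNReal.toReal_mono hΩ.fin.ne (measure_mono (hLΩ 0))) hR
  -- energy
  have hsumE : ∑ k ∈ Finset.range K, Ek k ≤ ∫ x, ‖fderiv ℝ u x‖^2 := by
    rw [hEk, ← integral_biUnion_finset]
    · exact setIntegral_le_integral (cs_grad_int hu hc) (ae_of_all _ fun x => by positivity)
    · intro k _; exact slab_meas hcu _ _
    · intro i _ j _ hij
      rw [Function.onFun, Set.disjoint_left]
      intro x hx hy
      simp only [mem_ofPred_eq] at hx hy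
      rcases lt_or_gt_of_ne hij with h1 | h1
      · have : (i:ℝ) + 1 ≤ j := by exact_mod_cast h1
        nlinarith [hx.2, hy.1]
      · have : (j:ℝ) + 1 ≤ i := by exact_mod_cast h1
        nlinarith [hy.2, hx.1]
    · intro k _; exact (cs_grad_int hu hc).integrableOn
  have hE1 : ∑ k ∈ Finset.range K, 4 * π * h^2 * (s k / (s k - s (k+1))) ≤
      (∫ x, ‖fderiv ℝ u x‖^2) + 4 * π * h * W := by
    calc _ ≤ ∑ k ∈ Finset.range K, (Ek k + 4 * π * h^2) := by
          apply Finset.sum_le_sum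
          intro k hk
          have hd := hdec k (Finset.mem_range.1 hk)
          have hd' : 0 < m k - m (k+1) := by linarith
          have e : s k / (s k - s (k+1)) = m (k+1) / (m k - m (k+1)) + 1 := by
            simp only [hs]
            have : m k / π - m (k+1) / π = (m k - m (k+1)) / π := by ring
            rw [this]; field_simp; ring
          rw [e, mul_add, mul_one]
          gcongr
          rw [← mul_div_assoc, div_le_iff₀ hd']
          linarith [hcs k]
      _ = ∑ k ∈ Finset.range K, Ek k + 4 * π * h * (K * h) := by
          rw [Finset.sum_add_distrib]; simp; ring
      _ ≤ _ := by gcongr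
  -- L2 bounds
  have hKn : ∀ p : ℕ → Prop, (∑ k ∈ Finset.range K, if p k then (1:ℝ) else 0) ≤ K := by
    intro p
    calc _ ≤ ∑ k ∈ Finset.range K, (1:ℝ) := by
          apply Finset.sum_le_sum; intro k _; split_ifs <;> norm_num
      _ = K := by simp
  have hn0 : ∀ p : ℕ → Prop, 0 ≤ (∑ k ∈ Finset.range K, if p k then (1:ℝ) else 0) := by
    intro p; apply Finset.sum_nonneg; intro k _; split_ifs <;> norm_num
  have hL1 : ∫ x, (u x)^2 ≤ h^2 * (∑ k ∈ Finset.range K, (2 * k + 1) * m k)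
      + (2 * W * h + h^2) * area Ω := by
    obtain ⟨i1, i2⟩ := int_indicator_sum hΩ.fin.ne K (fun k => 2 * k + 1) Lv hLm hLΩ
    have e0 : ∫ x, (u x)^2 = ∫ x in Ω, (u x)^2 := by
      refine (setIntegral_eq_integral_of_forall_compl_eq_zero fun x hx => ?_).symm
      rw [image_eq_zero_of_notMem_tsupport fun h => hx (hts h)]; simp
    have iC : IntegrableOn (fun _ : E2 => 2 * W * h + h^2) Ω := hΩ.intOn continuous_const
    rw [e0, ← i2, ← integral_const_mul]
    have e1 : (2 * W * h + h^2) * area Ω = ∫ x in Ω, (2 * W * h + h^2) := by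
      simp [area, Measure.real, mul_comm]
    rw [e1, ← integral_add (i1.const_mul _) iC]
    apply setIntegral_mono_ae (hΩ.intOn (by fun_prop)) ((i1.const_mul _).add iC)
    have hae : ∀ᵐ x : E2, x ∉ Lv K := by
      rw [ae_iff]
      simp only [not_not]
      rcases (ENNReal.toReal_eq_zero_iff _).1 hmK with h | h
      · exact h
      · exact absurd h ((measure_mono (hLΩ K)).trans_lt hΩ.fin).ne
    filter_upwards [hae] with x hx
    simp only [hLv, mem_ofPred_eq, not_le] at hx
    have h1 := level_count K hh hx
    have h2 := sum_sq_nested K (fun k => (k + 1) * h ≤ |u x|) (by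
      intro k hk; push_cast at hk; nlinarith)
    have h3 := hKn (fun k => (k + 1) * h ≤ |u x|)
    have h30 := hn0 (fun k => (k + 1) * h ≤ |u x|)
    have h4 : ∑ k ∈ Finset.range K, (2 * (k:ℝ) + 1) * (Lv k).indicator 1 x
      = (∑ k ∈ Finset.range K, if (k + 1) * h ≤ |u x| then (1:ℝ) else 0)^2 := by
      rw [h2]
      refine Finset.sum_congr rfl fun k _ => ?_
      rw [ite_indicator (fun x => (k + 1) * h ≤ |u x|)]
    show _ ≤ h^2 * _ + (2 * W * h + h^2)
    rw [h4]
    set n := ∑ k ∈ Finset.range K, if (k + 1) * h ≤ |u x| then (1:ℝ) else 0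
    have h5 : n * h ≤ W := (mul_le_mul_of_nonneg_right h3 hh.le).trans hKW
    have h6 : (u x)^2 ≤ ((n + 1) * h)^2 := by
      rw [← sq_abs]; gcongr
    nlinarith
  have hL2 : h^2 * (∑ k ∈ Finset.range K, (2 * k + 1) * m k) ≤ (∫ x, (v x)^2)
      + (2 * W * h + h^2) * (π * R^2) := by
    have hbd : Dom (Metric.ball (0:E2) R) := ⟨⟨0, by simpa using hR⟩, Metric.isOpen_ball, Metric.isBounded_ball⟩
    have hsk : ∀ k, s k < R^2 := by
      intro k
      simp only [hs]; rw [div_lt_iff₀ hπ, mul_comm]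
      refine lt_of_le_of_lt ?_ hRA
      exact ENNReal.toReal_mono hΩ.fin.ne (measure_mono (hLΩ k))
    have hs0 : ∀ k, 0 ≤ s k := fun k => div_nonneg (hm0 k) hπ.le
    have hTa : ∀ k, {x : E2 | ‖x‖^2 ≤ s k} = Metric.closedBall 0 (√(s k)) := by
      intro k; ext x
      simp only [mem_ofPred_eq, mem_closedBall_zero_iff]
      rw [Real.le_sqrt (norm_nonneg _) (hs0 k)]
    obtain ⟨i1, i2⟩ := int_indicator_sum hbd.fin.ne K (fun k => 2 * k + 1)
      (fun k => {x | ‖x‖^2 ≤ s k}) (fun k => by rw [hTa]; exact Metric.isClosed_closedBall.measurableSet)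
      (fun k x hx => by
        rw [mem_ball_zero_iff]
        have h1 : ‖x‖^2 < R^2 := lt_of_le_of_lt hx (hsk k)
        exact lt_of_pow_lt_pow_left₀ 2 hR.le h1)
    have e1 : ∀ k, area {x : E2 | ‖x‖^2 ≤ s k} = m k := by
      intro k
      rw [hTa, area, EuclideanSpace.volume_closedBall_fin_two]
      rw [← ENNReal.ofReal_pow (Real.sqrt_nonneg _), Real.sq_sqrt (hs0 k), ENNReal.toReal_mul,
        ENNReal.toReal_ofReal (hs0 k)]
      have : (ENNReal.ofReal π).toReal = π := ENNReal.toReal_ofReal hπ.le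
      simp only [hs]
      erw [this]
      field_simp
    simp only [e1] at i2
    have e0 : ∫ x, (v x)^2 = ∫ x in Metric.ball 0 R, (v x)^2 := by
      refine (setIntegral_eq_integral_of_forall_compl_eq_zero fun x hx => ?_).symm
      rw [image_eq_zero_of_notMem_tsupport fun h => hx (hvt h)]; simp
    have hcv := hv.continuous
    have iV : IntegrableOn (fun x => (v x)^2) (Metric.ball 0 R) := hbd.intOn (by fun_prop)
    have iC : IntegrableOn (fun _ : E2 => 2 * W * h + h^2) (Metric.ball 0 R) := hbd.intOn continuous_const
    have e2 : (2 * W * h + h^2) * (π * R^2) = ∫ x in Metric.ball (0:E2) R, (2 * W * h + h^2) := by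
      have := area_ball 0 hR.le
      rw [← this]
      simp [area, Measure.real, mul_comm]
    rw [e0, ← i2, ← integral_const_mul, e2, ← integral_add iV iC]
    apply setIntegral_mono (i1.const_mul _) (iV.add iC)
    intro x
    have hanti : ∀ k, s (k+1) ≤ s k := by
      intro k
      simp only [hs]
      gcongr
      apply ENNReal.toReal_mono ((measure_mono (hLΩ k)).trans_lt hΩ.fin).ne (measure_mono ?_)
      intro x hx
      simp only [hLv, mem_ofPred_eq] at *
      push_cast at hx; nlinarith
    have h2 := sum_sq_nested K (fun k => ‖x‖^2 ≤ s k) (fun k hk => hk.trans (hanti k))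
    have h4 : ∑ k ∈ Finset.range K, (2 * (k:ℝ) + 1) * ({x : E2 | ‖x‖^2 ≤ s k}).indicator 1 x
      = (∑ k ∈ Finset.range K, if ‖x‖^2 ≤ s k then (1:ℝ) else 0)^2 := by
      rw [h2]
      refine Finset.sum_congr rfl fun k _ => ?_
      rw [ite_indicator (fun x => ‖x‖^2 ≤ s k)]
    show h^2 * _ ≤ (v x)^2 + (2 * W * h + h^2)
    rw [h4]
    have h30 := hn0 (fun k => ‖x‖^2 ≤ s k)
    have h31 := hn0 (fun k => ‖x‖^2 ≤ s (k+1))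
    have h5 : (∑ k ∈ Finset.range K, if ‖x‖^2 ≤ s k then (1:ℝ) else 0) ≤
        (∑ k ∈ Finset.range K, if ‖x‖^2 ≤ s (k+1) then (1:ℝ) else 0) + 1 := by
      have e := Finset.sum_range_succ' (fun k => if ‖x‖^2 ≤ s k then (1:ℝ) else 0) K
      rw [Finset.sum_range_succ] at e
      have h6 : (if ‖x‖^2 ≤ s 0 then (1:ℝ) else 0) ≤ 1 := by split_ifs <;> norm_num
      have h7 : (0:ℝ) ≤ if ‖x‖^2 ≤ s K then (1:ℝ) else 0 := by split_ifs <;> norm_num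
      linarith
    have h6 := hvge x
    have h7 := (hvle x).trans hKW
    set n := ∑ k ∈ Finset.range K, if ‖x‖^2 ≤ s k then (1:ℝ) else 0
    set n' := ∑ k ∈ Finset.range K, if ‖x‖^2 ≤ s (k+1) then (1:ℝ) else 0
    have h8 : h * n ≤ v x + h := by nlinarith
    have h9 : (h * n)^2 ≤ (v x + h)^2 := by gcongr
    have h10 : v x * h ≤ W * h := by gcongr
    nlinarith
  have hray := dEig1_le hv hvc hvt
  have hlam : dEig1 (Metric.ball (0:E2) R) = dEig1 unitDisc / R^2 := by
    rw [← dEig1_ball hR]; field_simp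
  rw [hlam] at hray
  have hl0 : 0 ≤ dEig1 unitDisc / R^2 := div_nonneg (dEig1_nonneg _) (by positivity)
  calc _ ≤ dEig1 unitDisc / R^2 * ∫ x, (v x)^2 := by
        gcongr; nlinarith
    _ ≤ _ := hray
    _ ≤ _ := hvE
    _ ≤ _ := by gcongr

/-- Faber–Krahn. -/
theorem faber_krahn {Ω : Set E2} (hΩ : Dom Ω) : π * dEig1 unitDisc ≤ area Ω * dEig1 Ω := by
  have hA := hΩ.pos
  have hπ := pi_pos
  suffices π * dEig1 unitDisc / area Ω ≤ dEig1 Ω by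
    rw [div_le_iff₀ hA] at this; linarith
  apply dEig1_ge hΩ
  intro u hu hc hts
  obtain ⟨W, hW⟩ := hc.exists_bound_of_continuous hu.continuous
  have key : ∀ R, 0 < R → area Ω < π * R^2 →
      dEig1 unitDisc / R^2 * (∫ x, (u x)^2) ≤ ∫ x, ‖fderiv ℝ u x‖^2 := by
    intro R hR hRA
    have h1 : ∀ ε : ℝ, 0 < ε → _ := fun ε hε => fk_aux hΩ hu hc hts hW hε hε hR hRA
    have c1 : Continuous fun ε : ℝ => dEig1 unitDisc / R^2 * ((∫ x, (u x)^2)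
      - (2 * W * ε + ε^2) * (area Ω + π * R^2)) := by fun_prop
    have c2 : Continuous fun ε : ℝ => (1 + ε) * ((∫ x, ‖fderiv ℝ u x‖^2) + 4 * π * ε * W) := by
      fun_prop
    have t1 := (c1.tendsto 0).mono_left (nhdsWithin_le_nhds (s := Ioi 0))
    have t2 := (c2.tendsto 0).mono_left (nhdsWithin_le_nhds (s := Ioi 0))
    have := le_of_tendsto_of_tendsto t1 t2 (by
      filter_upwards [self_mem_nhdsWithin] with ε hε using h1 ε hε)
    simpa using this
  have key2 : ∀ q, area Ω < π * q → dEig1 unitDisc * (∫ x, (u x)^2) ≤ q * ∫ x, ‖fderiv ℝ u x‖^2 := by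
    intro q hq
    have hq0 : 0 < q := by
      by_contra h; push Not at h; nlinarith
    have := key (√q) (Real.sqrt_pos.2 hq0) (by rwa [Real.sq_sqrt hq0.le])
    rw [Real.sq_sqrt hq0.le, div_mul_eq_mul_div, div_le_iff₀ hq0] at this
    linarith
  have c2 : Continuous fun q : ℝ => q * ∫ x, ‖fderiv ℝ u x‖^2 := by fun_prop
  have t2 := (c2.tendsto (area Ω / π)).mono_left (nhdsWithin_le_nhds (s := Ioi (area Ω / π)))
  have := ge_of_tendsto t2 (by
    filter_upwards [self_mem_nhdsWithin] with q hq
    have hq : area Ω / π < q := hq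
    rw [div_lt_iff₀ hπ] at hq
    exact key2 q (by linarith))
  rw [div_mul_eq_mul_div, div_le_iff₀ hA]
  rw [div_mul_eq_mul_div, le_div_iff₀ hπ] at this
  linarith

end

noncomputable section

open Topology in
/-- Differentiation under the integral sign, continuous data. -/
lemma hasDerivAt_param {F F' : ℝ → ℝ → ℝ} (a b : ℝ)
    (hF : Continuous fun p : ℝ × ℝ => F p.1 p.2)
    (hF' : Continuous fun p : ℝ × ℝ => F' p.1 p.2)
    (hd : ∀ x t, HasDerivAt (fun x => F x t) (F' x t) x) (x₀ : ℝ) :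
    HasDerivAt (fun x => ∫ t in a..b, F x t) (∫ t in a..b, F' x₀ t) x₀ := by
  have hc : IsCompact (Icc (x₀ - 1) (x₀ + 1) ×ˢ uIcc a b) := isCompact_Icc.prod isCompact_uIcc
  obtain ⟨C, hC⟩ := hc.exists_bound_of_continuousOn hF'.continuousOn
  have h1 : ∀ x, Continuous (F x) := fun x => hF.comp (by fun_prop : Continuous fun t : ℝ => (x, t))
  have h2 : ∀ x, Continuous (F' x) := fun x => hF'.comp (by fun_prop : Continuous fun t : ℝ => (x, t))
  refine (intervalIntegral.hasDerivAt_integral_of_dominated_loc_of_deriv_le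
    (s := Icc (x₀ - 1) (x₀ + 1)) (bound := fun _ => C) (Icc_mem_nhds (by linarith) (by linarith))
    (Eventually.of_forall fun x => (h1 x).aestronglyMeasurable)
    ((h1 x₀).intervalIntegrable _ _) (h2 x₀).aestronglyMeasurable ?_ (by simp) ?_).2
  · refine ae_of_all _ fun t ht x hx => hC (x, t) ⟨hx, uIoc_subset_uIcc ht⟩
  · exact ae_of_all _ fun t _ x _ => hd x t

lemma cont_param {F : ℝ → ℝ → ℝ} (a b : ℝ) (hF : Continuous fun p : ℝ × ℝ => F p.1 p.2) :
    Continuous fun x => ∫ t in a..b, F x t :=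
  intervalIntegral.continuous_parametric_intervalIntegral_of_continuous' (f := F) hF a b

def bC (x : ℝ) : ℝ := ∫ t in (0:ℝ)..π, cos (x * sin t)
def bD (x : ℝ) : ℝ := ∫ t in (0:ℝ)..π, sin t * sin (x * sin t)
def bF (x : ℝ) : ℝ := ∫ t in (0:ℝ)..π, sin t ^ 2 * cos (x * sin t)

lemma bC_deriv (x : ℝ) : HasDerivAt bC (-bD x) x := by
  have := hasDerivAt_param (F := fun x t => cos (x * sin t))
    (F' := fun x t => - (sin t * sin (x * sin t))) 0 π (by fun_prop) (by fun_prop) (by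
      intro x t
      have := ((hasDerivAt_id x).mul_const (sin t)).cos
      exact this.congr_deriv (by simp only [id]; ring)) x
  rw [intervalIntegral.integral_neg] at this
  exact this

lemma bD_deriv (x : ℝ) : HasDerivAt bD (bF x) x :=
  hasDerivAt_param (F := fun x t => sin t * sin (x * sin t))
    (F' := fun x t => sin t ^2 * cos (x * sin t)) 0 π (by fun_prop) (by fun_prop) (by
      intro x t
      have := (((hasDerivAt_id x).mul_const (sin t)).sin).const_mul (sin t)
      exact this.congr_deriv (by simp only [id]; ring)) x

lemma bF_cont : Continuous bF := cont_param _ _ (by fun_prop)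

lemma bF_eq (x : ℝ) : x * bF x = x * bC x - bD x := by
  -- d/dt (cos t * sin (x sin t)) = - sin t sin (x sin t) + x cos² t cos (x sin t)
  have h : ∫ t in (0:ℝ)..π, (x * cos (x * sin t) - x * (sin t ^ 2 * cos (x * sin t))
      - sin t * sin (x * sin t)) = 0 := by
    have h1 : ∀ t, HasDerivAt (fun t => cos t * sin (x * sin t))
      (x * cos (x * sin t) - x * (sin t ^ 2 * cos (x * sin t)) - sin t * sin (x * sin t)) t := by
      intro t
      have := (hasDerivAt_cos t).mul (((hasDerivAt_sin t).const_mul x).sin)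
      refine this.congr_deriv ?_
      have := sin_sq_add_cos_sq t
      linear_combination (x * cos (x * sin t)) * this
    rw [intervalIntegral.integral_eq_sub_of_hasDerivAt (fun t _ => h1 t)
      (Continuous.intervalIntegrable (by fun_prop) _ _)]
    simp
  rw [intervalIntegral.integral_sub (Continuous.intervalIntegrable (by fun_prop) _ _)
    (Continuous.intervalIntegrable (by fun_prop) _ _), intervalIntegral.integral_sub
    (Continuous.intervalIntegrable (by fun_prop) _ _)
    (Continuous.intervalIntegrable (by fun_prop) _ _), intervalIntegral.integral_const_mul,
    intervalIntegral.integral_const_mul] at h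
  simp only [bF, bC, bD]; linarith

lemma bF_zero : 0 < bF 0 := by
  simp [bF, integral_sin_sq]; positivity

lemma bF_pi : bF π < 0 := by
  have h1 : bF π ≤ ∫ t in (0:ℝ)..π, sin t ^ 2 * cos (2 * t) := by
    apply intervalIntegral.integral_mono_on pi_pos.le
      (Continuous.intervalIntegrable (by fun_prop) _ _)
      (Continuous.intervalIntegrable (by fun_prop) _ _)
    intro t ht
    apply mul_le_mul_of_nonneg_left _ (sq_nonneg _)
    have hs : π * sin t ≤ π := by nlinarith [sin_le_one t, pi_pos]
    rcases le_total t (π/2) with h | h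
    · have h2 := Real.mul_le_sin ht.1 h
      apply cos_le_cos_of_nonneg_of_le_pi (by linarith [ht.1]) hs
      have := mul_le_mul_of_nonneg_left h2 pi_pos.le
      calc 2 * t = π * (2 / π * t) := by field_simp
        _ ≤ _ := this
    · have h2 := Real.mul_le_sin (x := π - t) (by linarith [ht.2]) (by linarith)
      rw [sin_pi_sub] at h2
      have e : cos (2 * t) = cos (2 * (π - t)) := by
        rw [show 2 * (π - t) = 2 * π - 2 * t by ring, cos_two_pi_sub]
      rw [e]
      apply cos_le_cos_of_nonneg_of_le_pi (by linarith [ht.2]) hs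
      have := mul_le_mul_of_nonneg_left h2 pi_pos.le
      calc 2 * (π - t) = π * (2 / π * (π - t)) := by field_simp
        _ ≤ _ := this
  have h2 : ∫ t in (0:ℝ)..π, sin t ^ 2 * cos (2 * t) = - π / 4 := by
    have hd : ∀ t, HasDerivAt (fun t => sin t * cos t / 2 - t / 4 - sin t * cos t * (2 * cos t^2 - 1)/4)
        (sin t ^ 2 * cos (2 * t)) t := by
      intro t
      have h1 := (hasDerivAt_sin t).mul (hasDerivAt_cos t)
      have h3 := (((hasDerivAt_cos t).pow 2).const_mul 2).sub_const 1
      have := ((h1.div_const 2).sub ((hasDerivAt_id t).div_const 4)).sub ((h1.mul h3).div_const 4)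
      refine this.congr_deriv ?_
      simp only [Pi.mul_apply, Pi.pow_apply]
      have h5 : sin t ^2 = 1 - cos t ^2 := by linarith [sin_sq_add_cos_sq t]
      rw [cos_two_mul]
      push_cast
      ring_nf
      have h6 : sin t ^4 = (1 - cos t ^2)^2 := by rw [← h5]; ring
      simp only [h5, h6]
      ring
    rw [intervalIntegral.integral_eq_sub_of_hasDerivAt (fun t _ => hd t)
      (Continuous.intervalIntegrable (by fun_prop) _ _)]
    simp
    ring
  rw [h2] at h1
  have := pi_pos
  linarith

/-- first zero of `bF` -/
lemma exists_j : ∃ j, 0 < j ∧ bF j = 0 ∧ ∀ x ∈ Ico 0 j, 0 < bF x := by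
  set S := Icc 0 π ∩ bF ⁻¹' (Iic 0) with hS
  have hcl : IsClosed S := isClosed_Icc.inter (isClosed_Iic.preimage bF_cont)
  have hne : S.Nonempty := ⟨π, ⟨pi_pos.le, le_rfl⟩, bF_pi.le⟩
  have hbd : BddBelow S := ⟨0, fun x hx => hx.1.1⟩
  have hm := hcl.csInf_mem hne hbd
  set j := sInf S
  have hpos : ∀ x ∈ Ico 0 j, 0 < bF x := by
    intro x hx
    by_contra h
    push Not at h
    have : j ≤ x := csInf_le hbd ⟨⟨hx.1, hx.2.le.trans hm.1.2⟩, h⟩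
    linarith [hx.2]
  have hj0 : 0 < j := by
    rcases hm.1.1.lt_or_eq with h | h
    · exact h
    · have : bF j ≤ 0 := hm.2
      rw [← h] at this; linarith [bF_zero]
  refine ⟨j, hj0, le_antisymm hm.2 ?_, hpos⟩
  have t : Tendsto bF (nhdsWithin j (Iio j)) (nhds (bF j)) :=
    (bF_cont.tendsto j).mono_left nhdsWithin_le_nhds
  refine ge_of_tendsto t ?_
  filter_upwards [Ioo_mem_nhdsLT hj0] with x hx using (hpos x ⟨hx.1.le, hx.2⟩).le

/-- Szegő–Weinberger profile. -/
structure Prof (μ : ℝ) (G g : ℝ → ℝ) : Prop where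
  hμ : 0 < μ
  dG : ∀ r, HasDerivAt G (g r) r
  cg : Continuous g
  G0 : G 0 = 0
  dg : ∀ r ∈ Ioo (0:ℝ) 1, HasDerivAt g (-(g r) / r - (μ - 1 / r^2) * G r) r
  gpos : ∀ r ∈ Ico (0:ℝ) 1, 0 < g r
  gz : ∀ r, 1 ≤ r → g r = 0

lemma exists_prof : ∃ μ G g, Prof μ G g := by
  obtain ⟨j, hj, hj0, hjp⟩ := exists_j
  set g : ℝ → ℝ := fun r => bF (j * min r 1) with hg
  have cg : Continuous g := bF_cont.comp (by fun_prop)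
  have dG : ∀ r, HasDerivAt (fun r => ∫ t in (0:ℝ)..r, g t) (g r) r := fun r =>
    intervalIntegral.integral_hasDerivAt_right (cg.intervalIntegrable _ _)
      (cg.stronglyMeasurableAtFilter _ _) cg.continuousAt
  have eG : ∀ r ∈ Ico (0:ℝ) 1, ∫ t in (0:ℝ)..r, g t = bD (j * r) / j := by
    intro r hr
    have h1 : ∀ t, HasDerivAt (fun t => bD (j * t) / j) (bF (j * t)) t := by
      intro t
      have := ((bD_deriv (j * t)).comp t ((hasDerivAt_id t).const_mul j)).div_const j
      refine this.congr_deriv (by simp only [mul_one, id]; field_simp)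
    have h2 : ∫ t in (0:ℝ)..r, g t = ∫ t in (0:ℝ)..r, bF (j * t) := by
      apply intervalIntegral.integral_congr
      intro t ht
      rw [uIcc_of_le hr.1] at ht
      simp only [hg]; rw [min_eq_left (ht.2.trans hr.2.le)]
    rw [h2, intervalIntegral.integral_eq_sub_of_hasDerivAt (fun t _ => h1 t)
      ((bF_cont.comp (by fun_prop)).intervalIntegrable _ _)]
    simp [bD]
  refine ⟨j^2, fun r => ∫ t in (0:ℝ)..r, g t, g, by positivity, dG, cg, by simp, ?_, ?_, ?_⟩
  · intro r hr
    rw [eG r ⟨hr.1.le, hr.2⟩]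
    have h0 : ∀ t ∈ Ioo (0:ℝ) 1, g t = bC (j * t) - bD (j * t) / (j * t) := by
      intro t ht
      simp only [hg]; rw [min_eq_left ht.2.le]
      have := bF_eq (j * t)
      have hjt : 0 < j * t := mul_pos hj ht.1
      rw [eq_sub_iff_add_eq, ← mul_left_inj' hjt.ne', add_mul, div_mul_cancel₀ _ hjt.ne']; linarith
    have hjr : 0 < j * r := mul_pos hj hr.1
    have l1 : HasDerivAt (fun t => j * t) j r := by simpa using (hasDerivAt_id r).const_mul j
    have h1 : HasDerivAt (fun t => bC (j * t)) _ r := (bC_deriv (j * r)).comp r l1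
    have h2 : HasDerivAt (fun t => bD (j * t)) _ r := (bD_deriv (j * r)).comp r l1
    have h3 := h1.sub (h2.div l1 hjr.ne')
    have h4 : HasDerivAt g _ r := h3.congr_of_eventuallyEq (by
      filter_upwards [Ioo_mem_nhds hr.1 hr.2] with t ht using h0 t ht)
    refine h4.congr_deriv ?_
    have e : bF (j * r) = g r := by simp only [hg]; rw [min_eq_left hr.2.le]
    rw [e]
    have hr0 := hr.1
    field_simp
    ring
  · intro r hr
    simp only [hg]; rw [min_eq_left hr.2.le]
    exact hjp _ ⟨mul_nonneg hj.le hr.1, by nlinarith [hr.2]⟩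
  · intro r hr
    simp only [hg]; rw [min_eq_right hr, mul_one, hj0]

namespace Prof

lemma g_nonneg {μ : ℝ} {G g : ℝ → ℝ} (P : Prof μ G g) {r : ℝ} (hr : 0 ≤ r) : 0 ≤ g r := by
  rcases lt_or_ge r 1 with h | h
  · exact (P.gpos r ⟨hr, h⟩).le
  · rw [P.gz r h]

lemma cG {μ : ℝ} {G g : ℝ → ℝ} (P : Prof μ G g) : Continuous G := continuous_iff_continuousAt.2 fun r => (P.dG r).continuousAt

lemma mono {μ : ℝ} {G g : ℝ → ℝ} (P : Prof μ G g) : MonotoneOn G (Ici 0) := by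
  apply monotoneOn_of_deriv_nonneg (convex_Ici 0) P.cG.continuousOn
  · intro r _; exact (P.dG r).differentiableAt.differentiableWithinAt
  · intro r hr
    rw [(P.dG r).deriv]; rw [interior_Ici] at hr; exact P.g_nonneg (le_of_lt hr)

lemma G_nonneg {μ : ℝ} {G g : ℝ → ℝ} (P : Prof μ G g) {r : ℝ} (hr : 0 ≤ r) : 0 ≤ G r := by
  rw [← P.G0]; exact P.mono (mem_Ici.2 le_rfl) (mem_Ici.2 hr) hr

lemma G_pos {μ : ℝ} {G g : ℝ → ℝ} (P : Prof μ G g) {r : ℝ} (hr : 0 < r) : 0 < G r := by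
  have hs : StrictMonoOn G (Icc 0 1) := by
    apply strictMonoOn_of_deriv_pos (convex_Icc 0 1) P.cG.continuousOn
    intro x hx
    rw [interior_Icc] at hx
    rw [(P.dG x).deriv]; exact P.gpos x ⟨hx.1.le, hx.2⟩
  have h1 : 0 < G (min r 1) := by
    rw [← P.G0]
    exact hs ⟨le_rfl, zero_le_one⟩ ⟨by positivity, min_le_right _ _⟩ (by positivity)
  exact h1.trans_le (P.mono (mem_Ici.2 (by positivity)) (mem_Ici.2 hr.le) (min_le_left _ _))

lemma G_const {μ : ℝ} {G g : ℝ → ℝ} (P : Prof μ G g) {r : ℝ} (hr : 1 ≤ r) : G r = G 1 := by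
  have h : ∀ x ∈ Ici (1:ℝ), HasDerivWithinAt G 0 (Ici 1) x := fun x hx => by
    have := (P.dG x).hasDerivWithinAt (s := Ici 1)
    rwa [P.gz x hx] at this
  have := (convex_Ici (1:ℝ)).is_const_of_fderivWithin_eq_zero (𝕜 := ℝ) (f := G)
    (fun x hx => (h x hx).differentiableWithinAt) (fun x hx => by
      ext
      rw [(h x hx).hasFDerivWithinAt.fderivWithin (uniqueDiffOn_Ici 1 x hx)]; simp)
    (mem_Ici.2 hr) (mem_Ici.2 le_rfl)
  exact this

lemma ratio_tendsto {μ : ℝ} {G g : ℝ → ℝ} (P : Prof μ G g) : Tendsto (fun r => r * g r / G r) (nhdsWithin 0 (Ioi 0)) (nhds 1) := by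
  have h0 := P.gpos 0 ⟨le_rfl, one_pos⟩
  have h1 := ((P.dG 0).tendsto_slope_zero).mono_left
    (nhdsWithin_mono (0:ℝ) (fun x (hx : x ∈ Ioi (0:ℝ)) => (ne_of_gt hx : x ≠ 0)))
  have h2 := (P.cg.tendsto 0).mono_left (nhdsWithin_le_nhds (s := Ioi 0))
  have h3 := h2.div h1 h0.ne'
  rw [div_self h0.ne'] at h3
  refine h3.congr' ?_
  filter_upwards [self_mem_nhdsWithin] with r hr
  have hr' : 0 < r := hr
  simp [P.G0]
  have := P.G_pos hr'
  field_simp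

/-- Picone-type inequality. -/
lemma picone {μ : ℝ} {G g : ℝ → ℝ} (P : Prof μ G g) {W X D B : ℝ → ℝ} {κ : ℝ} (hκ : 0 ≤ κ)
    (hW : ContinuousOn W (Icc 0 1)) (hW0 : W 0 = 0) (hWn : 0 ≤ W 1)
    (hX : ContinuousOn X (Ioc 0 1))
    (hd : ∀ r ∈ Ioo (0:ℝ) 1, HasDerivAt W (2 * X r) r)
    (hQ : ∀ r ∈ Ioo (0:ℝ) 1, ∀ k, 0 ≤ D r - 2 * k * X r + k^2 * W r)
    (hB : ContinuousOn B (Icc 0 1))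
    (hle : ∀ r ∈ Ioo (0:ℝ) 1, r * D r + W r / r + 2 * κ * X r ≤ B r) :
    μ * ∫ r in (0:ℝ)..1, r * W r ≤ ∫ r in (0:ℝ)..1, B r := by
  set F : ℝ → ℝ := fun r => B r - μ * (r * W r) with hF
  have cF : ContinuousOn F (Icc 0 1) := by
    apply hB.sub
    exact continuousOn_const.mul (continuousOn_id.mul hW)
  have iF : IntervalIntegrable F volume 0 1 := cF.intervalIntegrable_of_Icc zero_le_one
  set p : ℝ → ℝ := fun r => r * g r / G r with hp
  have cp : ContinuousOn p (Ioc 0 1) := by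
    apply ContinuousOn.div (by have := P.cg; fun_prop) P.cG.continuousOn
    intro r hr; exact (P.G_pos hr.1).ne'
  have dp : ∀ r ∈ Ioo (0:ℝ) 1, HasDerivAt p (-(μ * r - 1 / r) - r * (g r / G r)^2) r := by
    intro r hr
    have hG := P.G_pos hr.1
    have := ((hasDerivAt_id r).mul (P.dg r hr)).div (P.dG r) hG.ne'
    refine this.congr_deriv ?_
    have hr0 := hr.1
    simp only [id, Pi.mul_apply]
    field_simp
    ring
  have key : ∀ ε ∈ Ioo (0:ℝ) 1, - ((p ε + κ) * W ε) ≤ ∫ r in ε..1, F r := by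
    intro ε hε
    have hsub : Icc ε 1 ⊆ Icc 0 1 := Icc_subset_Icc_left hε.1.le
    have hsub' : Icc ε 1 ⊆ Ioc 0 1 := fun x hx => ⟨hε.1.trans_le hx.1, hx.2⟩
    set f' : ℝ → ℝ := fun r => (-(μ * r - 1 / r) - r * (g r / G r)^2) * W r
      + (p r + κ) * (2 * X r) with hf'
    have cf' : ContinuousOn f' (Icc ε 1) := by
      apply ContinuousOn.add
      · apply ContinuousOn.mul _ (hW.mono hsub)
        apply ContinuousOn.sub
        · apply ContinuousOn.neg
          apply ContinuousOn.sub (by fun_prop)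
          exact continuousOn_const.div continuousOn_id fun x hx => (hε.1.trans_le hx.1).ne'
        · apply continuousOn_id.mul
          apply ContinuousOn.pow
          exact P.cg.continuousOn.div P.cG.continuousOn fun x hx => (P.G_pos (hε.1.trans_le hx.1)).ne'
      · exact ((cp.mono hsub').add continuousOn_const).mul (continuousOn_const.mul (hX.mono hsub'))
    have if' := cf'.intervalIntegrable_of_Icc (μ := volume) hε.2.le
    have h1 : ∫ r in ε..1, f' r = (p 1 + κ) * W 1 - (p ε + κ) * W ε := by
      apply intervalIntegral.integral_eq_sub_of_hasDerivAt_of_le (f := fun r => (p r + κ) * W r) hε.2.le _ _ if'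
      · exact ((cp.mono hsub').add continuousOn_const).mul (hW.mono hsub)
      · intro r hr
        have hr' : r ∈ Ioo (0:ℝ) 1 := ⟨hε.1.trans hr.1, hr.2⟩
        exact ((dp r hr').add_const κ).mul (hd r hr')
    have hp1 : p 1 = 0 := by simp [hp, P.gz 1 le_rfl]
    have h2 : ∫ r in ε..1, f' r ≤ ∫ r in ε..1, F r := by
      apply intervalIntegral.integral_mono_on_of_le_Ioo hε.2.le if'
        ((cF.mono hsub).intervalIntegrable_of_Icc hε.2.le)
      intro r hr
      have hr' : r ∈ Ioo (0:ℝ) 1 := ⟨hε.1.trans hr.1, hr.2⟩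
      have hq := hQ r hr' (g r / G r)
      have hl := hle r hr'
      have hm := mul_nonneg hr'.1.le hq
      have e : p r = r * (g r / G r) := by simp only [hp]; ring
      simp only [hf', hF, e]
      have e2 : 1 / r * W r = W r / r := by ring
      nlinarith
    rw [h1, hp1] at h2
    nlinarith [mul_nonneg hκ hWn]
  have t1 : Tendsto (fun ε => ∫ r in ε..1, F r) (nhdsWithin 0 (Ioi 0)) (nhds (∫ r in (0:ℝ)..1, F r)) := by
    have := intervalIntegral.continuousOn_primitive_interval' (a := 1) iF (by simp)
    have h2 := (this 0 (by simp)).neg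
    have e : (-fun x => ∫ t in (1:ℝ)..x, F t) = fun ε => ∫ r in ε..1, F r := by
      ext x; rw [Pi.neg_apply, ← intervalIntegral.integral_symm]
    rw [e, ContinuousWithinAt] at h2
    refine (h2.mono_left ?_)
    rw [uIcc_of_le zero_le_one]
    rw [nhdsWithin_Icc_eq_nhdsGE zero_lt_one]
    exact nhdsWithin_mono _ Ioi_subset_Ici_self
  have t2 : Tendsto (fun ε => - ((p ε + κ) * W ε)) (nhdsWithin 0 (Ioi 0)) (nhds 0) := by
    have hw : Tendsto W (nhdsWithin 0 (Ioi 0)) (nhds 0) := by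
      have := hW 0 ⟨le_rfl, zero_le_one⟩
      rw [ContinuousWithinAt, nhdsWithin_Icc_eq_nhdsGE zero_lt_one, hW0] at this
      exact this.mono_left (nhdsWithin_mono _ Ioi_subset_Ici_self)
    have := ((P.ratio_tendsto.add_const κ).mul hw).neg
    simpa using this
  have := le_of_tendsto_of_tendsto t2 t1 (by
    filter_upwards [Ioo_mem_nhdsGT zero_lt_one] with ε hε using key ε hε)
  have i2 : IntervalIntegrable (fun r => μ * (r * W r)) volume 0 1 :=
    (continuousOn_const.mul (continuousOn_id.mul hW)).intervalIntegrable_of_Icc zero_le_one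
  simp only [hF] at this
  rw [intervalIntegral.integral_sub (hB.intervalIntegrable_of_Icc zero_le_one) i2,
    intervalIntegral.integral_const_mul] at this
  linarith

end Prof
end

noncomputable section

lemma wirtinger {w w' : ℝ → ℝ} (hd : ∀ t, HasDerivAt w (w' t) t) (hc : Continuous w')
    (hp : w (-π) = w π) (h0 : ∫ t in (-π)..π, w t = 0) :
    ∫ t in (-π)..π, (w t)^2 ≤ ∫ t in (-π)..π, (w' t)^2 := by
  have hab : -π < π := by linarith [pi_pos]
  have cw : Continuous w := continuous_iff_continuousAt.2 fun r => (hd r).continuousAt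
  have mem : ∀ f : ℝ → ℝ, Continuous f → MemLp (fun t => (f t : ℂ)) 2 (volume.restrict (Ioc (-π) π)) := by
    intro f hf
    obtain ⟨C, hC⟩ := isCompact_Icc (a := -π) (b := π) |>.exists_bound_of_continuousOn hf.continuousOn
    apply MemLp.of_bound (Complex.continuous_ofReal.comp hf).aestronglyMeasurable C
    filter_upwards [ae_restrict_mem measurableSet_Ioc] with t ht
    simpa using hC t ⟨ht.1.le, ht.2⟩
  have s1 := hasSum_sq_fourierCoeffOn hab (mem w cw)
  have s2 := hasSum_sq_fourierCoeffOn hab (mem w' hc)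
  have hle : ∀ n : ℤ, ‖fourierCoeffOn hab (fun t => (w t : ℂ)) n‖^2 ≤
      ‖fourierCoeffOn hab (fun t => (w' t : ℂ)) n‖^2 := by
    intro n
    by_cases hn : n = 0
    · subst hn
      rw [fourierCoeffOn_eq_integral]
      have : ∫ t in (-π)..π, (w t : ℂ) = 0 := by
        rw [intervalIntegral.integral_ofReal, h0]; simp
      simp [this]
    · have := fourierCoeffOn_of_hasDerivAt hab (f := fun t => (w t : ℂ)) (f' := fun t => (w' t : ℂ)) hn
        (fun t _ => (hd t).ofReal_comp)
        ((Complex.continuous_ofReal.comp hc).intervalIntegrable _ _)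
      rw [this, hp, sub_self, mul_zero, zero_sub]
      gcongr
      rw [norm_mul, norm_neg, norm_mul]
      have e1 : ‖(1 / (-2 * π * Complex.I * n) : ℂ)‖ = 1 / (2 * π * |(n:ℝ)|) := by
        simp [abs_of_pos pi_pos]
      have e2 : ‖((π:ℂ) - ((-π : ℝ) : ℂ))‖ = 2 * π := by
        rw [← Complex.ofReal_sub, Complex.norm_real, Real.norm_eq_abs, abs_of_pos (by linarith)]; ring
      rw [e1, e2, ← mul_assoc]
      have h1 : (1:ℝ) ≤ |(n:ℝ)| := by exact_mod_cast Int.one_le_abs hn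
      have h2 : 1 / (2 * π * |(n:ℝ)|) * (2 * π) ≤ 1 := by
        have := pi_pos
        rw [div_mul_eq_mul_div, one_mul, div_le_one (by positivity)]
        nlinarith
      exact mul_le_of_le_one_left (norm_nonneg _) h2
  have := hasSum_le hle s1 s2
  have h2 : 0 < (π - -π)⁻¹ := by apply inv_pos.2; linarith
  simp only [smul_eq_mul, Complex.norm_real, Real.norm_eq_abs, sq_abs] at this
  exact le_of_mul_le_mul_left this h2

/-- polar point -/
def ppt (r t : ℝ) : E2 := !₂[r * cos t, r * sin t]

lemma ppt_cont : Continuous fun p : ℝ × ℝ => ppt p.1 p.2 := by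
  have : (fun p : ℝ × ℝ => ppt p.1 p.2) =
    fun p => prodE.symm (p.1 * cos p.2, p.1 * sin p.2) := by ext p; rfl
  rw [this]; exact prodE.symm.continuous.comp (by fun_prop)

lemma norm_ppt (r t : ℝ) : ‖ppt r t‖ = |r| := by
  rw [EuclideanSpace.norm_eq]
  simp only [Fin.sum_univ_two, Real.norm_eq_abs, sq_abs, ppt]
  simp
  rw [show (r * cos t)^2 + (r * sin t)^2 = r^2 * (sin t^2 + cos t^2) by ring, sin_sq_add_cos_sq,
    mul_one, Real.sqrt_sq_eq_abs]

lemma polar_disc {F : E2 → ℝ} (hF : Continuous F) :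
    ∫ x in unitDisc, F x = ∫ r in (0:ℝ)..1, r * ∫ t in (-π)..π, F (ppt r t) := by
  have h1 : ∫ x in unitDisc, F x = ∫ p : ℝ × ℝ, (unitDisc.indicator F) (prodE.symm p) := by
    rw [prodE_symm_mp.integral_comp prodE.symm.toHomeomorph.measurableEmbedding,
      integral_indicator unitDisc_dom.meas]
  rw [h1, ← integral_comp_polarCoord_symm]
  have h2 : ∫ p in polarCoord.target, p.1 • unitDisc.indicator F (prodE.symm (polarCoord.symm p))
      = ∫ p in Ioo 0 1 ×ˢ Ioo (-π) π, p.1 * F (ppt p.1 p.2) := by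
    have hsub : Ioo (0:ℝ) 1 ×ˢ Ioo (-π) π ⊆ polarCoord.target := by
      rintro ⟨r, t⟩ ⟨h, h'⟩; exact ⟨h.1, h'⟩
    refine (setIntegral_eq_of_subset_of_forall_sdiff_eq_zero (f := fun p : ℝ × ℝ => p.1 • unitDisc.indicator F (prodE.symm (polarCoord.symm p))) (μ := volume) polarCoord.open_target.measurableSet hsub ?_).trans ?_
    swap
    · apply setIntegral_congr_fun (measurableSet_Ioo.prod measurableSet_Ioo)
      rintro ⟨r, t⟩ ⟨h, h'⟩
      have e : prodE.symm (polarCoord.symm (r, t)) = ppt r t := rfl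
      have hm : ppt r t ∈ unitDisc := by
        rw [unitDisc, mem_ball_zero_iff, norm_ppt, abs_of_pos h.1]; exact h.2
      simp only [e]
      rw [indicator_of_mem hm]; rfl
    · rintro ⟨r, t⟩ ⟨h, h'⟩
      have e : prodE.symm (polarCoord.symm (r, t)) = ppt r t := rfl
      have hm : ppt r t ∉ unitDisc := by
        rw [unitDisc, mem_ball_zero_iff, norm_ppt]
        intro h1
        have h2 : 0 < r := h.1
        rw [abs_of_pos h2] at h1
        exact h' ⟨⟨h2, h1⟩, h.2⟩
      simp only [e]
      rw [indicator_of_notMem hm]; simp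
  rw [h2]
  have hcont : Continuous fun p : ℝ × ℝ => p.1 * F (ppt p.1 p.2) :=
    continuous_fst.mul (hF.comp ppt_cont)
  rw [Measure.volume_eq_prod, setIntegral_prod]
  · rw [intervalIntegral.integral_of_le zero_le_one, integral_Ioc_eq_integral_Ioo]
    refine setIntegral_congr_fun measurableSet_Ioo fun r _ => ?_
    simp only
    rw [integral_const_mul, intervalIntegral.integral_of_le (by linarith [pi_pos]),
      integral_Ioc_eq_integral_Ioo]
  · rw [← Measure.volume_eq_prod]
    exact (hcont.continuousOn.integrableOn_compact
      (isCompact_Icc.prod isCompact_Icc : IsCompact (Icc (0:ℝ) 1 ×ˢ Icc (-π) π))).mono_set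
      (prod_mono Ioo_subset_Icc_self Ioo_subset_Icc_self)

/-- Radial part. -/
lemma radial_ineq {μ : ℝ} {G g : ℝ → ℝ} (P : Prof μ G g) {a a' : ℝ → ℝ}
    (hd : ∀ r, HasDerivAt a (a' r) r) (hc : Continuous a')
    (h0 : ∫ r in (0:ℝ)..1, r * a r = 0) :
    μ * ∫ r in (0:ℝ)..1, r * (a r)^2 ≤ ∫ r in (0:ℝ)..1, r * (a' r)^2 := by
  have ca : Continuous a := continuous_iff_continuousAt.2 fun r => (hd r).continuousAt
  have hμ := P.hμ
  set A : ℝ → ℝ := fun r => ∫ s in (0:ℝ)..r, s * a s with hA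
  have dA : ∀ r, HasDerivAt A (r * a r) r := fun r =>
    intervalIntegral.integral_hasDerivAt_right
      (Continuous.intervalIntegrable (by fun_prop) _ _)
      (Continuous.stronglyMeasurableAtFilter (by fun_prop) _ _) (by fun_prop)
  have cA : Continuous A := continuous_iff_continuousAt.2 fun r => (dA r).continuousAt
  have A0 : A 0 = 0 := by simp [hA]
  have cw : ∀ r, r ≠ 0 → ContinuousAt (fun r => A r / r) r := fun r hr =>
    cA.continuousAt.div continuousAt_id hr
  have c0 : ContinuousAt (fun r => A r / r) 0 := by
    rw [continuousAt_iff_punctured_nhds]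
    have := (dA 0).tendsto_slope_zero
    simp only [zero_add, A0, sub_zero, zero_mul, smul_eq_mul] at this
    simp only [div_zero]
    exact this.congr fun r => by rw [div_eq_inv_mul]
  have cw' : Continuous fun r => A r / r := continuous_iff_continuousAt.2 fun r => by
    by_cases hr : r = 0
    · rw [hr]; exact c0
    · exact cw r hr
  have dw : ∀ r, 0 < r → HasDerivAt (fun r => A r / r) (a r - A r / r^2) r := by
    intro r hr
    have := (dA r).div (hasDerivAt_id r) hr.ne'
    refine this.congr_deriv ?_
    simp only [id]; field_simp
  have h1 := P.picone (W := fun r => (A r / r)^2) (X := fun r => (A r / r) * (a r - A r / r^2))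
    (D := fun r => (a r - A r / r^2)^2) (B := fun r => r * (a r)^2) (κ := 1) zero_le_one
    (cw'.pow 2).continuousOn (by simp) (by positivity)
    (by
      apply cw'.continuousOn.mul
      apply ca.continuousOn.sub
      exact cA.continuousOn.div (by fun_prop) fun r hr => by have := hr.1; positivity)
    (fun r hr => by
      have := (dw r hr.1).pow 2
      refine this.congr_deriv ?_
      simp; ring)
    (fun r hr k => by
      have := sq_nonneg ((a r - A r / r^2) - k * (A r / r))
      linarith)
    (by fun_prop)
    (fun r hr => by
      have hr0 := hr.1
      apply le_of_eq
      field_simp; ring)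
  have e1 : ∫ r in (0:ℝ)..1, r * (a r)^2 = - ∫ r in (0:ℝ)..1, A r * a' r := by
    have : ∀ r, HasDerivAt (fun r => A r * a r) (r * (a r)^2 + A r * a' r) r := fun r => by
      refine ((dA r).mul (hd r)).congr_deriv (by ring)
    have h2 := intervalIntegral.integral_eq_sub_of_hasDerivAt (a := 0) (b := 1) (fun t _ => this t)
      (Continuous.intervalIntegrable (by fun_prop) _ _)
    rw [intervalIntegral.integral_add (Continuous.intervalIntegrable (by fun_prop) _ _)
      (Continuous.intervalIntegrable (by fun_prop) _ _)] at h2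
    have hA1 : A 1 = 0 := h0
    simp only [A0, hA1, zero_mul, sub_zero] at h2
    linarith
  have e2 : - ∫ r in (0:ℝ)..1, A r * a' r ≤ ∫ r in (0:ℝ)..1,
      ((1 / (2 * μ)) * (r * (a' r)^2) + μ / 2 * (r * (A r / r)^2)) := by
    rw [← intervalIntegral.integral_neg]
    apply intervalIntegral.integral_mono_on_of_le_Ioo zero_le_one
      (Continuous.intervalIntegrable (by fun_prop) _ _)
      (Continuous.intervalIntegrable (by fun_prop) _ _)
    intro r hr
    have hr0 := hr.1
    have e : (1 / (2 * μ)) * (r * (a' r)^2) + μ / 2 * (r * (A r / r)^2) + A r * a' r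
      = r / (2 * μ) * (a' r + μ * (A r / r))^2 := by field_simp; ring
    have : 0 ≤ r / (2 * μ) * (a' r + μ * (A r / r))^2 := by positivity
    linarith
  rw [intervalIntegral.integral_add (Continuous.intervalIntegrable (by fun_prop) _ _)
      (Continuous.intervalIntegrable (by fun_prop) _ _), intervalIntegral.integral_const_mul,
      intervalIntegral.integral_const_mul, ← e1] at e2
  have e3 : 1 / (2 * μ) * (∫ r in (0:ℝ)..1, r * (a' r)^2) * (2 * μ) = ∫ r in (0:ℝ)..1, r * (a' r)^2 := by
    field_simp
  nlinarith [mul_le_mul_of_nonneg_right e2 (by positivity : 0 ≤ 2 * μ),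
    mul_le_mul_of_nonneg_right h1 hμ.le]

end

noncomputable section

lemma ppt_deriv_r (r t : ℝ) : HasDerivAt (fun r => ppt r t) (ppt 1 t) r := by
  have e : (fun r => ppt r t) = fun r => r • ppt 1 t := by
    ext r i; fin_cases i <;> simp [ppt]
  rw [e]
  simpa using (hasDerivAt_id r).smul_const (ppt 1 t)

/-- tangential unit vector -/
def qpt (t : ℝ) : E2 := !₂[-sin t, cos t]

lemma ppt_deriv_t (r t : ℝ) : HasDerivAt (fun t => ppt r t) (r • qpt t) t := by
  have h : HasDerivAt (fun t => ((r * cos t, r * sin t) : ℝ × ℝ)) (r * (-sin t), r * cos t) t :=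
    ((hasDerivAt_cos t).const_mul r).prodMk ((hasDerivAt_sin t).const_mul r)
  have := (prodE.symm.hasFDerivAt (x := (r * cos t, r * sin t))).comp_hasDerivAt t h
  refine (this.congr_deriv ?_)
  ext i; fin_cases i <;> simp [qpt, prodE_symm_apply]

lemma qpt_cont : Continuous qpt := by
  have : qpt = fun t => prodE.symm (-sin t, cos t) := by ext p; rfl
  rw [this]; exact prodE.symm.continuous.comp (by fun_prop)

lemma norm_sq_polar (L : E2 →L[ℝ] ℝ) (t : ℝ) : ‖L‖^2 = (L (ppt 1 t))^2 + (L (qpt t))^2 := by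
  rw [dual_norm_sq]
  have e1 : ppt 1 t = cos t • EuclideanSpace.single 0 1 + sin t • EuclideanSpace.single 1 1 := by
    ext i; fin_cases i <;> simp [ppt]
  have e2 : qpt t = (-sin t) • EuclideanSpace.single 0 1 + cos t • EuclideanSpace.single 1 1 := by
    ext i; fin_cases i <;> simp [qpt]
  rw [e1, e2]
  simp only [map_add, map_smul, smul_eq_mul]
  linear_combination (-((L (EuclideanSpace.single 0 1))^2 + (L (EuclideanSpace.single 1 1))^2)) *
    sin_sq_add_cos_sq t

lemma disc_ge {μ : ℝ} {G g : ℝ → ℝ} (P : Prof μ G g) : μ ≤ nEig1 unitDisc := by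
  apply nEig1_ge unitDisc_dom
  intro u hu h0
  have hπ := pi_pos
  have cu := hu.continuous
  have cfd := hu.cont_fd
  have hfd : ∀ x, HasFDerivAt u (fderiv ℝ u x) x := fun x =>
    (hu.differentiable (by simp) x).hasFDerivAt
  set U : ℝ → ℝ → ℝ := fun r t => u (ppt r t) with hU
  set Ur : ℝ → ℝ → ℝ := fun r t => fderiv ℝ u (ppt r t) (ppt 1 t) with hUr
  set T : ℝ → ℝ → ℝ := fun r t => fderiv ℝ u (ppt r t) (qpt t) with hT
  have c1t : Continuous fun p : ℝ × ℝ => ppt 1 p.2 :=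
    ppt_cont.comp (by fun_prop : Continuous fun p : ℝ × ℝ => ((1:ℝ), p.2))
  have cU : Continuous fun p : ℝ × ℝ => U p.1 p.2 := cu.comp ppt_cont
  have cUr : Continuous fun p : ℝ × ℝ => Ur p.1 p.2 := (cfd.comp ppt_cont).clm_apply c1t
  have cT : Continuous fun p : ℝ × ℝ => T p.1 p.2 :=
    (cfd.comp ppt_cont).clm_apply (qpt_cont.comp continuous_snd)
  have dU : ∀ r t, HasDerivAt (fun r => U r t) (Ur r t) r := fun r t =>
    (hfd (ppt r t)).comp_hasDerivAt r (ppt_deriv_r r t)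
  have dT : ∀ r t, HasDerivAt (fun t => U r t) (r * T r t) t := fun r t => by
    have := (hfd (ppt r t)).comp_hasDerivAt t (ppt_deriv_t r t)
    refine this.congr_deriv (by simp [hT])
  set a : ℝ → ℝ := fun r => (2 * π)⁻¹ * ∫ t in (-π)..π, U r t with ha
  set a' : ℝ → ℝ := fun r => (2 * π)⁻¹ * ∫ t in (-π)..π, Ur r t with ha'
  have da : ∀ r, HasDerivAt a (a' r) r := fun r =>
    (hasDerivAt_param _ _ cU cUr dU r).const_mul _
  have ca' : Continuous a' := continuous_const.mul (cont_param _ _ cUr)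
  have ca : Continuous a := continuous_const.mul (cont_param _ _ cU)
  have sec : ∀ {F : ℝ → ℝ → ℝ}, (Continuous fun p : ℝ × ℝ => F p.1 p.2) → ∀ r, Continuous (F r) :=
    fun hF r => hF.comp (by fun_prop : Continuous fun t : ℝ => (r, t))
  have cV : Continuous fun p : ℝ × ℝ => U p.1 p.2 - a p.1 := cU.sub (ca.comp continuous_fst)
  have cVr : Continuous fun p : ℝ × ℝ => Ur p.1 p.2 - a' p.1 := cUr.sub (ca'.comp continuous_fst)
  have hIa : ∀ r, ∫ t in (-π)..π, U r t = 2 * π * a r := fun r => by simp only [ha]; field_simp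
  have hIa' : ∀ r, ∫ t in (-π)..π, Ur r t = 2 * π * a' r := fun r => by simp only [ha']; field_simp
  have var : ∀ (F : ℝ → ℝ) (c : ℝ), Continuous F → ∫ t in (-π)..π, F t = 2 * π * c →
      ∫ t in (-π)..π, (F t - c)^2 = (∫ t in (-π)..π, (F t)^2) - 2 * π * c^2 := by
    intro F c hF hI
    have e : ∀ t, (F t - c)^2 = (F t)^2 - ((2 * c) * F t - c^2) := fun t => by ring
    simp_rw [e]
    rw [intervalIntegral.integral_sub (Continuous.intervalIntegrable (by fun_prop) _ _)
      (Continuous.intervalIntegrable (by fun_prop) _ _),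
      intervalIntegral.integral_sub (Continuous.intervalIntegrable (by fun_prop) _ _)
      (Continuous.intervalIntegrable (by fun_prop) _ _), intervalIntegral.integral_const_mul, hI]
    simp; ring
  set W : ℝ → ℝ := fun r => ∫ t in (-π)..π, (U r t - a r)^2 with hW
  set D : ℝ → ℝ := fun r => ∫ t in (-π)..π, (Ur r t - a' r)^2 with hD
  set X : ℝ → ℝ := fun r => ∫ t in (-π)..π, (U r t - a r) * (Ur r t - a' r) with hX
  set N : ℝ → ℝ := fun r => ∫ t in (-π)..π, ((Ur r t)^2 + (T r t)^2) with hN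
  have cW : Continuous W := cont_param _ _ (cV.pow 2)
  have cN : Continuous N := cont_param _ _ ((cUr.pow 2).add (cT.pow 2))
  have key1 := P.picone (W := W) (X := X) (D := D) (B := fun r => r * N r - 2 * π * (r * (a' r)^2))
    (κ := 0) le_rfl cW.continuousOn (by
      have : ∀ t, U 0 t = u 0 := fun t => by
        simp only [hU]; congr 1; ext i; fin_cases i <;> simp [ppt]
      have e : a 0 = u 0 := by simp only [ha, this]; simp; field_simp; norm_num
      simp only [hW, this, e]; simp)
    (intervalIntegral.integral_nonneg (by linarith) fun t _ => by positivity)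
    (cont_param _ _ (cV.mul cVr)).continuousOn
    (fun r _ => by
      have := hasDerivAt_param (F := fun r t => (U r t - a r)^2)
        (F' := fun r t => 2 * ((U r t - a r) * (Ur r t - a' r))) (-π) π (cV.pow 2)
        (continuous_const.mul (cV.mul cVr)) (fun r t => by
          refine (((dU r t).sub (da r)).pow 2).congr_deriv ?_
          simp; ring) r
      rw [intervalIntegral.integral_const_mul] at this
      exact this)
    (fun r _ k => by
      have e : D r - 2 * k * X r + k^2 * W r =
          ∫ t in (-π)..π, ((Ur r t - a' r) - k * (U r t - a r))^2 := by
        have e1 : ∀ t, ((Ur r t - a' r) - k * (U r t - a r))^2 = (Ur r t - a' r)^2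
          - (2 * k) * ((U r t - a r) * (Ur r t - a' r)) + k^2 * (U r t - a r)^2 := fun t => by ring
        have c1 := sec (F := fun r t => U r t - a r) cV r
        have c2 := sec (F := fun r t => Ur r t - a' r) cVr r
        simp_rw [e1]
        rw [intervalIntegral.integral_add (Continuous.intervalIntegrable (by fun_prop) _ _)
          (Continuous.intervalIntegrable (by fun_prop) _ _),
          intervalIntegral.integral_sub (Continuous.intervalIntegrable (by fun_prop) _ _)
          (Continuous.intervalIntegrable (by fun_prop) _ _), intervalIntegral.integral_const_mul,
          intervalIntegral.integral_const_mul]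
      rw [e]
      exact intervalIntegral.integral_nonneg (by linarith) fun t _ => by positivity)
    (by fun_prop)
    (fun r hr => by
      have hr0 := hr.1
      have e1 : D r = (∫ t in (-π)..π, (Ur r t)^2) - 2 * π * (a' r)^2 :=
        var _ _ (sec cUr r) (hIa' r)
      have e2 : W r ≤ ∫ t in (-π)..π, (r * T r t)^2 := by
        apply wirtinger (w := fun t => U r t - a r) (fun t => (dT r t).sub_const _)
          (continuous_const.mul (sec cT r))
        · simp [hU, ppt]
        · rw [intervalIntegral.integral_sub ((sec cU r).intervalIntegrable _ _) (by simp), hIa]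
          simp; ring
      have e3 : ∫ t in (-π)..π, (r * T r t)^2 = r^2 * ∫ t in (-π)..π, (T r t)^2 := by
        rw [← intervalIntegral.integral_const_mul]; congr 1; ext t; ring
      have e4 : N r = (∫ t in (-π)..π, (Ur r t)^2) + ∫ t in (-π)..π, (T r t)^2 :=
        intervalIntegral.integral_add (((sec cUr r).pow 2).intervalIntegrable _ _)
          (((sec cT r).pow 2).intervalIntegrable _ _)
      have e5 : W r / r ≤ r * ∫ t in (-π)..π, (T r t)^2 := by
        rw [div_le_iff₀ hr0]; rw [e3] at e2; linarith
      rw [e4, e1]; linarith)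
  have key2 := radial_ineq P da ca' (by
    have := polar_disc cu
    rw [h0] at this
    have e : ∀ r, r * ∫ t in (-π)..π, u (ppt r t) = 2 * π * (r * a r) := fun r => by
      rw [show (∫ t in (-π)..π, u (ppt r t)) = 2 * π * a r from hIa r]; ring
    simp_rw [e] at this
    rw [intervalIntegral.integral_const_mul] at this
    have h2 : 2 * π ≠ 0 := by positivity
    exact (mul_eq_zero.1 this.symm).resolve_left h2)
  rw [polar_disc (by fun_prop : Continuous fun x => (u x)^2), polar_disc hu.cont_grad]
  have e1 : ∀ r, r * ∫ t in (-π)..π, (u (ppt r t))^2 = r * W r + 2 * π * (r * (a r)^2) := fun r => by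
    have := var _ _ (sec cU r) (hIa r)
    have h2 : W r = _ := this
    rw [h2]; simp only [hU]; ring
  have e2 : ∀ r, r * ∫ t in (-π)..π, ‖fderiv ℝ u (ppt r t)‖^2 = r * N r := fun r => by
    simp only [hN, hUr, hT]
    simp_rw [fun t => norm_sq_polar (fderiv ℝ u (ppt r t)) t]
  simp_rw [e1, e2]
  rw [intervalIntegral.integral_sub (Continuous.intervalIntegrable (by fun_prop) _ _)
    (Continuous.intervalIntegrable (by fun_prop) _ _), intervalIntegral.integral_const_mul] at key1
  rw [intervalIntegral.integral_add (Continuous.intervalIntegrable (by fun_prop) _ _)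
    (Continuous.intervalIntegrable (by fun_prop) _ _), intervalIntegral.integral_const_mul]
  have := mul_le_mul_of_nonneg_left key2 (by positivity : 0 ≤ 2 * π)
  linarith

end

noncomputable section

open Convolution in
/-- smooth approximation of compactly supported C¹ functions -/
lemma c1_approx_cs {v : E2 → ℝ} (hv : ContDiff ℝ 1 v) (hc : HasCompactSupport v) {δ : ℝ}
    (hδ : 0 < δ) : ∃ w : E2 → ℝ, SmoothF w ∧ (∀ x, |w x - v x| ≤ δ) ∧
      ∀ x, ‖fderiv ℝ w x - fderiv ℝ v x‖ ≤ δ := by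
  have cfd : Continuous (fderiv ℝ v) := hv.continuous_fderiv (by simp)
  have u1 := hc.uniformContinuous_of_continuous hv.continuous
  have u2 := (hc.fderiv ℝ).uniformContinuous_of_continuous cfd
  rw [Metric.uniformContinuous_iff] at u1 u2
  obtain ⟨d1, hd1, H1⟩ := u1 δ hδ
  obtain ⟨d2, hd2, H2⟩ := u2 δ hδ
  set d := min d1 d2 with hd
  have hd0 : 0 < d := lt_min hd1 hd2
  let φ : ContDiffBump (0 : E2) := ⟨d/2, d, by positivity, by linarith⟩
  have hφ : φ.rOut = d := rfl
  refine ⟨φ.normed volume ⋆[ContinuousLinearMap.lsmul ℝ ℝ, volume] v, ?_, ?_, ?_⟩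
  · exact φ.hasCompactSupport_normed.contDiff_convolution_left _ φ.contDiff_normed
      hv.continuous.locallyIntegrable
  · intro x
    rw [← Real.dist_eq]
    apply φ.dist_normed_convolution_le hv.continuous.aestronglyMeasurable
    intro y hy
    exact (H1 (lt_of_lt_of_le hy (min_le_left _ _))).le
  · intro x
    have hloc : LocallyIntegrable (φ.normed volume) (volume : Measure E2) :=
      φ.continuous_normed.locallyIntegrable
    have h := (hc.hasFDerivAt_convolution_right (ContinuousLinearMap.lsmul ℝ ℝ) hloc hv x)
    rw [h.fderiv]
    have e : (φ.normed volume ⋆[(ContinuousLinearMap.lsmul ℝ ℝ : ℝ →L[ℝ] ℝ →L[ℝ] ℝ).precompR E2,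
        (volume : Measure E2)] fderiv ℝ v) =
        (φ.normed volume ⋆[ContinuousLinearMap.lsmul ℝ ℝ, volume] fderiv ℝ v) := by
      congr 1
    rw [e, ← dist_eq_norm]
    apply φ.dist_normed_convolution_le cfd.aestronglyMeasurable
    intro y hy
    exact (H2 (lt_of_lt_of_le hy (min_le_right _ _))).le

lemma c1_approx {Ω : Set E2} (hΩ : Dom Ω) {v : E2 → ℝ} (hv : ContDiff ℝ 1 v) {δ : ℝ}
    (hδ : 0 < δ) : ∃ w : E2 → ℝ, SmoothF w ∧ (∀ x ∈ Ω, |w x - v x| ≤ δ) ∧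
      ∀ x ∈ Ω, ‖fderiv ℝ w x - fderiv ℝ v x‖ ≤ δ := by
  obtain ⟨R, hR, hb⟩ := hΩ.bd.subset_ball_lt 0 (0 : E2)
  let φ : ContDiffBump (0 : E2) := ⟨R, R + 1, hR, by linarith⟩
  obtain ⟨w, h1, h2, h3⟩ := c1_approx_cs (v := fun x => φ x * v x) (φ.contDiff.mul hv)
    (φ.hasCompactSupport.mul_right) hδ
  have key : ∀ x ∈ Ω, (fun x => φ x * v x) =ᶠ[nhds x] v := fun x hx => by
    filter_upwards [Metric.isOpen_ball.mem_nhds (hb hx)] with y hy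
    rw [φ.one_of_mem_closedBall (Metric.ball_subset_closedBall hy), one_mul]
  refine ⟨w, h1, fun x hx => ?_, fun x hx => ?_⟩
  · have := (key x hx).eq_of_nhds
    rw [← this]; exact h2 x
  · rw [← (key x hx).fderiv_eq]; exact h3 x

lemma nEig1_c1 {Ω : Set E2} (hΩ : Dom Ω) {v : E2 → ℝ} (hv : ContDiff ℝ 1 v) :
    nEig1 Ω * ((∫ x in Ω, (v x)^2) - (∫ x in Ω, v x)^2 / area Ω)
      ≤ ∫ x in Ω, ‖fderiv ℝ v x‖^2 := by
  have cfd : Continuous (fderiv ℝ v) := hv.continuous_fderiv (by simp)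
  choose w h1 h2 h3 using fun n : ℕ => c1_approx hΩ hv (δ := 1 / ((n:ℝ) + 1)) (by positivity)
  have hle1 : ∀ n : ℕ, 1 / ((n:ℝ) + 1) ≤ 1 := fun n => by
    rw [div_le_one (by positivity)]; linarith [n.cast_nonneg (α := ℝ)]
  have h2' : ∀ x ∈ Ω, Tendsto (fun n => w n x) atTop (nhds (v x)) := fun x hx => by
    rw [tendsto_iff_dist_tendsto_zero]
    exact squeeze_zero (fun _ => dist_nonneg) (fun n => by rw [Real.dist_eq]; exact h2 n x hx)
      tendsto_one_div_add_atTop_nhds_zero_nat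
  have h3' : ∀ x ∈ Ω, Tendsto (fun n => fderiv ℝ (w n) x) atTop (nhds (fderiv ℝ v x)) :=
    fun x hx => by
    rw [tendsto_iff_dist_tendsto_zero]
    exact squeeze_zero (fun _ => dist_nonneg) (fun n => by rw [dist_eq_norm]; exact h3 n x hx)
      tendsto_one_div_add_atTop_nhds_zero_nat
  have b2 : ∀ n, ∀ x ∈ Ω, |w n x| ≤ |v x| + 1 := fun n x hx => by
    have a := (h2 n x hx).trans (hle1 n)
    have := abs_sub_abs_le_abs_sub (w n x) (v x)
    linarith
  have b3 : ∀ n, ∀ x ∈ Ω, ‖fderiv ℝ (w n) x‖ ≤ ‖fderiv ℝ v x‖ + 1 := fun n x hx => by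
    have a := (h3 n x hx).trans (hle1 n)
    have := norm_sub_norm_le (fderiv ℝ (w n) x) (fderiv ℝ v x)
    linarith
  have cv := hv.continuous
  have ae := fun {p : E2 → Prop} (h : ∀ x ∈ Ω, p x) =>
    ((ae_restrict_iff' hΩ.meas).2 (ae_of_all volume h) : ∀ᵐ x ∂(volume.restrict Ω), p x)
  have t1 : Tendsto (fun n => ∫ x in Ω, w n x) atTop (nhds (∫ x in Ω, v x)) :=
    tendsto_integral_of_dominated_convergence (fun x => |v x| + 1)
      (fun n => (h1 n).continuous.aestronglyMeasurable) (hΩ.intOn (by fun_prop))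
      (fun n => ae fun x hx => b2 n x hx) (ae h2')
  have t2 : Tendsto (fun n => ∫ x in Ω, (w n x)^2) atTop (nhds (∫ x in Ω, (v x)^2)) :=
    tendsto_integral_of_dominated_convergence (fun x => (|v x| + 1)^2)
      (fun n => ((h1 n).continuous.pow 2).aestronglyMeasurable) (hΩ.intOn (by fun_prop))
      (fun n => ae fun x hx => by
        rw [norm_pow, Real.norm_eq_abs]; exact pow_le_pow_left₀ (abs_nonneg _) (b2 n x hx) 2)
      (ae fun x hx => (h2' x hx).pow 2)
  have t3 : Tendsto (fun n => ∫ x in Ω, ‖fderiv ℝ (w n) x‖^2) atTop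
      (nhds (∫ x in Ω, ‖fderiv ℝ v x‖^2)) :=
    tendsto_integral_of_dominated_convergence (fun x => (‖fderiv ℝ v x‖ + 1)^2)
      (fun n => (h1 n).cont_grad.aestronglyMeasurable) (hΩ.intOn (by fun_prop))
      (fun n => ae fun x hx => by
        rw [norm_pow, norm_norm]; exact pow_le_pow_left₀ (norm_nonneg _) (b3 n x hx) 2)
      (ae fun x hx => (h3' x hx).norm.pow 2)
  exact le_of_tendsto_of_tendsto' ((t2.sub ((t1.pow 2).div_const _)).const_mul _) t3
    fun n => nEig1_le_var hΩ (h1 n)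

end

noncomputable section

namespace Prof
variable {μ : ℝ} {G g : ℝ → ℝ}

lemma k_cont (P : Prof μ G g) : Continuous (dslope G 0) := by
  rw [continuous_iff_continuousAt]
  intro r
  by_cases h : r = 0
  · rw [h, continuousAt_dslope_same]; exact (P.dG 0).differentiableAt
  · rw [continuousAt_dslope_of_ne h]; exact P.cG.continuousAt

lemma k_zero (P : Prof μ G g) : dslope G 0 0 = g 0 := by rw [dslope_same, (P.dG 0).deriv]

lemma k_ne (P : Prof μ G g) {r : ℝ} (h : r ≠ 0) : dslope G 0 r = G r / r := by
  rw [dslope_of_ne _ h, slope_def_field, P.G0]; simp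

lemma k_mul (P : Prof μ G g) (r : ℝ) : r * dslope G 0 r = G r := by
  by_cases h : r = 0
  · rw [h, P.G0]; simp
  · rw [P.k_ne h]; field_simp

lemma k_deriv (P : Prof μ G g) {r : ℝ} (h : r ≠ 0) :
    HasDerivAt (dslope G 0) ((g r - dslope G 0 r) / r) r := by
  have h1 : HasDerivAt (fun r => G r / r) ((g r * r - G r * 1) / r^2) r :=
    (P.dG r).div (hasDerivAt_id r) h
  have h2 : dslope G 0 =ᶠ[nhds r] fun r => G r / r := by
    filter_upwards [isOpen_ne.mem_nhds h] with s hs using P.k_ne hs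
  refine (h1.congr_of_eventuallyEq h2).congr_deriv ?_
  rw [P.k_ne h]; field_simp

end Prof

lemma norm_fd {x : E2} (hx : x ≠ 0) : HasFDerivAt (fun x : E2 => ‖x‖) (‖x‖⁻¹ • innerSL ℝ x) x := by
  have h := (hasStrictFDerivAt_norm_sq x).hasFDerivAt.sqrt (by simpa using hx)
  simp only [Real.sqrt_sq (norm_nonneg _)] at h
  have : ‖x‖ ≠ 0 := by simpa using hx
  refine h.congr_fderiv ?_
  ext y; simp; field_simp

/-- Weinberger test functions -/
def swv (G : ℝ → ℝ) (i : Fin 2) (x : E2) : ℝ := x i * dslope G 0 ‖x‖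

def swD (G g : ℝ → ℝ) (i : Fin 2) (x : E2) : E2 →L[ℝ] ℝ :=
  dslope G 0 ‖x‖ • (EuclideanSpace.proj i : E2 →L[ℝ] ℝ) +
    (x i * (g ‖x‖ - dslope G 0 ‖x‖) / ‖x‖^2) • innerSL ℝ x

namespace Prof
variable {μ : ℝ} {G g : ℝ → ℝ}

lemma swv_fd (P : Prof μ G g) (i : Fin 2) (x : E2) : HasFDerivAt (swv G i) (swD G g i x) x := by
  have hp : HasFDerivAt (fun x : E2 => x i) (EuclideanSpace.proj i : E2 →L[ℝ] ℝ) x :=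
    (EuclideanSpace.proj i : E2 →L[ℝ] ℝ).hasFDerivAt
  by_cases hx : x = 0
  · subst hx
    have hk : Continuous fun x : E2 => dslope G 0 ‖x‖ := P.k_cont.comp continuous_norm
    rw [hasFDerivAt_iff_isLittleO]
    have e : ∀ x : E2, swv G i x - swv G i 0 - swD G g i 0 (x - 0) =
        x i * (dslope G 0 ‖x‖ - dslope G 0 0) := fun x => by
      simp [swv, swD]; ring
    simp_rw [e]
    rw [Asymptotics.isLittleO_iff]
    intro c hc
    have := (Metric.tendsto_nhds.1 (hk.tendsto 0)) c hc
    filter_upwards [this] with y hy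
    rw [norm_mul, sub_zero, mul_comm]
    simp only [norm_zero, Real.dist_eq] at hy
    exact mul_le_mul hy.le (EuclideanSpace.norm_eq y ▸ PiLp.norm_apply_le y i) (norm_nonneg _) hc.le
  · have hn : ‖x‖ ≠ 0 := by simpa using hx
    have h1 := (P.k_deriv hn).comp_hasFDerivAt x (norm_fd hx)
    have h2 := hp.mul h1
    refine h2.congr_fderiv ?_
    ext y; simp [swD]; field_simp; ring

lemma swD_cont (P : Prof μ G g) (i : Fin 2) : Continuous (swD G g i) := by
  have hk : Continuous fun x : E2 => dslope G 0 ‖x‖ := P.k_cont.comp continuous_norm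
  have hg : Continuous fun x : E2 => g ‖x‖ := P.cg.comp continuous_norm
  refine (hk.smul continuous_const).add ?_
  rw [continuous_iff_continuousAt]
  intro x
  by_cases hx : x = 0
  · subst hx
    unfold ContinuousAt
    beta_reduce
    rw [show ((0:E2) i * (g ‖(0:E2)‖ - dslope G 0 ‖(0:E2)‖) / ‖(0:E2)‖^2) • innerSL ℝ (0:E2) = 0 by simp]
    rw [tendsto_zero_iff_norm_tendsto_zero]
    have ht : Tendsto (fun x : E2 => |g ‖x‖ - dslope G 0 ‖x‖|) (nhds 0) (nhds 0) := by
      have : Continuous fun x : E2 => |g ‖x‖ - dslope G 0 ‖x‖| := (hg.sub hk).abs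
      have := this.tendsto 0
      simpa [(P.dG 0).deriv] using this
    refine squeeze_zero (fun _ => norm_nonneg _) (fun y => ?_) ht
    rw [norm_smul, innerSL_apply_norm, norm_div, norm_mul, norm_pow, norm_norm, Real.norm_eq_abs,
      Real.norm_eq_abs]
    by_cases hy : y = 0
    · simp [hy]
    have hn : 0 < ‖y‖ := by simpa using hy
    rw [div_mul_eq_mul_div, div_le_iff₀ (by positivity)]
    have : |y i| ≤ ‖y‖ := PiLp.norm_apply_le y i
    nlinarith [mul_le_mul_of_nonneg_right this (mul_nonneg (abs_nonneg (g ‖y‖ - dslope G 0 ‖y‖)) hn.le)]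
  · have hn : ‖x‖^2 ≠ 0 := by simpa using hx
    have hi : Continuous fun x : E2 => x i := (smooth_coord i).continuous
    have h1 : Continuous fun x : E2 => innerSL ℝ x := (innerSL ℝ).continuous
    have h2 : Continuous fun x : E2 => ‖x‖^2 := by fun_prop
    exact (((hi.mul (hg.sub hk)).continuousAt).div h2.continuousAt hn).smul h1.continuousAt

lemma swv_c1 (P : Prof μ G g) (i : Fin 2) : ContDiff ℝ 1 (swv G i) := by
  rw [contDiff_one_iff_fderiv]
  refine ⟨fun x => (P.swv_fd i x).differentiableAt, ?_⟩
  have : fderiv ℝ (swv G i) = swD G g i := by ext1 x; exact (P.swv_fd i x).fderiv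
  rw [this]; exact P.swD_cont i

lemma swD_sum (P : Prof μ G g) (x : E2) : ‖swD G g 0 x‖^2 + ‖swD G g 1 x‖^2 =
    (g ‖x‖)^2 + (dslope G 0 ‖x‖)^2 := by
  rw [dual_norm_sq, dual_norm_sq]
  simp [swD, EuclideanSpace.inner_single_right]
  by_cases hx : x = 0
  · simp [hx, (P.dG 0).deriv]
  have hn : ‖x‖^2 ≠ 0 := by simpa using hx
  have hs : ‖x‖^2 = x 0^2 + x 1^2 := by simp [EuclideanSpace.norm_sq_eq]
  have hn' : x 0^2 + x 1^2 ≠ 0 := hs ▸ hn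
  generalize g ‖x‖ = a at *
  generalize dslope G 0 ‖x‖ = b at *
  rw [hs]
  field_simp
  ring

lemma swv_sum (P : Prof μ G g) (x : E2) : (swv G 0 x)^2 + (swv G 1 x)^2 = (G ‖x‖)^2 := by
  have hs : ‖x‖^2 = x 0^2 + x 1^2 := by simp [EuclideanSpace.norm_sq_eq]
  rw [← P.k_mul, mul_pow, hs]; simp only [swv]; ring

lemma swv_le (P : Prof μ G g) (i : Fin 2) (x : E2) : |swv G i x| ≤ G 1 := by
  have h1 : |swv G i x| ≤ G ‖x‖ := by
    apply abs_le_of_sq_le_sq _ (P.G_nonneg (norm_nonneg _))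
    have := P.swv_sum x
    fin_cases i <;> simp <;> nlinarith [sq_nonneg (swv G 0 x), sq_nonneg (swv G 1 x)]
  refine h1.trans ?_
  rcases le_total ‖x‖ 1 with h | h
  · exact P.mono (mem_Ici.2 (norm_nonneg _)) (mem_Ici.2 zero_le_one) h
  · exact (P.G_const h).le

end Prof
end

noncomputable section

lemma bathtub {Ω B : Set E2} (hΩ : Dom Ω) (hB : Dom B) (ha : area Ω = area B) {f : E2 → ℝ}
    (hf : Continuous f) {m : ℝ} (h1 : ∀ x ∈ B, f x ≤ m) (h2 : ∀ x, x ∉ B → m ≤ f x) :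
    ∫ x in B, f x ≤ ∫ x in Ω, f x := by
  have iΩ := hΩ.intOn hf
  have iB := hB.intOn hf
  rw [← integral_inter_add_sdiff hΩ.meas iB, ← integral_inter_add_sdiff hB.meas iΩ, inter_comm]
  have e1 : ∫ x in B \ Ω, f x ≤ ∫ x in B \ Ω, m :=
    setIntegral_mono_on (iB.mono_set sdiff_subset) ((hB.intOn continuous_const).mono_set sdiff_subset)
      (hB.meas.diff hΩ.meas) fun x hx => h1 x hx.1
  have e2 : ∫ x in Ω \ B, m ≤ ∫ x in Ω \ B, f x :=
    setIntegral_mono_on ((hΩ.intOn continuous_const).mono_set sdiff_subset) (iΩ.mono_set sdiff_subset)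
      (hΩ.meas.diff hB.meas) fun x hx => h2 x hx.2
  have e3 : ∫ x in B \ Ω, m = ∫ x in Ω \ B, m := by
    have f1 := integral_inter_add_sdiff hΩ.meas (hB.intOn (continuous_const (y := m)))
    have f2 := integral_inter_add_sdiff hB.meas (hΩ.intOn (continuous_const (y := m)))
    rw [inter_comm] at f1
    have f3 : ∫ x in B, m = ∫ x in Ω, m := by
      simp only [integral_const, smul_eq_mul]
      simp only [measureReal_restrict_apply_univ]
      have : volume.real Ω = volume.real B := ha
      rw [this]
    linarith
  linarith

lemma int_ball_sub (c : E2) (f : E2 → ℝ) :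
    ∫ x in Metric.ball c 1, f (x - c) = ∫ x in unitDisc, f x := by
  rw [← integral_indicator Metric.isOpen_ball.measurableSet,
    ← integral_indicator unitDisc_dom.meas,
    ← integral_sub_right_eq_self (unitDisc.indicator f) c]
  congr 1; ext x
  by_cases h : x ∈ Metric.ball c 1
  · rw [indicator_of_mem h, indicator_of_mem]; simpa [unitDisc, dist_eq_norm] using h
  · rw [indicator_of_notMem h, indicator_of_notMem]; simpa [unitDisc, dist_eq_norm] using h

namespace Prof
variable {μ : ℝ} {G g : ℝ → ℝ}

lemma HH_deriv (P : Prof μ G g) (t : ℝ) : HasDerivAt (fun t => ∫ s in (0:ℝ)..t, G s) (G t) t :=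
  intervalIntegral.integral_hasDerivAt_right (P.cG.intervalIntegrable _ _)
    (P.cG.stronglyMeasurableAtFilter _ _) P.cG.continuousAt

lemma hh_fd (P : Prof μ G g) (x : E2) : HasFDerivAt (fun x : E2 => ∫ s in (0:ℝ)..‖x‖, G s)
    (dslope G 0 ‖x‖ • innerSL ℝ x) x := by
  by_cases hx : x = 0
  · subst hx
    have h := (hasDerivAt_iff_isLittleO.1 (P.HH_deriv 0))
    rw [P.G0] at h
    simp only [intervalIntegral.integral_same, sub_zero, smul_zero] at h
    have h2 : Tendsto (fun x : E2 => ‖x‖) (nhds 0) (nhds 0) := by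
      simpa using (continuous_norm (E := E2)).tendsto 0
    have h3 := h.comp_tendsto h2
    rw [hasFDerivAt_iff_isLittleO]
    refine Asymptotics.IsLittleO.of_norm_right ?_
    simpa [Function.comp_def] using h3
  · have hn : ‖x‖ ≠ 0 := by simpa using hx
    refine ((P.HH_deriv ‖x‖).comp_hasFDerivAt x (norm_fd hx)).congr_fderiv ?_
    rw [P.k_ne hn, smul_smul, div_eq_mul_inv]

lemma HH_ge (P : Prof μ G g) {t : ℝ} (ht : 0 ≤ t) : G 1 * (t - 1) ≤ ∫ s in (0:ℝ)..t, G s := by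
  rcases le_total t 1 with h | h
  · have : 0 ≤ ∫ s in (0:ℝ)..t, G s := intervalIntegral.integral_nonneg ht fun s hs =>
      P.G_nonneg hs.1
    nlinarith [P.G_pos one_pos]
  · rw [← intervalIntegral.integral_add_adjacent_intervals (b := 1) (P.cG.intervalIntegrable _ _)
      (P.cG.intervalIntegrable _ _)]
    have h1 : 0 ≤ ∫ s in (0:ℝ)..1, G s := intervalIntegral.integral_nonneg zero_le_one fun s hs =>
      P.G_nonneg hs.1
    have h2 : ∫ s in (1:ℝ)..t, G s = ∫ s in (1:ℝ)..t, G 1 :=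
      intervalIntegral.integral_congr fun s hs => by
        rw [uIcc_of_le h] at hs; exact P.G_const hs.1
    rw [h2]; simp; linarith

lemma center (P : Prof μ G g) {Ω : Set E2} (hΩ : Dom Ω) :
    ∃ c : E2, ∀ i, ∫ x in Ω, swv G i (x - c) = 0 := by
  set h : E2 → ℝ := fun x => ∫ s in (0:ℝ)..‖x‖, G s with hh
  have ch : Continuous h := continuous_iff_continuousAt.2 fun x => (P.hh_fd x).continuousAt
  set Φ : E2 → ℝ := fun c => ∫ x in Ω, h (x - c) with hΦ
  have g1 := P.G_pos one_pos
  have lip : ∀ x y, |h x - h y| ≤ 2 * G 1 * ‖x - y‖ := by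
    intro x y
    have := Convex.norm_image_sub_le_of_norm_hasFDerivWithin_le (f := h) (s := univ)
      (f' := fun x => dslope G 0 ‖x‖ • innerSL ℝ x) (C := 2 * G 1)
      (fun x _ => (P.hh_fd x).hasFDerivWithinAt) (fun x _ => by
        rw [norm_smul, innerSL_apply_norm]
        have e1 : ‖dslope G 0 ‖x‖‖ * ‖x‖ = |G ‖x‖| := by
          rw [← P.k_mul, abs_mul, abs_norm, mul_comm, Real.norm_eq_abs]
        rw [e1, abs_of_nonneg (P.G_nonneg (norm_nonneg _))]
        rcases le_total ‖x‖ 1 with h | h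
        · have := P.mono (mem_Ici.2 (norm_nonneg x)) (mem_Ici.2 zero_le_one) h
          linarith
        · rw [P.G_const h]; linarith) convex_univ (mem_univ y) (mem_univ x)
    exact this
  have iΦ : ∀ c, IntegrableOn (fun x => h (x - c)) Ω := fun c => hΩ.intOn (by fun_prop)
  have cΦ : Continuous Φ := by
    have : LipschitzWith (Real.toNNReal (2 * G 1 * area Ω)) Φ := by
      apply LipschitzWith.of_dist_le_mul
      intro c c'
      rw [Real.coe_toNNReal _ (by have := hΩ.pos; positivity), Real.dist_eq, hΦ]
      simp only
      rw [← integral_sub (iΦ c) (iΦ c')]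
      have := norm_setIntegral_le_of_norm_le_const (μ := volume) (s := Ω) hΩ.fin
        (f := fun x => h (x - c) - h (x - c')) (C := 2 * G 1 * dist c c') (fun x _ => by
          refine (lip _ _).trans (le_of_eq ?_)
          rw [sub_sub_sub_cancel_left, dist_comm, dist_eq_norm])
      refine this.trans (le_of_eq ?_)
      simp only [area, Measure.real]; ring
    exact this.continuous
  obtain ⟨M, hM, hb⟩ := hΩ.bd.subset_ball_lt 0 (0 : E2)
  have coer : Tendsto Φ (cocompact E2) atTop := by
    have hl : ∀ c, G 1 * (‖c‖ - M - 1) * area Ω ≤ Φ c := fun c => by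
      have : ∫ x in Ω, G 1 * (‖c‖ - M - 1) ≤ Φ c :=
        setIntegral_mono_on (hΩ.intOn continuous_const) (iΦ c) hΩ.meas fun x hx => by
          refine le_trans ?_ (P.HH_ge (norm_nonneg _))
          have h1 : ‖x‖ < M := by simpa using hb hx
          have h2 : ‖c‖ ≤ ‖x‖ + ‖x - c‖ := by
            have := norm_sub_le x (x - c); rwa [sub_sub_cancel] at this
          nlinarith
      refine le_trans (le_of_eq ?_) this
      simp [area, Measure.real, mul_comm]
    refine tendsto_atTop_mono hl ?_
    apply Tendsto.atTop_mul_const hΩ.pos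
    apply Tendsto.const_mul_atTop g1
    simp only [sub_eq_add_neg]
    exact tendsto_atTop_add_const_right _ _ (tendsto_atTop_add_const_right _ _
      (tendsto_norm_cocompact_atTop))
  obtain ⟨c, hc⟩ := cΦ.exists_forall_le coer
  refine ⟨c, fun i => ?_⟩
  set e : E2 := EuclideanSpace.single i 1 with he
  have dline : ∀ (x : E2) (t : ℝ), HasDerivAt (fun t : ℝ => h (x - (c + t • e)))
      (-swv G i (x - (c + t • e))) t := fun x t => by
    have d1 : HasDerivAt (fun t : ℝ => x - (c + t • e)) (-e) t := by
      have := (((hasDerivAt_id t).smul_const e).const_add c).const_sub x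
      simpa using this
    refine ((P.hh_fd _).comp_hasDerivAt t d1).congr_deriv ?_
    simp [swv, he, EuclideanSpace.inner_single_right]; ring
  have cswv := (P.swv_c1 i).continuous
  have D := hasDerivAt_integral_of_dominated_loc_of_deriv_le (μ := volume.restrict Ω)
    (F := fun t x => h (x - (c + t • e))) (F' := fun t x => -swv G i (x - (c + t • e)))
    (x₀ := (0:ℝ)) (s := univ) (bound := fun _ => G 1) univ_mem
    (Eventually.of_forall fun t => (iΦ _).aestronglyMeasurable) (iΦ _)
    (by apply Continuous.aestronglyMeasurable; fun_prop)
    (ae_of_all _ fun x t _ => by rw [norm_neg]; exact P.swv_le i _)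
    (hΩ.intOn continuous_const)
    (ae_of_all _ fun x t _ => dline x t)
  have hmin : IsLocalMin (fun t : ℝ => ∫ x in Ω, h (x - (c + t • e))) 0 :=
    Eventually.of_forall fun t => by simpa using hc (c + t • e)
  have := hmin.hasDerivAt_eq_zero D.2
  simp only [zero_smul, add_zero, integral_neg, neg_eq_zero] at this
  exact this

lemma N_anti (P : Prof μ G g) : AntitoneOn (fun r => (g r)^2 + (dslope G 0 r)^2) (Icc 0 1) := by
  apply antitoneOn_of_deriv_nonpos (convex_Icc 0 1)
  · exact ((P.cg.pow 2).add (P.k_cont.pow 2)).continuousOn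
  · intro r hr
    rw [interior_Icc] at hr
    exact ((((P.dg r hr).pow 2).add ((P.k_deriv hr.1.ne').pow 2)).differentiableAt).differentiableWithinAt
  · intro r hr
    rw [interior_Icc] at hr
    have h := ((P.dg r hr).pow 2).add ((P.k_deriv hr.1.ne').pow 2)
    have h' : HasDerivAt (fun r => (g r)^2 + (dslope G 0 r)^2) _ r := h
    rw [h'.deriv]
    have e : G r = r * dslope G 0 r := (P.k_mul r).symm
    have r0 := hr.1
    have hk : 0 ≤ dslope G 0 r := by
      rw [P.k_ne hr.1.ne']; exact div_nonneg (P.G_nonneg r0.le) r0.le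
    have hg := P.gpos r ⟨r0.le, hr.2⟩
    have hμ := P.hμ
    rw [e]
    generalize dslope G 0 r = k at *
    generalize g r = a at *
    have : ((2:ℕ):ℝ) * a ^ (2-1) * (-a / r - (μ - 1/r^2) * (r * k)) + ((2:ℕ):ℝ) * k^(2-1) * ((a - k)/r)
      = - (2 * μ * a * (r * k) + (2 / r) * (a - k)^2) := by
      field_simp; push_cast; ring
    rw [this]
    have : 0 ≤ 2 * μ * a * (r * k) + (2 / r) * (a - k)^2 := by positivity
    linarith

lemma N_int (P : Prof μ G g) : ∫ x in unitDisc, ((g ‖x‖)^2 + (dslope G 0 ‖x‖)^2) =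
    μ * ∫ x in unitDisc, (G ‖x‖)^2 := by
  have cN : Continuous fun r => (g r)^2 + (dslope G 0 r)^2 := (P.cg.pow 2).add (P.k_cont.pow 2)
  rw [polar_disc (F := fun x => (g ‖x‖)^2 + (dslope G 0 ‖x‖)^2) (cN.comp continuous_norm),
    polar_disc (F := fun x => (G ‖x‖)^2) ((P.cG.comp continuous_norm).pow 2)]
  simp only [norm_ppt, intervalIntegral.integral_const, smul_eq_mul]
  have cg := P.cg
  have cG := P.cG
  have key := intervalIntegral.integral_eq_sub_of_hasDerivAt_of_le (zero_le_one (α := ℝ))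
    (f := fun r => r * g r * G r)
    (f' := fun r => r * ((g r)^2 + (dslope G 0 r)^2) - μ * (r * (G r)^2))
    (by fun_prop) (fun r hr => by
      refine (((hasDerivAt_id r).mul (P.dg r hr)).mul (P.dG r)).congr_deriv ?_
      have r0 := hr.1.ne'
      simp only [id, Pi.mul_apply]
      rw [P.k_ne r0]
      field_simp
      ring) (Continuous.intervalIntegrable (by fun_prop) _ _)
  have e0 : G 0 = 0 := P.G0
  have e1 : g 1 = 0 := P.gz 1 le_rfl
  rw [intervalIntegral.integral_sub (Continuous.intervalIntegrable (by fun_prop) _ _)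
    (Continuous.intervalIntegrable (by fun_prop) _ _), intervalIntegral.integral_const_mul] at key
  simp only [e0, e1, mul_zero, zero_mul, sub_zero] at key
  have cong : ∀ f : ℝ → ℝ, ∫ r in (0:ℝ)..1, r * ((π - -π) * f |r|) =
      (π - -π) * ∫ r in (0:ℝ)..1, r * f r := fun f => by
    rw [← intervalIntegral.integral_const_mul]
    refine intervalIntegral.integral_congr fun r hr => ?_
    rw [uIcc_of_le zero_le_one] at hr
    simp only [abs_of_nonneg hr.1]; ring
  rw [cong (fun r => (g r)^2 + (dslope G 0 r)^2), cong (fun r => (G r)^2)]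
  linear_combination (π - -π) * key

end Prof

lemma sw_pi {Ω : Set E2} (hΩ : Dom Ω) (ha : area Ω = π) : nEig1 Ω ≤ nEig1 unitDisc := by
  obtain ⟨μ, G, g, P⟩ := exists_prof
  refine le_trans ?_ (disc_ge P)
  obtain ⟨c, hc⟩ := P.center hΩ
  have hsub : ∀ i, ContDiff ℝ 1 fun x => swv G i (x - c) := fun i =>
    (P.swv_c1 i).comp (contDiff_id.sub contDiff_const)
  have hfd : ∀ i x, fderiv ℝ (fun x => swv G i (x - c)) x = swD G g i (x - c) := fun i x => by
    rw [fderiv_comp_sub]; exact (P.swv_fd i (x - c)).fderiv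
  have key : ∀ i, nEig1 Ω * ∫ x in Ω, (swv G i (x - c))^2 ≤ ∫ x in Ω, ‖swD G g i (x - c)‖^2 :=
    fun i => by
    have := nEig1_c1 hΩ (hsub i)
    simp only [hc i, hfd] at this
    simpa using this
  have cv : ∀ i, Continuous fun x => (swv G i (x - c))^2 := fun i => (hsub i).continuous.pow 2
  have cD : ∀ i, Continuous fun x => ‖swD G g i (x - c)‖^2 := fun i =>
    ((P.swD_cont i).comp (continuous_id.sub continuous_const)).norm.pow 2
  have k0 := key 0
  have k1 := key 1
  have s1 : (∫ x in Ω, (swv G 0 (x - c))^2) + ∫ x in Ω, (swv G 1 (x - c))^2 =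
      ∫ x in Ω, (G ‖x - c‖)^2 := by
    rw [← integral_add (hΩ.intOn (cv 0)) (hΩ.intOn (cv 1))]
    simp_rw [P.swv_sum]
  have s2 : (∫ x in Ω, ‖swD G g 0 (x - c)‖^2) + ∫ x in Ω, ‖swD G g 1 (x - c)‖^2 =
      ∫ x in Ω, ((g ‖x - c‖)^2 + (dslope G 0 ‖x - c‖)^2) := by
    rw [← integral_add (hΩ.intOn (cD 0)) (hΩ.intOn (cD 1))]
    simp_rw [P.swD_sum]
  have hB : Dom (Metric.ball c 1) := ⟨⟨c, by simp⟩, Metric.isOpen_ball, Metric.isBounded_ball⟩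
  have haB : area Ω = area (Metric.ball c 1) := by rw [ha, area_ball c zero_le_one]; simp
  have cN : Continuous fun r => (g r)^2 + (dslope G 0 r)^2 := (P.cg.pow 2).add (P.k_cont.pow 2)
  have cn : Continuous fun x : E2 => ‖x - c‖ := by fun_prop
  have b1 := bathtub hΩ hB haB (f := fun x => (G ‖x - c‖)^2) ((P.cG.comp cn).pow 2) (m := (G 1)^2)
    (fun x hx => by
      rw [Metric.mem_ball, dist_eq_norm] at hx
      exact pow_le_pow_left₀ (P.G_nonneg (norm_nonneg _))
        (P.mono (mem_Ici.2 (norm_nonneg _)) (mem_Ici.2 zero_le_one) hx.le) 2)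
    (fun x hx => by
      rw [Metric.mem_ball, dist_eq_norm, not_lt] at hx
      exact (congrArg (· ^2) (P.G_const hx)).ge)
  have N1 : (g 1)^2 + (dslope G 0 1)^2 = (G 1)^2 := by
    rw [P.gz 1 le_rfl, P.k_ne one_ne_zero]; simp
  have b2 := bathtub hΩ hB haB (f := fun x => -((g ‖x - c‖)^2 + (dslope G 0 ‖x - c‖)^2))
    ((cN.comp cn).neg) (m := -(G 1)^2)
    (fun x hx => by
      rw [Metric.mem_ball, dist_eq_norm] at hx
      have := P.N_anti (⟨norm_nonneg _, hx.le⟩ : ‖x - c‖ ∈ Icc (0:ℝ) 1)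
        (⟨zero_le_one, le_rfl⟩ : (1:ℝ) ∈ Icc (0:ℝ) 1) hx.le
      simp only [N1] at this
      linarith)
    (fun x hx => by
      rw [Metric.mem_ball, dist_eq_norm, not_lt] at hx
      rw [P.gz _ hx, P.k_ne (by linarith), P.G_const hx]
      have : G 1 / ‖x - c‖ ≤ G 1 := div_le_self (P.G_nonneg zero_le_one) hx
      have h2 : 0 ≤ G 1 / ‖x - c‖ := div_nonneg (P.G_nonneg zero_le_one) (norm_nonneg _)
      have := pow_le_pow_left₀ h2 this 2
      simp; linarith)
  rw [integral_neg, integral_neg] at b2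
  rw [int_ball_sub c (fun x => (G ‖x‖)^2)] at b1
  rw [int_ball_sub c (fun x => (g ‖x‖)^2 + (dslope G 0 ‖x‖)^2), P.N_int] at b2
  have hn := nEig1_nonneg Ω
  have pos : 0 < ∫ x in unitDisc, (G ‖x‖)^2 := by
    refine sq_int_pos unitDisc_dom (P.cG.comp continuous_norm)
      (x := EuclideanSpace.single 0 (1/2)) (by simp [unitDisc]; norm_num) ?_
    apply ne_of_gt; apply P.G_pos; simp
  have : nEig1 Ω * ∫ x in unitDisc, (G ‖x‖)^2 ≤ μ * ∫ x in unitDisc, (G ‖x‖)^2 := by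
    nlinarith [mul_le_mul_of_nonneg_left b1 hn]
  exact le_of_mul_le_mul_right this pos

open Pointwise in
/-- Szegő–Weinberger -/
theorem szego_weinberger {Ω : Set E2} (hΩ : Dom Ω) : area Ω * nEig1 Ω ≤ π * nEig1 unitDisc := by
  set c := √(π / area Ω) with hc
  have ha := hΩ.pos
  have hπ := pi_pos
  have hc0 : 0 < c := by positivity
  have hc2 : c^2 = π / area Ω := Real.sq_sqrt (by positivity)
  have h := sw_pi (hΩ.smul hc0) (by rw [area_smul hc0, hc2]; field_simp)
  have h2 := nEig1_smul hΩ hc0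
  rw [← h2]
  rw [hc2]
  calc area Ω * (π / area Ω * nEig1 (c • Ω)) = π * nEig1 (c • Ω) := by field_simp
    _ ≤ _ := mul_le_mul_of_nonneg_left h hπ.le

end

noncomputable section

lemma lint_affine {Ω : Set E2} (hm : MeasurableSet Ω) {f : E2 → ENNReal} (hf : Measurable f)
    {σ : ℝ} (hσ : 0 < σ) (c : E2) (hmap : ∀ x ∈ Ω, σ • x + c ∈ Ω) :
    ∫⁻ x in Ω, f (σ • x + c) ≤ ENNReal.ofReal ((σ^2)⁻¹) * ∫⁻ x in Ω, f x := by
  have hF : Measurable (Ω.indicator f) := hf.indicator hm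
  calc ∫⁻ x in Ω, f (σ • x + c) = ∫⁻ x in Ω, Ω.indicator f (σ • x + c) := by
        refine setLIntegral_congr_fun hm fun x hx => ?_
        simp [hmap x hx]
    _ ≤ ∫⁻ x, Ω.indicator f (σ • x + c) := setLIntegral_le_lintegral _ _
    _ = ∫⁻ y, Ω.indicator f (y + c) ∂(Measure.map (fun x : E2 => σ • x) volume) := by
        rw [lintegral_map (f := fun y => Ω.indicator f (y + c)) (by fun_prop) (by fun_prop)]
    _ = ENNReal.ofReal ((σ^2)⁻¹) * ∫⁻ y, Ω.indicator f (y + c) := by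
        have e : Measure.map (fun x : E2 => σ • x) volume
            = ENNReal.ofReal ((σ^2)⁻¹) • (volume : Measure E2) := by
          have := Measure.map_addHaar_smul (volume : Measure E2) hσ.ne'
          rw [show (fun x : E2 => σ • x) = (σ • ·) from rfl, this]
          simp
        rw [e, lintegral_smul_measure, smul_eq_mul]
    _ = ENNReal.ofReal ((σ^2)⁻¹) * ∫⁻ y, Ω.indicator f y := by
        rw [lintegral_add_right_eq_self (μ := (volume : Measure E2)) (fun y => Ω.indicator f y) c]
    _ = _ := by rw [lintegral_indicator hm]

lemma seg_lint {u : E2 → ℝ} (hu : SmoothF u) (p v : E2) {L : ℝ} (hv : ‖v‖ ≤ L) :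
    ENNReal.ofReal ((u (p + v) - u p)^2) ≤ ENNReal.ofReal (L^2) *
      ∫⁻ τ in Ioc (0:ℝ) 1, ENNReal.ofReal (‖fderiv ℝ u (p + τ • v)‖^2) := by
  have hc : Continuous fun τ : ℝ => ‖fderiv ℝ u (p + τ • v)‖^2 :=
    hu.cont_grad.comp (by fun_prop)
  have h0 : 0 ≤ ∫ τ in (0:ℝ)..1, ‖fderiv ℝ u (p + τ • v)‖^2 :=
    intervalIntegral.integral_nonneg (by norm_num) fun _ _ => by positivity
  have h := (seg_ineq hu p v).trans (mul_le_mul_of_nonneg_right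
    (pow_le_pow_left₀ (norm_nonneg _) hv 2) h0)
  refine (ENNReal.ofReal_le_ofReal h).trans ?_
  rw [ENNReal.ofReal_mul (by positivity), intervalIntegral.integral_of_le (by norm_num),
    ofReal_integral_eq_lintegral_ofReal]
  · exact (hc.integrableOn_Icc (a := 0) (b := 1)).mono_set Ioc_subset_Icc_self
  · exact ae_of_all _ fun _ => by positivity

/-- transport along straight segments. -/
lemma seg_transport {Ω : Set E2} (hm : MeasurableSet Ω) {u : E2 → ℝ} (hu : SmoothF u)
    {θ L : ℝ} (hθ : 0 < θ) (hθ1 : θ ≤ 1) (z : E2)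
    (hseg : ∀ x ∈ Ω, ∀ τ : ℝ, 0 ≤ τ → τ ≤ 1 → x + τ • (θ • x + z - x) ∈ Ω)
    (hL : ∀ x ∈ Ω, ‖θ • x + z - x‖ ≤ L) :
    ∫⁻ x in Ω, ENNReal.ofReal ((u (θ • x + z) - u x)^2) ≤
      ENNReal.ofReal (L^2 * (θ^2)⁻¹) * ∫⁻ x in Ω, ENNReal.ofReal (‖fderiv ℝ u x‖^2) := by
  set G : E2 → ENNReal := fun x => ENNReal.ofReal (‖fderiv ℝ u x‖^2) with hG
  have hGc : Continuous G := ENNReal.continuous_ofReal.comp hu.cont_grad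
  have hGm : Measurable G := hGc.measurable
  calc ∫⁻ x in Ω, ENNReal.ofReal ((u (θ • x + z) - u x)^2)
      ≤ ∫⁻ x in Ω, ENNReal.ofReal (L^2) *
          ∫⁻ τ in Ioc (0:ℝ) 1, G (x + τ • (θ • x + z - x)) := by
        refine setLIntegral_mono' hm fun x hx => ?_
        have := seg_lint hu x (θ • x + z - x) (hL x hx)
        rwa [add_sub_cancel] at this
    _ = ENNReal.ofReal (L^2) * ∫⁻ x in Ω, ∫⁻ τ in Ioc (0:ℝ) 1, G (x + τ • (θ • x + z - x)) := by
        rw [lintegral_const_mul']; exact ENNReal.ofReal_ne_top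
    _ = ENNReal.ofReal (L^2) * ∫⁻ τ in Ioc (0:ℝ) 1, ∫⁻ x in Ω, G (x + τ • (θ • x + z - x)) := by
        congr 1
        apply lintegral_lintegral_swap
        have : Measurable (fun q : E2 × ℝ => G (q.1 + q.2 • (θ • q.1 + z - q.1))) :=
          (hGc.comp (by fun_prop)).measurable
        exact this.aemeasurable
    _ ≤ ENNReal.ofReal (L^2) * ∫⁻ τ in Ioc (0:ℝ) 1,
          ENNReal.ofReal ((θ^2)⁻¹) * ∫⁻ x in Ω, G x := by
        refine mul_le_mul' le_rfl (setLIntegral_mono' measurableSet_Ioc fun τ hτ => ?_)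
        have hσ : θ ≤ 1 - τ * (1 - θ) := by nlinarith [hτ.1, hτ.2]
        have e : ∀ x : E2, x + τ • (θ • x + z - x) = (1 - τ * (1 - θ)) • x + τ • z := by
          intro x; module
        have h1 := lint_affine hm hGm (σ := 1 - τ * (1 - θ)) (by linarith) (τ • z) (fun x hx => by
          rw [← e]; exact hseg x hx τ hτ.1.le hτ.2)
        simp_rw [e]
        refine h1.trans ?_
        gcongr
    _ = _ := by
        rw [setLIntegral_const]
        simp only [volume_Ioc, sub_zero, ENNReal.ofReal_one, mul_one]
        rw [← mul_assoc, ← ENNReal.ofReal_mul (by positivity)]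

lemma of_lint {Ω : Set E2} {f g : E2 → ℝ} (hf : IntegrableOn f Ω) (hg : IntegrableOn g Ω)
    (f0 : ∀ x, 0 ≤ f x) (g0 : ∀ x, 0 ≤ g x) {C : ℝ} (hC : 0 ≤ C)
    (h : ∫⁻ x in Ω, ENNReal.ofReal (f x) ≤ ENNReal.ofReal C * ∫⁻ x in Ω, ENNReal.ofReal (g x)) :
    ∫ x in Ω, f x ≤ C * ∫ x in Ω, g x := by
  rw [← ofReal_integral_eq_lintegral_ofReal hf (ae_of_all _ f0),
    ← ofReal_integral_eq_lintegral_ofReal hg (ae_of_all _ g0), ← ENNReal.ofReal_mul hC] at h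
  exact (ENNReal.ofReal_le_ofReal_iff (mul_nonneg hC (integral_nonneg g0))).1 h

lemma seg_transport_real {Ω : Set E2} (hΩ : Dom Ω) {u : E2 → ℝ} (hu : SmoothF u)
    {θ L : ℝ} (hθ : 0 < θ) (hθ1 : θ ≤ 1) (z : E2)
    (hseg : ∀ x ∈ Ω, ∀ τ : ℝ, 0 ≤ τ → τ ≤ 1 → x + τ • (θ • x + z - x) ∈ Ω)
    (hL : ∀ x ∈ Ω, ‖θ • x + z - x‖ ≤ L) :
    ∫ x in Ω, (u (θ • x + z) - u x)^2 ≤ (L^2 * (θ^2)⁻¹) * ∫ x in Ω, ‖fderiv ℝ u x‖^2 := by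
  have hc := hu.continuous
  exact of_lint (hΩ.intOn (by fun_prop)) (hΩ.intOn hu.cont_grad) (fun _ => by positivity)
    (fun _ => by positivity) (by positivity) (seg_transport hΩ.meas hu hθ hθ1 z hseg hL)

/-- translation estimate on the whole plane -/
lemma trans_est {u : E2 → ℝ} (hu : SmoothF u) (h : E2) :
    ∫⁻ x, ENNReal.ofReal ((u (x + h) - u x)^2) ≤
      ENNReal.ofReal (‖h‖^2) * ∫⁻ x, ENNReal.ofReal (‖fderiv ℝ u x‖^2) := by
  have := seg_transport (Ω := univ) MeasurableSet.univ hu one_pos le_rfl h (L := ‖h‖)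
    (by simp) (by intro x _; simp)
  simpa using this

lemma mink {α : Type*} [MeasurableSpace α] {ν : Measure α} {f g : α → ℝ}
    (hf : Integrable (fun x => f x ^ 2) ν) (hg : Integrable (fun x => g x ^ 2) ν)
    (hfm : AEStronglyMeasurable f ν) (hgm : AEStronglyMeasurable g ν)
    {a b E : ℝ} (ha : 0 < a) (hb : 0 < b) (h1 : ∫ x, f x ^ 2 ∂ν ≤ a^2 * E)
    (h2 : ∫ x, g x ^ 2 ∂ν ≤ b^2 * E) : ∫ x, (f x + g x)^2 ∂ν ≤ (a + b)^2 * E := by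
  have hp : ∀ x, (f x + g x)^2 ≤ (1 + b / a) * f x ^ 2 + (1 + a / b) * g x ^ 2 := by
    intro x
    have : (1 + b / a) * f x ^ 2 + (1 + a / b) * g x ^ 2 - (f x + g x)^2
        = (b * f x - a * g x)^2 / (a * b) := by field_simp; ring
    have : 0 ≤ (b * f x - a * g x)^2 / (a * b) := by positivity
    linarith
  have hi : Integrable (fun x => (1 + b / a) * f x ^ 2 + (1 + a / b) * g x ^ 2) ν :=
    (hf.const_mul _).add (hg.const_mul _)
  have hi2 : Integrable (fun x => (f x + g x)^2) ν :=
    hi.mono' ((hfm.add hgm).pow 2) (ae_of_all _ fun x => by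
      rw [Real.norm_of_nonneg (by positivity)]; exact hp x)
  calc _ ≤ ∫ x, ((1 + b / a) * f x ^ 2 + (1 + a / b) * g x ^ 2) ∂ν := integral_mono hi2 hi hp
    _ = (1 + b / a) * ∫ x, f x ^ 2 ∂ν + (1 + a / b) * ∫ x, g x ^ 2 ∂ν := by
        rw [integral_add (hf.const_mul _) (hg.const_mul _), integral_const_mul, integral_const_mul]
    _ ≤ (1 + b / a) * (a^2 * E) + (1 + a / b) * (b^2 * E) := by gcongr
    _ = _ := by field_simp; ring

lemma Dom.mink {Ω} (h : Dom Ω) {f g : E2 → ℝ} (hf : Continuous f) (hg : Continuous g)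
    {a b E : ℝ} (ha : 0 < a) (hb : 0 < b) (h1 : ∫ x in Ω, f x ^ 2 ≤ a^2 * E)
    (h2 : ∫ x in Ω, g x ^ 2 ≤ b^2 * E) : ∫ x in Ω, (f x + g x)^2 ≤ (a + b)^2 * E :=
  _root_.mink (h.intOn (by fun_prop)) (h.intOn (by fun_prop)) hf.aestronglyMeasurable
    hg.aestronglyMeasurable ha hb h1 h2

/-- Poincaré inequality with constant `K`. -/
def PC (Ω : Set E2) (K : ℝ) : Prop := ∀ v : E2 → ℝ, SmoothF v →
  ∃ m : ℝ, ∫ x in Ω, (v x - m)^2 ≤ K^2 * ∫ x in Ω, ‖fderiv ℝ v x‖^2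

lemma PC.le {Ω} (h : Dom Ω) {K : ℝ} (hK : 0 < K) (hp : PC Ω K) : 1 / K^2 ≤ nEig1 Ω := by
  apply nEig1_ge h
  intro u hu h0
  obtain ⟨m, hm⟩ := hp u hu
  have := int_sq_le_sub_const h hu.continuous h0 m
  rw [one_div, inv_mul_le_iff₀ (by positivity)]
  linarith

lemma pc_of_pos {Ω} (h : Dom Ω) (hp : 0 < nEig1 Ω) : PC Ω (1 / √(nEig1 Ω)) := by
  intro v hv
  refine ⟨mean Ω v, ?_⟩
  have := nEig1_le_mean h hv
  rw [div_pow, Real.sq_sqrt hp.le, one_pow, one_div, ← div_eq_inv_mul, le_div_iff₀ hp]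
  linarith

lemma pc_inv_sqrt_le {Ω} (h : Dom Ω) {K : ℝ} (hK : 0 < K) (hp : PC Ω K) :
    0 < nEig1 Ω ∧ 1 / √(nEig1 Ω) ≤ K := by
  have h1 := hp.le h hK
  have h2 : 0 < nEig1 Ω := lt_of_lt_of_le (by positivity) h1
  refine ⟨h2, ?_⟩
  rw [div_le_iff₀ (by positivity)]
  have : 1 ≤ K^2 * nEig1 Ω := by rwa [div_le_iff₀' (by positivity)] at h1
  have h3 : √1 ≤ √(K^2 * nEig1 Ω) := Real.sqrt_le_sqrt this
  rwa [Real.sqrt_one, Real.sqrt_mul (by positivity), Real.sqrt_sq hK.le] at h3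

end

noncomputable section

lemma int_mono_set {Ω Ω' : Set E2} (h' : Dom Ω') (hs : Ω ⊆ Ω') {f : E2 → ℝ} (hf : Continuous f)
    (f0 : ∀ x, 0 ≤ f x) : ∫ x in Ω, f x ≤ ∫ x in Ω', f x :=
  setIntegral_mono_set (h'.intOn hf) (ae_of_all _ f0) (hs.eventuallyLE)

open Pointwise in
lemma int_smul_le {Ω Ω' : Set E2} (h : Dom Ω) {c : ℝ} (hc : 0 < c) (hs : Ω' ⊆ c • Ω)
    {f : E2 → ℝ} (hf : Continuous f) (f0 : ∀ x, 0 ≤ f x) :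
    ∫ x in Ω', f (c⁻¹ • x) ≤ c^2 * ∫ x in Ω, f x := by
  rw [int_smul (inv_pos.2 hc)]
  have : c⁻¹ • Ω' ⊆ Ω := by
    rintro _ ⟨y, hy, rfl⟩
    obtain ⟨w, hw, rfl⟩ := hs hy
    simpa [inv_smul_smul₀ hc.ne'] using hw
  have h1 := int_mono_set h this hf f0
  rw [show ((c⁻¹)^2)⁻¹ = c^2 by simp]
  gcongr

lemma contraction {Ω : Set E2} (h : Dom Ω) (hst : StarConvex ℝ 0 Ω) {M : ℝ}
    (hM : ∀ x ∈ Ω, ‖x‖ ≤ M) {c b : ℝ} (hc : 1 ≤ c) (hb : M * (c - 1) ≤ b) {u : E2 → ℝ}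
    (hu : SmoothF u) :
    ∫ x in Ω, (u (c⁻¹ • x) - u x)^2 ≤ b^2 * ∫ x in Ω, ‖fderiv ℝ u x‖^2 := by
  have hc0 : 0 < c := by linarith
  have hθ1 : c⁻¹ ≤ 1 := inv_le_one_of_one_le₀ hc
  have hM0 : 0 ≤ M := by
    obtain ⟨x, hx⟩ := h.ne
    exact (norm_nonneg x).trans (hM x hx)
  have := seg_transport_real h hu (inv_pos.2 hc0) hθ1 0 (L := M * (1 - c⁻¹)) (by
    intro x hx τ h0 h1
    have e : x + τ • (c⁻¹ • x + 0 - x) = (1 - τ * (1 - c⁻¹)) • x := by module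
    rw [e]
    have := inv_pos.2 hc0
    exact hst.smul_mem hx (by nlinarith) (by nlinarith)) (by
    intro x hx
    have e : c⁻¹ • x + 0 - x = (-(1 - c⁻¹)) • x := by module
    rw [e, norm_smul, norm_neg, Real.norm_of_nonneg (by linarith), mul_comm]
    exact mul_le_mul_of_nonneg_right (hM x hx) (by linarith))
  simp only [add_zero] at this
  refine this.trans (mul_le_mul_of_nonneg_right ?_ (integral_nonneg fun _ => by positivity))
  have e : (M * (1 - c⁻¹))^2 * (c⁻¹ ^ 2)⁻¹ = (M * (c - 1))^2 := by field_simp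
  rw [e]
  exact pow_le_pow_left₀ (mul_nonneg hM0 (by linarith)) hb 2

open Pointwise in
lemma pc_up {Ω Ω' : Set E2} (h : Dom Ω) (h' : Dom Ω') (hs : Ω ⊆ Ω') {c : ℝ} (hc : 1 ≤ c)
    (hs' : Ω' ⊆ c • Ω) (hst : StarConvex ℝ 0 Ω') {M b K : ℝ}
    (hM : ∀ x ∈ Ω', ‖x‖ ≤ M) (hb : M * (c - 1) ≤ b) (hb0 : 0 < b) (hK : 0 < K)
    (hp : PC Ω K) : PC Ω' (c * K + b) := by
  intro v hv
  obtain ⟨m, hm⟩ := hp v hv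
  refine ⟨m, ?_⟩
  have hc0 : 0 < c := by linarith
  have hcv := hv.continuous
  have h1 := contraction h' hst hM hc hb hv
  have h2 : ∫ x in Ω', (v (c⁻¹ • x) - m)^2 ≤ (c * K)^2 * ∫ x in Ω', ‖fderiv ℝ v x‖^2 := by
    have := int_smul_le h hc0 hs' (f := fun x => (v x - m)^2) (by fun_prop) (fun _ => by positivity)
    have h3 := int_mono_set h' hs hv.cont_grad (fun _ => by positivity)
    calc _ ≤ _ := this
      _ ≤ c^2 * (K^2 * ∫ x in Ω', ‖fderiv ℝ v x‖^2) := by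
        refine mul_le_mul_of_nonneg_left (hm.trans ?_) (by positivity)
        gcongr
      _ = _ := by ring
  have h1' : ∫ x in Ω', (v x - v (c⁻¹ • x))^2 ≤ b^2 * ∫ x in Ω', ‖fderiv ℝ v x‖^2 := by
    refine le_of_eq_of_le ?_ h1
    congr 1; ext x; ring
  have := h'.mink (f := fun x => v (c⁻¹ • x) - m) (g := fun x => v x - v (c⁻¹ • x))
    (by fun_prop) (by fun_prop) (by positivity) hb0 h2 h1'
  refine le_of_eq_of_le ?_ this
  congr 1; ext x; ring

open Pointwise in
lemma pc_down {Ω Ω' : Set E2} (h : Dom Ω) (h' : Dom Ω') (hs : Ω ⊆ Ω') {c : ℝ} (hc : 1 ≤ c)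
    (hs' : Ω' ⊆ c • Ω) (hst : StarConvex ℝ 0 Ω) {M b K : ℝ}
    (hM : ∀ x ∈ Ω, ‖x‖ ≤ M) (hb : M * (c - 1) ≤ b) (hb0 : 0 < b) (hK : 0 < K)
    (hp : PC Ω' K) : PC Ω (K + b) := by
  intro v hv
  have hc0 : 0 < c := by linarith
  have hcv := hv.continuous
  have hsm : SmoothF (fun x => v (c⁻¹ • x)) := hv.comp (contDiff_const_smul c⁻¹)
  obtain ⟨m, hm⟩ := hp _ hsm
  refine ⟨m, ?_⟩
  have h1 := contraction h hst hM hc hb hv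
  have hE : ∫ x in Ω', ‖fderiv ℝ (fun x => v (c⁻¹ • x)) x‖^2 ≤ ∫ x in Ω, ‖fderiv ℝ v x‖^2 := by
    have := int_smul_le h hc0 hs' (f := fun x => (c⁻¹)^2 * ‖fderiv ℝ v x‖^2)
      (continuous_const.mul hv.cont_grad) (fun _ => by positivity)
    rw [integral_const_mul, integral_const_mul, ← mul_assoc, show c^2 * (c⁻¹)^2 = 1 by field_simp, one_mul] at this
    refine le_of_eq_of_le ?_ this
    rw [← integral_const_mul]
    congr 1; ext x
    rw [fderiv_comp_smul', norm_smul, mul_pow, Real.norm_eq_abs, sq_abs]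
  have h2 : ∫ x in Ω, (v (c⁻¹ • x) - m)^2 ≤ K^2 * ∫ x in Ω, ‖fderiv ℝ v x‖^2 := by
    refine (int_mono_set h' hs (by fun_prop) (fun _ => by positivity)).trans (hm.trans ?_)
    gcongr
  have h1' : ∫ x in Ω, (v x - v (c⁻¹ • x))^2 ≤ b^2 * ∫ x in Ω, ‖fderiv ℝ v x‖^2 := by
    refine le_of_eq_of_le ?_ h1
    congr 1; ext x; ring
  have := h.mink (f := fun x => v (c⁻¹ • x) - m) (g := fun x => v x - v (c⁻¹ • x))
    (by fun_prop) (by fun_prop) hK hb0 h2 h1'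
  refine le_of_eq_of_le ?_ this
  congr 1; ext x; ring

def rect (κ a : ℝ) : Set E2 := {x | |x 0| < κ ∧ |x 1| < a}

def Om (κ a : ℝ) : Set E2 := unitDisc ∪ rect κ a

lemma rect_open (κ a : ℝ) : IsOpen (rect κ a) := by
  have h0 : Continuous fun x : E2 => |x 0| := (smooth_coord 0).continuous.abs
  have h1 : Continuous fun x : E2 => |x 1| := (smooth_coord 1).continuous.abs
  exact (isOpen_lt h0 continuous_const).inter (isOpen_lt h1 continuous_const)

lemma norm_le_coords (x : E2) : ‖x‖ ≤ |x 0| + |x 1| := by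
  rw [EuclideanSpace.norm_eq]
  apply Real.sqrt_le_iff.2 ⟨by positivity, ?_⟩
  simp only [Fin.sum_univ_two, Real.norm_eq_abs]
  nlinarith [abs_nonneg (x 0), abs_nonneg (x 1)]

lemma coord_le_norm (x : E2) (i : Fin 2) : |x i| ≤ ‖x‖ := PiLp.norm_apply_le x i

lemma rect_convex (κ a : ℝ) : Convex ℝ (rect κ a) := by
  intro x hx y hy s t hs ht hst
  have key : ∀ {p q r : ℝ}, |p| < r → |q| < r → |s * p + t * q| < r := by
    intro p q r hp hq
    rw [abs_lt] at *
    rcases hs.eq_or_lt with rfl | h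
    · have : t = 1 := by linarith
      subst this; constructor <;> linarith
    · constructor <;> nlinarith
  exact ⟨by simpa using key hx.1 hy.1, by simpa using key hx.2 hy.2⟩

lemma Om_norm {κ a : ℝ} (hκ1 : κ ≤ 1) (ha : 0 ≤ a) : ∀ x ∈ Om κ a, ‖x‖ ≤ 1 + a := by
  rintro x (hx | hx)
  · simp only [unitDisc, mem_ball_zero_iff] at hx; linarith
  · have := norm_le_coords x
    have := hx.1; have := hx.2; linarith

lemma Om_dom {κ a : ℝ} (hκ1 : κ ≤ 1) (ha : 0 ≤ a) : Dom (Om κ a) :=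
  ⟨unitDisc_dom.ne.mono subset_union_left, unitDisc_dom.op.union (rect_open _ _),
    (Metric.isBounded_closedBall (x := 0) (r := 1 + a)).subset fun x hx => by
      simpa using Om_norm hκ1 ha x hx⟩

lemma ball_sub_rect {κ a : ℝ} (ha : κ ≤ a) : Metric.ball 0 κ ⊆ rect κ a := by
  intro x hx
  rw [mem_ball_zero_iff] at hx
  exact ⟨(coord_le_norm x 0).trans_lt hx, (coord_le_norm x 1).trans_lt (hx.trans_le ha)⟩

lemma Om_star {κ a : ℝ} (hκ1 : κ ≤ 1) (ha : κ ≤ a) {b : E2} (hb : ‖b‖ < κ) :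
    StarConvex ℝ b (Om κ a) := by
  apply StarConvex.union
  · exact (convex_ball _ _).starConvex (by simp; linarith)
  · exact (rect_convex _ _).starConvex (ball_sub_rect ha (by simpa using hb))

lemma Om_mono {κ a a' : ℝ} (h : a ≤ a') : Om κ a ⊆ Om κ a' :=
  union_subset_union_right _ fun _ hx => ⟨hx.1, hx.2.trans_le h⟩

open Pointwise in
lemma Om_smul {κ a a' : ℝ} (ha : 0 < a) (h : a ≤ a') : Om κ a' ⊆ (a' / a) • Om κ a := by
  have hc : 1 ≤ a' / a := by rwa [one_le_div ha]
  have hc0 : 0 < a' / a := by linarith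
  intro x hx
  rw [mem_smul_set_iff_inv_smul_mem₀ hc0.ne']
  have hi : (a' / a)⁻¹ ≤ 1 := inv_le_one_of_one_le₀ hc
  have hi0 := inv_pos.2 hc0
  rcases hx with hx | hx
  · left
    simp only [unitDisc, mem_ball_zero_iff] at *
    rw [norm_smul, Real.norm_of_nonneg hi0.le]
    nlinarith [norm_nonneg x]
  · right
    constructor
    · have := hx.1
      simp only [PiLp.smul_apply, smul_eq_mul, abs_mul, abs_of_pos hi0]
      nlinarith [abs_nonneg (x 0)]
    · have := hx.2
      simp only [PiLp.smul_apply, smul_eq_mul, abs_mul, abs_of_pos hi0]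
      rw [inv_div, div_mul_eq_mul_div, div_lt_iff₀ (by linarith)]
      exact mul_lt_mul_of_pos_left this ha

lemma Om_base {κ : ℝ} (hκ : 2 * κ^2 ≤ 1) : Om κ κ = unitDisc := by
  apply union_eq_self_of_subset_right
  intro x hx
  simp only [unitDisc, mem_ball_zero_iff]
  have h0 := hx.1; have h1 := hx.2
  have : ‖x‖^2 < 1 := by
    rw [EuclideanSpace.norm_sq_eq]
    simp only [Fin.sum_univ_two, Real.norm_eq_abs]
    nlinarith [abs_nonneg (x 0), abs_nonneg (x 1)]
  nlinarith [norm_nonneg x]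

lemma vol_box (p q r s : ℝ) :
    volume {x : E2 | x 0 ∈ Ioo p q ∧ x 1 ∈ Ioo r s} = ENNReal.ofReal (q - p) * ENNReal.ofReal (s - r) := by
  have e : {x : E2 | x 0 ∈ Ioo p q ∧ x 1 ∈ Ioo r s} = prodE ⁻¹' (Ioo p q ×ˢ Ioo r s) := by
    ext x; simp [prodE_apply, and_assoc]
  rw [e, prodE_mp.measure_preimage (measurableSet_Ioo.prod measurableSet_Ioo).nullMeasurableSet]
  rw [Measure.volume_eq_prod, Measure.prod_prod]; simp

lemma area_box {p q r s : ℝ} (h : p ≤ q) (h' : r ≤ s) :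
    area {x : E2 | x 0 ∈ Ioo p q ∧ x 1 ∈ Ioo r s} = (q - p) * (s - r) := by
  rw [area, vol_box, ENNReal.toReal_mul, ENNReal.toReal_ofReal (by linarith),
    ENNReal.toReal_ofReal (by linarith)]

end

noncomputable section

lemma area_mono {Ω Ω' : Set E2} (h : Dom Ω') (hs : Ω ⊆ Ω') : area Ω ≤ area Ω' :=
  ENNReal.toReal_mono h.fin.ne (measure_mono hs)

lemma rect_eq (κ a : ℝ) : rect κ a = {x : E2 | x 0 ∈ Ioo (-κ) κ ∧ x 1 ∈ Ioo (-a) a} := by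
  ext x; simp [rect, abs_lt]

lemma area_Om_le {κ a : ℝ} (hκ : 0 ≤ κ) (ha : 0 ≤ a) : area (Om κ a) ≤ π + 4 * κ * a := by
  have h := measure_union_le (μ := volume) unitDisc (rect κ a)
  have h1 : area (Om κ a) ≤ area unitDisc + area (rect κ a) := by
    rw [area, area, area, ← ENNReal.toReal_add unitDisc_dom.fin.ne]
    · apply ENNReal.toReal_mono _ h
      rw [rect_eq, vol_box]
      exact ENNReal.add_ne_top.2 ⟨unitDisc_dom.fin.ne, ENNReal.mul_ne_top ENNReal.ofReal_ne_top
        ENNReal.ofReal_ne_top⟩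
    · rw [rect_eq, vol_box]
      exact ENNReal.mul_ne_top ENNReal.ofReal_ne_top ENNReal.ofReal_ne_top
  rw [area_unitDisc, rect_eq, area_box (by linarith) (by linarith)] at h1
  nlinarith

lemma cont_helper {g : ℝ → ℝ} {κ A M : ℝ} (hκ : 0 < κ) (hM : 0 ≤ M) (g0 : ∀ a, 0 ≤ g a)
    (h1 : ∀ a a', κ ≤ a → a ≤ a' → a' ≤ A → g a ≤ g a' + M * (a' / a - 1))
    (h2 : ∀ a a', κ ≤ a → a ≤ a' → a' ≤ A → g a' ≤ (a' / a) * g a + M * (a' / a - 1)) :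
    ContinuousOn g (Icc κ A) := by
  rcases lt_or_ge A κ with hA | hA
  · simp [Icc_eq_empty (not_le.2 hA)]
  set B := (A / κ) * g κ + M * (A / κ - 1)
  have hAκ : 1 ≤ A / κ := (one_le_div hκ).2 hA
  have hB : ∀ a ∈ Icc κ A, g a ≤ B := by
    intro a ha
    have h3 := h2 κ a le_rfl ha.1 ha.2
    have h4 : a / κ ≤ A / κ := by gcongr; exact ha.2
    have := g0 κ
    simp only [B]
    nlinarith
  have hB0 : 0 ≤ B := (g0 κ).trans (hB κ ⟨le_rfl, hA⟩)
  have key : ∀ a a', κ ≤ a → a ≤ a' → a' ≤ A → |g a - g a'| ≤ (B + M) / κ * (a' - a) := by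
    intro a a' ha haa ha'
    have ha0 : 0 < a := by linarith
    have e : a' / a - 1 = (a' - a) / a := by field_simp
    have e2 : (a' - a) / a ≤ (a' - a) / κ := by
      apply div_le_div_of_nonneg_left (by linarith) hκ ha
    have e3 : 0 ≤ (a' - a) / a := div_nonneg (by linarith) ha0.le
    have h3 := h1 a a' ha haa ha'
    have h4 := h2 a a' ha haa ha'
    have e4 : a' / a = 1 + (a' - a) / a := by field_simp; ring
    have h5 := hB a ⟨ha, haa.trans ha'⟩
    have h6 : (B + M) / κ * (a' - a) = (B + M) * ((a' - a) / κ) := by ring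
    rw [h6, abs_le]
    rw [e] at h3
    rw [e, e4] at h4
    have := g0 a
    constructor <;> nlinarith
  have hC : 0 ≤ (B + M) / κ := by positivity
  refine (LipschitzOnWith.of_dist_le_mul (K := ⟨(B + M) / κ, hC⟩) ?_).continuousOn
  intro a ha a' ha'
  rw [Real.dist_eq, Real.dist_eq]
  change _ ≤ (B + M) / κ * |a - a'|
  rcases le_total a a' with h | h
  · rw [abs_sub_comm a a', abs_of_nonneg (by linarith : 0 ≤ a' - a)]
    exact key a a' ha.1 h ha'.2
  · rw [abs_sub_comm (g a), abs_of_nonneg (by linarith : 0 ≤ a - a')]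
    exact key a' a ha'.1 h ha.2

lemma nEig1_unitDisc_pos : 0 < nEig1 unitDisc := by
  obtain ⟨μ, G, g, P⟩ := exists_prof
  exact P.hμ.trans_le (disc_ge P)

lemma Om_nEig_pos {κ a : ℝ} (hκ0 : 0 < κ) (hκ1 : κ ≤ 1) (hκ : 2 * κ^2 ≤ 1) (ha : κ ≤ a) :
    0 < nEig1 (Om κ a) := by
  have hd := nEig1_unitDisc_pos
  have hp := pc_of_pos unitDisc_dom hd
  have hc : 1 ≤ a / κ := (one_le_div hκ0).2 ha
  have hs := Om_smul (κ := κ) hκ0 ha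
  rw [Om_base hκ] at hs
  have h0 := Om_star hκ1 ha (b := 0) (by simpa using hκ0)
  have hdom := Om_dom hκ1 (hκ0.le.trans ha)
  have := pc_up unitDisc_dom hdom subset_union_left hc hs h0
    (Om_norm hκ1 (hκ0.le.trans ha)) (b := (1 + a) * (a / κ - 1) + 1) (by linarith)
    (by nlinarith) (by positivity) hp
  exact (pc_inv_sqrt_le hdom (by
    have : 0 ≤ (1 + a) * (a / κ - 1) := mul_nonneg (by linarith) (by linarith)
    positivity) this).1

lemma Om_cont {κ A : ℝ} (hκ0 : 0 < κ) (hκ1 : κ ≤ 1) (hκ : 2 * κ^2 ≤ 1) :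
    ContinuousOn (fun a => area (Om κ a) * nEig1 (Om κ a)) (Icc κ A) := by
  rcases lt_or_ge A κ with hA | hA
  · simp [Icc_eq_empty (not_le.2 hA)]
  have hA0 : 0 < A := hκ0.trans_le hA
  have hpos : ∀ a ∈ Icc κ A, 0 < nEig1 (Om κ a) := fun a ha => Om_nEig_pos hκ0 hκ1 hκ ha.1
  have hdom : ∀ a, κ ≤ a → Dom (Om κ a) := fun a ha => Om_dom hκ1 (hκ0.le.trans ha)
  have hst : ∀ a, κ ≤ a → StarConvex ℝ 0 (Om κ a) := fun a ha =>
    Om_star hκ1 ha (b := 0) (by simpa using hκ0)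
  have hc1 : ContinuousOn (fun a => area (Om κ a)) (Icc κ A) := by
    have hB0 : 0 ≤ area (Om κ A) := (hdom A hA).pos.le
    refine cont_helper (M := (A / κ) * area (Om κ A)) hκ0 (by positivity)
      (fun a => ENNReal.toReal_nonneg) ?_ ?_
    · intro a a' ha haa ha'
      have h1 := area_mono (hdom a' (ha.trans haa)) (Om_mono (κ := κ) haa)
      have : 0 ≤ a' / a - 1 := by
        have := (one_le_div (hκ0.trans_le ha)).2 haa
        linarith
      have := mul_nonneg (mul_nonneg (by positivity : 0 ≤ A / κ) hB0) this
      linarith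
    · intro a a' ha haa ha'
      have ha0 := hκ0.trans_le ha
      have h1 : 1 ≤ a' / a := (one_le_div ha0).2 haa
      have h2 := area_mono ((hdom a ha).smul (c := a' / a) (by linarith)) (Om_smul (κ := κ) ha0 haa)
      rw [area_smul (by linarith)] at h2
      have h3 := area_mono (hdom A hA) (Om_mono (κ := κ) (haa.trans ha'))
      have h4 : a' / a ≤ A / κ := div_le_div₀ (by linarith) ha' hκ0 ha
      have h5 : (a' / a) * area (Om κ a) ≤ (A / κ) * area (Om κ A) := by
        have := (hdom a ha).pos
        gcongr
      nlinarith
  have hc2 : ContinuousOn (fun a => 1 / √(nEig1 (Om κ a))) (Icc κ A) := by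
    refine cont_helper (M := 1 + A) hκ0 (by linarith) (fun a => by positivity) ?_ ?_
    · intro a a' ha haa ha'
      have hc : 1 ≤ a' / a := (one_le_div (hκ0.trans_le ha)).2 haa
      have hp' := hpos a' ⟨ha.trans haa, ha'⟩
      refine le_of_forall_pos_le_add fun t ht => ?_
      have hK : 0 < 1 / √(nEig1 (Om κ a')) := by positivity
      have hb : 0 ≤ (1 + A) * (a' / a - 1) := mul_nonneg (by linarith) (by linarith)
      have := pc_down (hdom a ha) (hdom a' (ha.trans haa)) (Om_mono haa) hc
        (Om_smul (hκ0.trans_le ha) haa) (hst a ha) (M := 1 + A)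
        (fun x hx => (Om_norm hκ1 (hκ0.le.trans ha) x hx).trans (by linarith))
        (b := (1 + A) * (a' / a - 1) + t) (by linarith) (by linarith) hK
        (pc_of_pos (hdom a' (ha.trans haa)) hp')
      have := (pc_inv_sqrt_le (hdom a ha) (by linarith) this).2
      linarith
    · intro a a' ha haa ha'
      have hc : 1 ≤ a' / a := (one_le_div (hκ0.trans_le ha)).2 haa
      have hp' := hpos a ⟨ha, haa.trans ha'⟩
      refine le_of_forall_pos_le_add fun t ht => ?_
      have hK : 0 < 1 / √(nEig1 (Om κ a)) := by positivity
      have hb : 0 ≤ (1 + A) * (a' / a - 1) := mul_nonneg (by linarith) (by linarith)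
      have := pc_up (hdom a ha) (hdom a' (ha.trans haa)) (Om_mono haa) hc
        (Om_smul (hκ0.trans_le ha) haa) (hst a' (ha.trans haa)) (M := 1 + A)
        (fun x hx => (Om_norm hκ1 (hκ0.le.trans (ha.trans haa)) x hx).trans (by linarith))
        (b := (1 + A) * (a' / a - 1) + t) (by linarith) (by linarith) hK
        (pc_of_pos (hdom a ha) hp')
      have := (pc_inv_sqrt_le (hdom a' (ha.trans haa)) (by positivity) this).2
      linarith
  have hc3 : ContinuousOn (fun a => ((1 / √(nEig1 (Om κ a)))^2)⁻¹) (Icc κ A) := by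
    apply (hc2.pow 2).inv₀
    intro a ha
    have := hpos a ha
    have h3 : 0 < (1 / √(nEig1 (Om κ a)))^2 := by positivity
    exact h3.ne'
  refine (hc1.mul hc3).congr fun a ha => ?_
  have := hpos a ha
  simp only [Pi.mul_apply]
  rw [div_pow, Real.sq_sqrt this.le]; simp

lemma Om_upper {κ a : ℝ} (hκ0 : 0 < κ) (hκ1 : κ ≤ 1) (ha : 0 < a) :
    nEig1 (Om κ a) * (κ * a^3 / 4) ≤ area (Om κ a) := by
  have hdom := Om_dom hκ1 ha.le
  have h := nEig1_le_mean hdom (smooth_coord 1)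
  have hgrad : ∫ x in Om κ a, ‖fderiv ℝ (fun x : E2 => x 1) x‖^2 ≤ area (Om κ a) := by
    have e : (fun x : E2 => x 1) = (EuclideanSpace.proj (𝕜 := ℝ) (1 : Fin 2) : E2 →L[ℝ] ℝ) := by
      ext; rfl
    have hn : ‖(EuclideanSpace.proj (𝕜 := ℝ) (1 : Fin 2) : E2 →L[ℝ] ℝ)‖ ≤ 1 :=
      ContinuousLinearMap.opNorm_le_bound _ zero_le_one fun x => by
        simpa using PiLp.norm_apply_le x 1
    simp_rw [e, ContinuousLinearMap.fderiv]
    rw [setIntegral_const, smul_eq_mul]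
    have := pow_le_one₀ (n := 2) (norm_nonneg _) hn
    exact mul_le_of_le_one_right hdom.pos.le this
  set m := mean (Om κ a) (fun x => x 1)
  have hc1 : Continuous fun x : E2 => x 1 := (smooth_coord 1).continuous
  have key : ∀ r s : ℝ, -a ≤ r → s ≤ a → s - r = a / 2 → (∀ t ∈ Ioo r s, a^2 / 4 ≤ (t - m)^2) →
      κ * a^3 / 4 ≤ ∫ x in Om κ a, (x 1 - m)^2 := by
    intro r s hr hs hrs hb
    set S := {x : E2 | x 0 ∈ Ioo (-κ) κ ∧ x 1 ∈ Ioo r s} with hS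
    have hSm : MeasurableSet S := by
      have h0 : Continuous fun x : E2 => x 0 := (smooth_coord 0).continuous
      exact ((isOpen_Ioo.preimage h0).inter (isOpen_Ioo.preimage hc1)).measurableSet
    have hSs : S ⊆ Om κ a := by
      refine Subset.trans ?_ subset_union_right
      rw [rect_eq]
      exact fun x hx => ⟨hx.1, hr.trans_lt hx.2.1, hx.2.2.trans_le hs⟩
    have h1 := int_mono_set hdom hSs (f := fun x => (x 1 - m)^2) (by fun_prop) (fun _ => by positivity)
    refine le_trans ?_ h1
    have h2 : ∫ x in S, (a^2/4 : ℝ) ≤ ∫ x in S, (x 1 - m)^2 :=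
      setIntegral_mono_on ((hdom.intOn continuous_const).mono_set hSs)
        ((hdom.intOn (by fun_prop)).mono_set hSs) hSm fun x hx => hb _ hx.2
    rw [setIntegral_const, smul_eq_mul] at h2
    have h3 : volume.real S = κ * a := by
      change area S = _
      rw [hS, area_box (by linarith) (by linarith), hrs]; ring
    rw [h3] at h2
    linarith
  have hV : κ * a^3 / 4 ≤ ∫ x in Om κ a, (x 1 - m)^2 := by
    rcases le_total m 0 with hm | hm
    · exact key (a/2) a (by linarith) le_rfl (by ring) fun t ht => by nlinarith [ht.1]
    · exact key (-a) (-(a/2)) le_rfl (by linarith) (by ring) fun t ht => by nlinarith [ht.2]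
  exact (mul_le_mul_of_nonneg_left hV (nEig1_nonneg _)).trans (h.trans hgrad)

lemma exists_base {y δ : ℝ} (hy : 0 ≤ y) (hy2 : y ≤ π * nEig1 unitDisc) (hδ : 0 < δ) :
    ∃ (Ω : Set E2) (κ : ℝ), Dom Ω ∧ 0 < κ ∧ (∀ b : E2, ‖b‖ < κ → StarConvex ℝ b Ω) ∧
      Metric.ball 0 κ ⊆ Ω ∧ 0 < nEig1 Ω ∧ |area Ω * nEig1 Ω - y| ≤ δ ∧
      area Ω * dEig1 Ω ≤ π * dEig1 unitDisc + δ := by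
  set lam := dEig1 unitDisc
  have hl : 0 ≤ lam := dEig1_nonneg _
  obtain ⟨d, hd0, hd1, hd2⟩ : ∃ d : ℝ, 0 < d ∧ d ≤ 1 ∧ 4 * d * lam ≤ δ := by
    refine ⟨min 1 (δ / (4 * (lam + 1))), by positivity, min_le_left _ _, ?_⟩
    have : min 1 (δ / (4 * (lam + 1))) ≤ δ / (4 * (lam + 1)) := min_le_right _ _
    rw [le_div_iff₀ (by positivity)] at this
    have h0 : 0 ≤ min 1 (δ / (4 * (lam + 1))) := by positivity
    nlinarith
  set A := 2 + 4 * (π + 4)^2 / (d * δ) with hA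
  have hA2 : 2 ≤ A := by
    have : 0 ≤ 4 * (π + 4)^2 / (d * δ) := by positivity
    linarith
  set κ := d / A with hκ
  have hA0 : 0 < A := by linarith
  have hκ0 : 0 < κ := by positivity
  have hκA : κ * A = d := by rw [hκ]; field_simp
  have hκh : κ ≤ 1 / 2 := by nlinarith
  have hκ1 : κ ≤ 1 := by linarith
  have hκ2 : 2 * κ^2 ≤ 1 := by nlinarith
  have hκA' : κ ≤ A := by linarith
  have gen : ∀ a ∈ Icc κ A, |area (Om κ a) * nEig1 (Om κ a) - y| ≤ δ →
      ∃ (Ω : Set E2) (κ : ℝ), Dom Ω ∧ 0 < κ ∧ (∀ b : E2, ‖b‖ < κ → StarConvex ℝ b Ω) ∧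
      Metric.ball 0 κ ⊆ Ω ∧ 0 < nEig1 Ω ∧ |area Ω * nEig1 Ω - y| ≤ δ ∧
      area Ω * dEig1 Ω ≤ π * lam + δ := by
    intro a ha h
    refine ⟨Om κ a, κ, Om_dom hκ1 (hκ0.le.trans ha.1), hκ0, fun b hb => Om_star hκ1 ha.1 hb,
      (ball_sub_rect ha.1).trans subset_union_right, Om_nEig_pos hκ0 hκ1 hκ2 ha.1, h, ?_⟩
    have h1 : dEig1 (Om κ a) ≤ lam := dEig1_mono unitDisc_dom subset_union_left
    have h2 := area_Om_le hκ0.le (hκ0.le.trans ha.1)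
    have h3 : 4 * κ * a ≤ 4 * d := by nlinarith [ha.2]
    have h4 := (Om_dom hκ1 (hκ0.le.trans ha.1)).pos
    calc _ ≤ area (Om κ a) * lam := by gcongr
      _ ≤ (π + 4 * d) * lam := by gcongr; linarith
      _ ≤ _ := by nlinarith
  have hend : area (Om κ A) * nEig1 (Om κ A) ≤ δ := by
    have h1 := Om_upper hκ0 hκ1 hA0
    have h2 : area (Om κ A) ≤ π + 4 := by
      have := area_Om_le hκ0.le hA0.le
      nlinarith
    have h3 : κ * A^3 / 4 = d * A^2 / 4 := by rw [← hκA]; ring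
    rw [h3] at h1
    have h4 : 4 * (π + 4)^2 ≤ A^2 * (d * δ) := by
      have : 4 * (π + 4)^2 / (d * δ) ≤ A^2 := by nlinarith
      rwa [div_le_iff₀ (by positivity)] at this
    have h5 := (Om_dom hκ1 hA0.le).pos
    have h6 := nEig1_nonneg (Om κ A)
    have h7 : area (Om κ A) * (nEig1 (Om κ A) * (d * A^2 / 4)) ≤ (π + 4) * (π + 4) := by gcongr
                                                                                         linarith
    have h8 : 0 < d * A^2 := by positivity
    by_contra hcon
    push Not at hcon
    nlinarith
  have hstart : area (Om κ κ) * nEig1 (Om κ κ) = π * nEig1 unitDisc := by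
    rw [Om_base hκ2, area_unitDisc]
  rcases le_total y (area (Om κ A) * nEig1 (Om κ A)) with hyA | hyA
  · refine gen A ⟨hκA', le_rfl⟩ ?_
    rw [abs_le]; constructor <;> linarith
  · have := intermediate_value_Icc' hκA' (Om_cont hκ0 hκ1 hκ2 (A := A)) ⟨hyA, by rw [hstart]; exact hy2⟩
    obtain ⟨a, ha, hay⟩ := this
    refine gen a ha ?_
    simp only at hay
    rw [hay]; simpa using hδ.le

end

noncomputable section

/-- periodic weight vanishing near the integers -/
structure Wt (ε η : ℝ) (β : ℝ → ℝ) : Prop where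
  smooth : ContDiff ℝ (⊤ : ℕ∞) β
  nonneg : ∀ t, 0 ≤ β t
  le : ∀ t, β t ≤ 1 + ε
  per : Function.Periodic β 1
  int : ∀ a, ∫ t in a..(a+1), β t = 1
  zero : ∀ (t : ℝ) (k : ℤ), |t - k| ≤ 2 * η → β t = 0

lemma exists_wt {ε : ℝ} (hε : 0 < ε) : ∃ η1 > 0, ∀ η, 0 < η → η ≤ η1 → ∃ β, Wt ε η β := by
  obtain ⟨σ, hσ0, hσ1, hσε⟩ : ∃ σ : ℝ, 0 < σ ∧ σ ≤ 1/4 ∧ 1 ≤ (1 - 2 * σ) * (1 + ε) := by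
    refine ⟨min (1/4) (ε / (2 * (1 + ε))), by positivity, min_le_left _ _, ?_⟩
    have h := min_le_right (1/4) (ε / (2 * (1 + ε)))
    rw [le_div_iff₀ (by positivity)] at h
    linarith
  set a := 1 / (4 * σ^2) with ha
  have ha0 : 0 < a := by positivity
  set f : ℝ → ℝ := fun t => smoothTransition (a * (1 - cos (2 * π * t)) - 1) with hf
  have hfs : ContDiff ℝ (⊤ : ℕ∞) f := by
    apply smoothTransition.contDiff.comp
    have : ContDiff ℝ (⊤ : ℕ∞) fun t : ℝ => cos (2 * π * t) := Real.contDiff_cos.comp (by fun_prop)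
    exact (contDiff_const.mul (contDiff_const.sub this)).sub contDiff_const
  have hfc : Continuous f := hfs.continuous
  have hfper : Function.Periodic f 1 := by
    intro t
    simp only [hf]
    rw [show 2 * π * (t + 1) = 2 * π * t + 2 * π by ring, Real.cos_add_two_pi]
  have hf0 : ∀ t, 0 ≤ f t := fun t => smoothTransition.nonneg _
  have hf1 : ∀ t, f t ≤ 1 := fun t => smoothTransition.le_one _
  have hfone : ∀ t, σ ≤ t → t ≤ 1 - σ → f t = 1 := by
    intro t h1 h2
    apply smoothTransition.one_of_one_le
    have hs : 2 * σ ≤ sin (π * t) := by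
      rcases le_total t (1/2) with h | h
      · have := Real.mul_le_sin (x := π * t) (by have := pi_pos; nlinarith) (by nlinarith [pi_pos])
        rw [← mul_assoc, div_mul_cancel₀ _ pi_ne_zero] at this
        linarith
      · have := Real.mul_le_sin (x := π * (1 - t)) (by have := pi_pos; nlinarith) (by nlinarith [pi_pos])
        rw [← mul_assoc, div_mul_cancel₀ _ pi_ne_zero, show π * (1 - t) = π - π * t by ring,
          Real.sin_pi_sub] at this
        linarith
    have e : 1 - cos (2 * π * t) = 2 * sin (π * t)^2 := by
      rw [show 2 * π * t = 2 * (π * t) by ring, Real.cos_two_mul, Real.sin_sq]; ring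
    rw [e]
    have : 8 * σ^2 ≤ 2 * sin (π * t)^2 := by nlinarith
    have h3 : a * (8 * σ^2) = 2 := by rw [ha]; field_simp; norm_num
    nlinarith
  have hI1 : 1 - 2 * σ ≤ ∫ t in (0:ℝ)..1, f t := by
    have h1 : ∫ t in σ..(1-σ), f t ≤ ∫ t in (0:ℝ)..1, f t := by
      apply intervalIntegral.integral_mono_interval hσ0.le (by linarith) (by linarith)
        (ae_of_all _ hf0) (hfc.intervalIntegrable _ _)
    have h2 : ∫ t in σ..(1-σ), f t = ∫ t in σ..(1-σ), (1:ℝ) := by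
      apply intervalIntegral.integral_congr
      intro t ht
      rw [uIcc_of_le (by linarith)] at ht
      exact hfone t ht.1 ht.2
    rw [h2] at h1
    simp only [intervalIntegral.integral_const, smul_eq_mul, mul_one] at h1
    linarith
  set I := ∫ t in (0:ℝ)..1, f t
  have hI0 : 0 < I := by linarith
  refine ⟨min (1/8) (1 / (8 * π^2 * a + 1)), by positivity, fun η hη hη1 => ⟨fun t => f t / I, ?_⟩⟩
  refine ⟨hfs.div_const _, fun t => div_nonneg (hf0 t) hI0.le, fun t => ?_, fun t => ?_, fun b => ?_,
    fun t k htk => ?_⟩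
  · rw [div_le_iff₀ hI0]
    have := hf1 t
    nlinarith
  · show f (t + 1) / I = f t / I
    rw [hfper t]
  · rw [intervalIntegral.integral_div, hfper.intervalIntegral_add_eq b 0, zero_add]
    exact div_self hI0.ne'
  · have : f t = 0 := by
      have e : f t = f (t - k) := by
        have := hfper.sub_int_mul_eq (x := t) k
        rw [mul_one] at this; exact this.symm
      rw [e]
      apply smoothTransition.zero_of_nonpos
      have h1 := Real.one_sub_sq_div_two_le_cos (x := 2 * π * (t - k))
      have h2 : (t - k)^2 ≤ (2 * η)^2 := by
        rw [← sq_abs]; exact pow_le_pow_left₀ (abs_nonneg _) htk 2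
      have h3 : η ≤ 1 / (8 * π^2 * a + 1) := hη1.trans (min_le_right _ _)
      have h4 : η ≤ 1 := hη1.trans ((min_le_left _ _).trans (by norm_num))
      rw [le_div_iff₀ (by positivity)] at h3
      have h5 : 1 - cos (2 * π * (t - k)) ≤ 8 * π^2 * η^2 := by
        have : (2 * π * (t - k))^2 / 2 = 2 * π^2 * (t-k)^2 := by ring
        nlinarith [sq_nonneg π]
      have h6 : a * (8 * π^2 * η^2) ≤ 8 * π^2 * a * η := by
        have : η^2 ≤ η := by nlinarith
        have := mul_le_mul_of_nonneg_left this (by positivity : 0 ≤ 8 * π^2 * a)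
        linarith
      have := mul_le_mul_of_nonneg_left h5 ha0.le
      linarith
    rw [this, zero_div]

/-- weighted Cauchy–Schwarz -/
lemma wcs {α : Type*} [MeasurableSpace α] {ν : Measure α} {b h : α → ℝ} (b0 : ∀ x, 0 ≤ b x)
    (hb : Integrable b ν) (hbh : Integrable (fun x => b x * h x) ν)
    (hbh2 : Integrable (fun x => b x * h x ^ 2) ν) (h1 : ∫ x, b x ∂ν = 1) :
    (∫ x, b x * h x ∂ν)^2 ≤ ∫ x, b x * h x ^ 2 ∂ν := by
  set c := ∫ x, b x * h x ∂ν
  have h0 : 0 ≤ ∫ x, (b x * h x ^ 2 - (2 * c) * (b x * h x) + c^2 * b x) ∂ν := by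
    apply integral_nonneg
    intro x
    have : b x * h x ^ 2 - (2 * c) * (b x * h x) + c^2 * b x = b x * (h x - c)^2 := by ring
    simp only [Pi.zero_apply]
    rw [this]
    exact mul_nonneg (b0 x) (sq_nonneg _)
  have e : ∫ x, (b x * h x ^ 2 - (2 * c) * (b x * h x) + c^2 * b x) ∂ν
      = ∫ x, b x * h x ^ 2 ∂ν - (2 * c) * c + c^2 * 1 := by
    have hs : Integrable (fun x => b x * h x ^ 2 - (2 * c) * (b x * h x)) ν :=
      hbh2.sub (hbh.const_mul _)
    rw [integral_add hs (hb.const_mul _), integral_sub hbh2 (hbh.const_mul _),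
      integral_const_mul, integral_const_mul, h1]
  rw [e] at h0
  nlinarith

end

noncomputable section

abbrev e0 : E2 := EuclideanSpace.single 0 1
abbrev e1 : E2 := EuclideanSpace.single 1 1

def Sq : Set (ℝ × ℝ) := Icc 0 1 ×ˢ Icc 0 1

lemma Sq_compact : IsCompact Sq := isCompact_Icc.prod isCompact_Icc
lemma Sq_meas : MeasurableSet Sq := Sq_compact.isClosed.measurableSet
lemma Sq_vol : volume Sq = 1 := by
  rw [Sq, Measure.volume_eq_prod, Measure.prod_prod]; simp

lemma symm_eq (s t : ℝ) : prodE.symm (s, t) = s • e0 + t • e1 := by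
  rw [prodE_symm_apply]
  ext i
  fin_cases i <;> simp

lemma Sq_int {f : ℝ × ℝ → ℝ} (hf : Continuous f) : IntegrableOn f Sq :=
  hf.continuousOn.integrableOn_compact Sq_compact

lemma Sq_norm {z : ℝ × ℝ} (hz : z ∈ Sq) : ‖prodE.symm z‖ ≤ 2 := by
  refine (norm_le_coords _).trans ?_
  obtain ⟨⟨h1, h2⟩, h3, h4⟩ := hz
  rw [prodE_symm_apply]
  simp only [Matrix.cons_val_zero, Matrix.cons_val_one]
  rw [abs_of_nonneg h1, abs_of_nonneg h3]; linarith

/-- average over the unit square -/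
def avg (w : E2 → ℝ) (x : E2) : ℝ := ∫ z in Sq, w (x + prodE.symm z)

lemma avg_hasFDerivAt {w : E2 → ℝ} (hw : ContDiff ℝ 1 w) (x : E2) :
    HasFDerivAt (avg w) (∫ z in Sq, fderiv ℝ w (x + prodE.symm z)) x := by
  have hc := hw.continuous_fderiv (by norm_num)
  obtain ⟨C, hC⟩ := (isCompact_closedBall x 3).exists_bound_of_continuousOn hc.continuousOn
  have hwc := hw.continuous
  refine hasFDerivAt_integral_of_dominated_of_fderiv_le (𝕜 := ℝ)
    (F := fun y z => w (y + prodE.symm z)) (F' := fun y z => fderiv ℝ w (y + prodE.symm z))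
    (μ := volume.restrict Sq) (s := Metric.ball x 1) (bound := fun _ => C)
    (Metric.ball_mem_nhds x one_pos) (Eventually.of_forall fun y => ?_) ?_ ?_ ?_ ?_ ?_
  · exact (by fun_prop : Continuous fun z => w (y + prodE.symm z)).aestronglyMeasurable
  · exact Sq_int (by fun_prop)
  · exact (hc.comp (by fun_prop : Continuous fun z => x + prodE.symm z)).aestronglyMeasurable
  · refine (ae_restrict_iff' Sq_meas).2 (ae_of_all _ fun z hz y hy => hC _ ?_)
    rw [Metric.mem_closedBall, dist_eq_norm]
    rw [Metric.mem_ball, dist_eq_norm] at hy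
    have := Sq_norm hz
    calc ‖y + prodE.symm z - x‖ = ‖(y - x) + prodE.symm z‖ := by congr 1; abel
      _ ≤ ‖y - x‖ + ‖prodE.symm z‖ := norm_add_le _ _
      _ ≤ 3 := by linarith
  · have : IsFiniteMeasure (volume.restrict Sq) := ⟨by simp [Sq_vol]⟩
    exact integrable_const C
  · refine ae_of_all _ fun z y _ => ?_
    have h1 : HasFDerivAt w (fderiv ℝ w (y + prodE.symm z)) (y + prodE.symm z) :=
      (hw.differentiable (by norm_num) _).hasFDerivAt
    exact (hasFDerivAt_comp_add_right (prodE.symm z)).2 h1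

lemma avg_c1 {w : E2 → ℝ} (hw : ContDiff ℝ 1 w) : ContDiff ℝ 1 (avg w) := by
  rw [contDiff_one_iff_fderiv]
  refine ⟨fun x => (avg_hasFDerivAt hw x).differentiableAt, ?_⟩
  have e : fderiv ℝ (avg w) = fun x => ∫ z in Sq, fderiv ℝ w (x + prodE.symm z) :=
    funext fun x => (avg_hasFDerivAt hw x).fderiv
  rw [e]
  have hc := hw.continuous_fderiv (by norm_num)
  exact continuous_parametric_integral_of_continuous
    (f := fun x z => fderiv ℝ w (x + prodE.symm z)) (hc.comp (by fun_prop)) Sq_compact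

lemma ftc_dir {f : E2 → ℝ} (hf : ContDiff ℝ 1 f) (q e : E2) :
    ∫ t in Icc (0:ℝ) 1, fderiv ℝ f (q + t • e) e = f (q + e) - f q := by
  rw [integral_Icc_eq_integral_Ioc, ← intervalIntegral.integral_of_le zero_le_one]
  have hc := hf.continuous_fderiv (by norm_num)
  rw [intervalIntegral.integral_eq_sub_of_hasDerivAt (f := fun t : ℝ => f (q + t • e))]
  · simp
  · intro t _
    have h1 : HasFDerivAt f (fderiv ℝ f (q + t • e)) (q + t • e) :=
      (hf.differentiable (by norm_num) _).hasFDerivAt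
    have h2 : HasDerivAt (fun t : ℝ => q + t • e) e t := by
      simpa using ((hasDerivAt_id t).smul_const e).const_add q
    exact h1.comp_hasDerivAt t h2
  · apply Continuous.intervalIntegrable
    exact (hc.comp (by fun_prop)).clm_apply continuous_const

lemma sq_int0 {F : E2 → ℝ} (hF : Continuous F) (x : E2) :
    ∫ z in Sq, F (x + prodE.symm z) =
      ∫ t in Icc (0:ℝ) 1, ∫ s in Icc (0:ℝ) 1, F (x + t • e1 + s • e0) := by
  have hi : Integrable (fun z => F (x + prodE.symm z))
    ((volume.restrict (Icc (0:ℝ) 1)).prod (volume.restrict (Icc (0:ℝ) 1))) := by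
    rw [Measure.prod_restrict]
    exact Sq_int (f := fun z => F (x + prodE.symm z)) (by fun_prop)
  have h := integral_prod_symm _ hi
  rw [Measure.prod_restrict] at h
  refine Eq.trans h ?_
  congr 1; ext t; congr 1; ext s
  rw [symm_eq]; congr 1; abel

lemma sq_int1 {F : E2 → ℝ} (hF : Continuous F) (x : E2) :
    ∫ z in Sq, F (x + prodE.symm z) =
      ∫ s in Icc (0:ℝ) 1, ∫ t in Icc (0:ℝ) 1, F (x + s • e0 + t • e1) := by
  have hi : Integrable (fun z => F (x + prodE.symm z))
    ((volume.restrict (Icc (0:ℝ) 1)).prod (volume.restrict (Icc (0:ℝ) 1))) := by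
    rw [Measure.prod_restrict]
    exact Sq_int (f := fun z => F (x + prodE.symm z)) (by fun_prop)
  have h := integral_prod _ hi
  rw [Measure.prod_restrict] at h
  refine Eq.trans h ?_
  congr 1; ext t; congr 1; ext s
  rw [symm_eq]; congr 1; abel

/-- product weight -/
def Bw (β : ℝ → ℝ) (x : E2) : ℝ := β (x 0) * β (x 1)

namespace Wt
variable {ε η : ℝ} {β : ℝ → ℝ}

lemma int_Icc (h : Wt ε η β) (a : ℝ) : ∫ t in Icc (0:ℝ) 1, β (a + t) = 1 := by
  rw [integral_Icc_eq_integral_Ioc, ← intervalIntegral.integral_of_le zero_le_one]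
  rw [intervalIntegral.integral_comp_add_left (fun t => β t) a, add_zero]
  exact h.int a

lemma smooth0 (h : Wt ε η β) (i : Fin 2) : SmoothF (fun x => β (x i)) := h.smooth.comp (smooth_coord i)

lemma Bw_smooth (h : Wt ε η β) : SmoothF (Bw β) := (h.smooth0 0).mul (h.smooth0 1)

lemma Bw_nonneg (h : Wt ε η β) (x : E2) : 0 ≤ Bw β x := mul_nonneg (h.nonneg _) (h.nonneg _)

lemma one_le (h : Wt ε η β) : 0 ≤ 1 + ε := (h.nonneg 0).trans (h.le 0)

lemma Bw_le (h : Wt ε η β) (x : E2) : Bw β x ≤ (1 + ε)^2 := by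
  rw [sq]; exact mul_le_mul (h.le _) (h.le _) (h.nonneg _) h.one_le

lemma int_Bw (h : Wt ε η β) (x : E2) : ∫ z in Sq, Bw β (x + prodE.symm z) = 1 := by
  rw [sq_int0 h.Bw_smooth.continuous]
  have : ∀ t : ℝ, ∫ s in Icc (0:ℝ) 1, Bw β (x + t • e1 + s • e0) = β (x 1 + t) := by
    intro t
    simp only [Bw]
    simp [integral_mul_const, h.int_Icc]
  simp_rw [this]
  exact h.int_Icc _

lemma int_b1 (h : Wt ε η β) (x : E2) : ∫ z in Sq, β ((x + prodE.symm z) 1) = 1 := by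
  rw [sq_int0 (F := fun y => β (y 1)) (h.smooth0 1).continuous]
  simp [h.int_Icc]

lemma int_b0 (h : Wt ε η β) (x : E2) : ∫ z in Sq, β ((x + prodE.symm z) 0) = 1 := by
  rw [sq_int1 (F := fun y => β (y 0)) (h.smooth0 0).continuous]
  simp [h.int_Icc]

lemma d0 (h : Wt ε η β) {v : E2 → ℝ} (hv : SmoothF v) (x : E2) :
    fderiv ℝ (avg fun y => Bw β y * v y) x e0 =
      β (x 0) * ∫ z in Sq, β ((x + prodE.symm z) 1) * fderiv ℝ v (x + prodE.symm z) e0 := by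
  have hw : SmoothF (fun y => Bw β y * v y) := h.Bw_smooth.mul hv
  have hw1 : ContDiff ℝ 1 (fun y => Bw β y * v y) := hw.of_le (by exact_mod_cast le_top)
  have hv1 : ContDiff ℝ 1 v := hv.of_le (by exact_mod_cast le_top)
  have hcb := (h.smooth0 1).continuous
  rw [(avg_hasFDerivAt hw1 x).fderiv, ContinuousLinearMap.integral_apply]
  · rw [sq_int0 (F := fun y => fderiv ℝ (fun y => Bw β y * v y) y e0)
        (hw.cont_fd.clm_apply continuous_const),
      sq_int0 (F := fun y => β (y 1) * fderiv ℝ v y e0)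
        (hcb.mul (hv.cont_fd.clm_apply continuous_const)), ← integral_const_mul]
    congr 1; ext t
    rw [ftc_dir hw1]
    have : ∀ s : ℝ, β ((x + t • e1 + s • e0) 1) = β (x 1 + t) := by intro s; simp
    simp_rw [this]
    rw [integral_const_mul, ftc_dir hv1]
    have hp := h.per (x 0)
    simp only [Bw]
    simp only [PiLp.add_apply, PiLp.smul_apply, PiLp.single_apply]
    simp [hp]
    ring
  · exact ((hw.cont_fd.comp (by fun_prop : Continuous fun z => x + prodE.symm z)).continuousOn.integrableOn_compact Sq_compact)

lemma d1 (h : Wt ε η β) {v : E2 → ℝ} (hv : SmoothF v) (x : E2) :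
    fderiv ℝ (avg fun y => Bw β y * v y) x e1 =
      β (x 1) * ∫ z in Sq, β ((x + prodE.symm z) 0) * fderiv ℝ v (x + prodE.symm z) e1 := by
  have hw : SmoothF (fun y => Bw β y * v y) := h.Bw_smooth.mul hv
  have hw1 : ContDiff ℝ 1 (fun y => Bw β y * v y) := hw.of_le (by exact_mod_cast le_top)
  have hv1 : ContDiff ℝ 1 v := hv.of_le (by exact_mod_cast le_top)
  have hcb := (h.smooth0 0).continuous
  rw [(avg_hasFDerivAt hw1 x).fderiv, ContinuousLinearMap.integral_apply]
  · rw [sq_int1 (F := fun y => fderiv ℝ (fun y => Bw β y * v y) y e1)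
        (hw.cont_fd.clm_apply continuous_const),
      sq_int1 (F := fun y => β (y 0) * fderiv ℝ v y e1)
        (hcb.mul (hv.cont_fd.clm_apply continuous_const)), ← integral_const_mul]
    congr 1; ext t
    rw [ftc_dir hw1]
    have : ∀ s : ℝ, β ((x + t • e0 + s • e1) 0) = β (x 0 + t) := by intro s; simp
    simp_rw [this]
    rw [integral_const_mul, ftc_dir hv1]
    have hp := h.per (x 1)
    simp only [Bw]
    simp only [PiLp.add_apply, PiLp.smul_apply, PiLp.single_apply]
    simp [hp]
    ring
  · exact ((hw.cont_fd.comp (by fun_prop : Continuous fun z => x + prodE.symm z)).continuousOn.integrableOn_compact Sq_compact)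

end Wt

end

noncomputable section

/-- points both of whose coordinates are near integers -/
def bad (η : ℝ) : Set E2 := {y | (∃ k : ℤ, |y 0 - k| ≤ 2 * η) ∧ ∃ k : ℤ, |y 1 - k| ≤ 2 * η}

lemma bad_meas (η : ℝ) : MeasurableSet (bad η) := by
  have h : ∀ i : Fin 2, MeasurableSet {y : E2 | ∃ k : ℤ, |y i - k| ≤ 2 * η} := by
    intro i
    rw [show {y : E2 | ∃ k : ℤ, |y i - k| ≤ 2 * η} = ⋃ k : ℤ, {y : E2 | |y i - k| ≤ 2 * η} by
      ext; simp]
    refine MeasurableSet.iUnion fun k => ?_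
    have := (smooth_coord i).continuous
    exact (isClosed_le (by fun_prop) continuous_const).measurableSet
  exact (h 0).inter (h 1)

namespace Wt
variable {ε η : ℝ} {β : ℝ → ℝ}

lemma d_aux (h : Wt ε η β) {v : E2 → ℝ} (hv : SmoothF v) (x e : E2) (i j : Fin 2)
    (h_int : ∫ z in Sq, β ((x + prodE.symm z) i) = 1)
    (hb : ∀ y : E2, y ∈ bad η → β (y i) = 0)
    (hd : fderiv ℝ (avg fun y => Bw β y * v y) x e =
      β (x j) * ∫ z in Sq, β ((x + prodE.symm z) i) * fderiv ℝ v (x + prodE.symm z) e) :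
    ENNReal.ofReal ((fderiv ℝ (avg fun y => Bw β y * v y) x e)^2) ≤ ENNReal.ofReal ((1 + ε)^3) *
      ∫⁻ z in Sq, (bad η)ᶜ.indicator (fun y => ENNReal.ofReal ((fderiv ℝ v y e)^2))
        (x + prodE.symm z) := by
  have hcb := (h.smooth0 i).continuous
  have hcd : Continuous fun y => fderiv ℝ v y e := hv.cont_fd.clm_apply continuous_const
  have hcb' : Continuous fun z => β ((x + prodE.symm z) i) :=
    hcb.comp (by fun_prop : Continuous fun z => x + prodE.symm z)
  have hcd' : Continuous fun z => fderiv ℝ v (x + prodE.symm z) e :=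
    hcd.comp (by fun_prop : Continuous fun z => x + prodE.symm z)
  have hi2 : IntegrableOn (fun z => β ((x + prodE.symm z) i) *
      (fderiv ℝ v (x + prodE.symm z) e)^2) Sq := Sq_int (hcb'.mul (hcd'.pow 2))
  have hw := wcs (ν := volume.restrict Sq) (b := fun z => β ((x + prodE.symm z) i))
    (h := fun z => fderiv ℝ v (x + prodE.symm z) e) (fun z => h.nonneg _)
    (Sq_int hcb') (Sq_int (hcb'.mul hcd')) hi2 h_int
  set J := ∫ z in Sq, β ((x + prodE.symm z) i) * (fderiv ℝ v (x + prodE.symm z) e)^2 with hJ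
  have h1 : (fderiv ℝ (avg fun y => Bw β y * v y) x e)^2 ≤ (1 + ε)^2 * J := by
    rw [hd, mul_pow]
    exact mul_le_mul (pow_le_pow_left₀ (h.nonneg _) (h.le _) 2) hw (sq_nonneg _) (sq_nonneg _)
  refine (ENNReal.ofReal_le_ofReal h1).trans ?_
  rw [ENNReal.ofReal_mul (sq_nonneg _), hJ, ofReal_integral_eq_lintegral_ofReal hi2
    (ae_of_all _ fun z => mul_nonneg (h.nonneg _) (sq_nonneg _)), pow_succ (1 + ε) 2,
    ENNReal.ofReal_mul (sq_nonneg _), mul_assoc]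
  refine mul_le_mul' le_rfl ?_
  rw [← lintegral_const_mul' _ _ ENNReal.ofReal_ne_top]
  refine lintegral_mono fun z => ?_
  by_cases hz : (x + prodE.symm z) ∈ bad η
  · simp only [hb _ hz, zero_mul, ENNReal.ofReal_zero]; exact zero_le
  · rw [indicator_of_mem (by exact hz), ENNReal.ofReal_mul (h.nonneg _)]
    exact mul_le_mul' (ENNReal.ofReal_le_ofReal (h.le _)) le_rfl

lemma grad_pt (h : Wt ε η β) {v : E2 → ℝ} (hv : SmoothF v) (x : E2) :
    ENNReal.ofReal (‖fderiv ℝ (avg fun y => Bw β y * v y) x‖^2) ≤ ENNReal.ofReal ((1 + ε)^3) *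
      ∫⁻ z in Sq, (bad η)ᶜ.indicator (fun y => ENNReal.ofReal (‖fderiv ℝ v y‖^2))
        (x + prodE.symm z) := by
  have a0 := h.d_aux hv x e0 1 0 (h.int_b1 x) (fun y hy => by
    obtain ⟨k, hk⟩ := hy.2; exact h.zero _ k hk) (h.d0 hv x)
  have a1 := h.d_aux hv x e1 0 1 (h.int_b0 x) (fun y hy => by
    obtain ⟨k, hk⟩ := hy.1; exact h.zero _ k hk) (h.d1 hv x)
  rw [dual_norm_sq, ENNReal.ofReal_add (sq_nonneg _) (sq_nonneg _)]
  refine (add_le_add a0 a1).trans ?_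
  rw [← mul_add, ← lintegral_add_left]
  · refine mul_le_mul' le_rfl (lintegral_mono fun z => ?_)
    by_cases hz : (x + prodE.symm z) ∈ bad η
    · simp [hz]
    · rw [indicator_of_mem (by exact hz), indicator_of_mem (by exact hz), indicator_of_mem (by exact hz),
        dual_norm_sq, ENNReal.ofReal_add (sq_nonneg _) (sq_nonneg _)]
  · have hcd : Continuous fun y => fderiv ℝ v y e0 := hv.cont_fd.clm_apply continuous_const
    exact ((ENNReal.continuous_ofReal.comp (hcd.pow 2)).measurable.indicator
      (bad_meas η).compl).comp (by fun_prop : Measurable fun z => x + prodE.symm z)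

/-- energy of the contracted average -/
lemma grad_int (h : Wt ε η β) {v : E2 → ℝ} (hv : SmoothF v) {U : Set E2} (hU : Dom U) {θ : ℝ}
    (hθ : 0 < θ) (hmap : ∀ x ∈ U, ∀ z ∈ Sq, θ • x + prodE.symm z ∈ U) :
    ∫ x in U, ‖fderiv ℝ (fun x => avg (fun y => Bw β y * v y) (θ • x)) x‖^2 ≤
      (1 + ε)^3 * ∫ x in U \ bad η, ‖fderiv ℝ v x‖^2 := by
  have hw1 : ContDiff ℝ 1 (fun y => Bw β y * v y) :=
    (h.Bw_smooth.mul hv).of_le (by exact_mod_cast le_top)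
  have hA := avg_c1 hw1
  set A := avg fun y => Bw β y * v y
  have hAc : Continuous fun x => ‖fderiv ℝ A x‖^2 := (hA.continuous_fderiv (by norm_num)).norm.pow 2
  have e : ∀ x, ‖fderiv ℝ (fun x => A (θ • x)) x‖^2 = θ^2 * ‖fderiv ℝ A (θ • x)‖^2 := by
    intro x
    rw [fderiv_comp_smul', norm_smul, mul_pow, Real.norm_eq_abs, sq_abs]
  simp_rw [e]
  set G : E2 → ENNReal := (bad η)ᶜ.indicator (fun y => ENNReal.ofReal (‖fderiv ℝ v y‖^2)) with hG
  have hGm : Measurable G :=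
    (ENNReal.continuous_ofReal.comp hv.cont_grad).measurable.indicator (bad_meas η).compl
  have key : ∫⁻ x in U, ENNReal.ofReal (θ^2 * ‖fderiv ℝ A (θ • x)‖^2) ≤
      ENNReal.ofReal ((1 + ε)^3) * ∫⁻ x in U, G x := by
    calc _ ≤ ∫⁻ x in U, ENNReal.ofReal (θ^2) * (ENNReal.ofReal ((1 + ε)^3) *
            ∫⁻ z in Sq, G (θ • x + prodE.symm z)) := by
          refine lintegral_mono fun x => ?_
          simp only
          rw [ENNReal.ofReal_mul (sq_nonneg _)]
          exact mul_le_mul' le_rfl (h.grad_pt hv _)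
      _ = ENNReal.ofReal (θ^2) * (ENNReal.ofReal ((1 + ε)^3) *
            ∫⁻ x in U, ∫⁻ z in Sq, G (θ • x + prodE.symm z)) := by
          rw [lintegral_const_mul' _ _ ENNReal.ofReal_ne_top,
            lintegral_const_mul' _ _ ENNReal.ofReal_ne_top]
      _ = ENNReal.ofReal (θ^2) * (ENNReal.ofReal ((1 + ε)^3) *
            ∫⁻ z in Sq, ∫⁻ x in U, G (θ • x + prodE.symm z)) := by
          congr 2
          apply lintegral_lintegral_swap
          have : Measurable (fun q : E2 × (ℝ × ℝ) => G (θ • q.1 + prodE.symm q.2)) :=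
            hGm.comp (by fun_prop)
          exact this.aemeasurable
      _ ≤ ENNReal.ofReal (θ^2) * (ENNReal.ofReal ((1 + ε)^3) *
            ∫⁻ z in Sq, ENNReal.ofReal ((θ^2)⁻¹) * ∫⁻ x in U, G x) := by
          refine mul_le_mul' le_rfl (mul_le_mul' le_rfl (setLIntegral_mono' Sq_meas fun z hz => ?_))
          exact lint_affine hU.meas hGm hθ _ fun x hx => hmap x hx z hz
      _ = _ := by
          rw [setLIntegral_const, Sq_vol, mul_one, mul_left_comm, ← mul_assoc (ENNReal.ofReal (θ^2)),
            ← ENNReal.ofReal_mul (sq_nonneg _), mul_inv_cancel₀ (by positivity), ENNReal.ofReal_one,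
            one_mul]
  have e2 : ∫⁻ x in U, G x = ∫⁻ x in U \ bad η, ENNReal.ofReal (‖fderiv ℝ v x‖^2) := by
    rw [hG, lintegral_indicator (bad_meas η).compl, Measure.restrict_restrict (bad_meas η).compl]
    congr 2
    rw [inter_comm]; rfl
  rw [e2, ← ofReal_integral_eq_lintegral_ofReal, ← ofReal_integral_eq_lintegral_ofReal,
    ← ENNReal.ofReal_mul (pow_nonneg h.one_le 3)] at key
  · exact (ENNReal.ofReal_le_ofReal_iff (mul_nonneg (pow_nonneg h.one_le 3)
      (integral_nonneg fun _ => by positivity))).1 key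
  · exact (hU.intOn hv.cont_grad).mono_set sdiff_subset
  · exact ae_of_all _ fun _ => by positivity
  · exact hU.intOn (continuous_const.mul (hAc.comp (continuous_const_smul θ)))
  · exact ae_of_all _ fun _ => by positivity

/-- L² closeness of the contracted average -/
lemma avg_close (h : Wt ε η β) {v : E2 → ℝ} (hv : SmoothF v) {U : Set E2} (hU : Dom U) {θ L : ℝ}
    (hθ : 0 < θ) (hθ1 : θ ≤ 1)
    (hseg : ∀ z ∈ Sq, ∀ x ∈ U, ∀ τ : ℝ, 0 ≤ τ → τ ≤ 1 → x + τ • (θ • x + prodE.symm z - x) ∈ U)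
    (hL : ∀ z ∈ Sq, ∀ x ∈ U, ‖θ • x + prodE.symm z - x‖ ≤ L) :
    ∫ x in U, (v x - avg (fun y => Bw β y * v y) (θ • x))^2 ≤
      ((1 + ε)^2 * (L^2 * (θ^2)⁻¹)) * ∫ x in U, ‖fderiv ℝ v x‖^2 := by
  have hw1 : ContDiff ℝ 1 (fun y => Bw β y * v y) :=
    (h.Bw_smooth.mul hv).of_le (by exact_mod_cast le_top)
  have hA := (avg_c1 hw1).continuous
  have hvc := hv.continuous
  have hBc := h.Bw_smooth.continuous
  have pt : ∀ x, ENNReal.ofReal ((v x - avg (fun y => Bw β y * v y) (θ • x))^2) ≤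
      ENNReal.ofReal ((1+ε)^2) *
        ∫⁻ z in Sq, ENNReal.ofReal ((v (θ • x + prodE.symm z) - v x)^2) := by
    intro x
    have hb : Continuous fun z => Bw β (θ • x + prodE.symm z) := by fun_prop
    have hh : Continuous fun z => v (θ • x + prodE.symm z) - v x := by fun_prop
    have i2 : IntegrableOn (fun z => Bw β (θ • x + prodE.symm z) *
        (v (θ • x + prodE.symm z) - v x)^2) Sq := Sq_int (hb.mul (hh.pow 2))
    have hw := wcs (ν := volume.restrict Sq) (b := fun z => Bw β (θ • x + prodE.symm z))
      (h := fun z => v (θ • x + prodE.symm z) - v x) (fun z => h.Bw_nonneg _) (Sq_int hb)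
      (Sq_int (hb.mul hh)) i2 (h.int_Bw _)
    have e : ∫ z in Sq, Bw β (θ • x + prodE.symm z) * (v (θ • x + prodE.symm z) - v x)
        = avg (fun y => Bw β y * v y) (θ • x) - v x := by
      simp_rw [mul_sub]
      rw [integral_sub (Sq_int (by fun_prop)) (Sq_int (by fun_prop)), integral_mul_const, h.int_Bw,
        one_mul]
      rfl
    rw [e] at hw
    have e' : (v x - avg (fun y => Bw β y * v y) (θ • x))^2
        = (avg (fun y => Bw β y * v y) (θ • x) - v x)^2 := by ring
    rw [e']
    refine (ENNReal.ofReal_le_ofReal hw).trans ?_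
    rw [ofReal_integral_eq_lintegral_ofReal i2
      (ae_of_all _ fun z => mul_nonneg (h.Bw_nonneg _) (sq_nonneg _)),
      ← lintegral_const_mul' _ _ ENNReal.ofReal_ne_top]
    refine lintegral_mono fun z => ?_
    simp only
    rw [ENNReal.ofReal_mul (h.Bw_nonneg _)]
    exact mul_le_mul' (ENNReal.ofReal_le_ofReal (h.Bw_le _)) le_rfl
  refine of_lint (hU.intOn (by fun_prop)) (hU.intOn hv.cont_grad) (fun _ => by positivity)
    (fun _ => by positivity) (by positivity) ?_
  calc _ ≤ ∫⁻ x in U, ENNReal.ofReal ((1+ε)^2) *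
        ∫⁻ z in Sq, ENNReal.ofReal ((v (θ • x + prodE.symm z) - v x)^2) := lintegral_mono pt
    _ = ENNReal.ofReal ((1+ε)^2) * ∫⁻ x in U,
        ∫⁻ z in Sq, ENNReal.ofReal ((v (θ • x + prodE.symm z) - v x)^2) := by
        rw [lintegral_const_mul' _ _ ENNReal.ofReal_ne_top]
    _ = ENNReal.ofReal ((1+ε)^2) * ∫⁻ z in Sq,
        ∫⁻ x in U, ENNReal.ofReal ((v (θ • x + prodE.symm z) - v x)^2) := by
        congr 1
        apply lintegral_lintegral_swap
        have : Measurable (fun q : E2 × (ℝ × ℝ) =>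
            ENNReal.ofReal ((v (θ • q.1 + prodE.symm q.2) - v q.1)^2)) :=
          (ENNReal.continuous_ofReal.comp (by fun_prop)).measurable
        exact this.aemeasurable
    _ ≤ ENNReal.ofReal ((1+ε)^2) * ∫⁻ z in Sq,
        ENNReal.ofReal (L^2 * (θ^2)⁻¹) * ∫⁻ x in U, ENNReal.ofReal (‖fderiv ℝ v x‖^2) := by
        refine mul_le_mul' le_rfl (setLIntegral_mono' Sq_meas fun z hz => ?_)
        exact seg_transport hU.meas hv hθ hθ1 _ (hseg z hz) (hL z hz)
    _ = _ := by
        rw [setLIntegral_const, Sq_vol, mul_one, ← mul_assoc, ← ENNReal.ofReal_mul (sq_nonneg _)]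

end Wt

end

noncomputable section

def hole0 (η : ℝ) : Set E2 := {x | |x 0| ≤ η ∧ |x 1| ≤ η}
def cell0 : Set E2 := {x | |x 0| < 1/2 ∧ |x 1| < 1/2}

lemma cont_coord (i : Fin 2) : Continuous (fun x : E2 => x i) := (smooth_coord i).continuous

lemma hole0_closed (η : ℝ) : IsClosed (hole0 η) :=
  (isClosed_le (cont_coord 0).abs continuous_const).inter
    (isClosed_le (cont_coord 1).abs continuous_const)

lemma cell0_open : IsOpen cell0 :=
  (isOpen_lt (cont_coord 0).abs continuous_const).inter
    (isOpen_lt (cont_coord 1).abs continuous_const)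

lemma line_lint {u : E2 → ℝ} (hu : SmoothF u) {D : Set E2} (p e : E2) (he : ‖e‖ = 1)
    {a b : ℝ} (hab : |b - a| ≤ 1) (hD : ∀ t ∈ uIcc a b, p + t • e ∈ D) :
    ENNReal.ofReal ((u (p + b • e) - u (p + a • e))^2) ≤
      ∫⁻ t : ℝ, D.indicator (fun x => ENNReal.ofReal (‖fderiv ℝ u x‖^2)) (p + t • e) := by
  wlog h : a ≤ b generalizing a b
  · have := this (a := b) (b := a) (by rwa [abs_sub_comm]) (by rwa [uIcc_comm]) (le_of_not_ge h)
    convert this using 2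
    ring
  rw [uIcc_of_le h] at hD
  have hc : Continuous fun τ : ℝ => ‖fderiv ℝ u (p + τ • e)‖^2 :=
    hu.cont_grad.comp (by fun_prop)
  have h1 := seg_ineq hu (p + a • e) ((b - a) • e)
  have e1 : p + a • e + (b - a) • e = p + b • e := by rw [add_assoc, ← add_smul]; congr 2; ring
  have e2 : ∀ τ : ℝ, p + a • e + τ • (b - a) • e = p + (a + (b - a) * τ) • e := fun τ => by
    rw [add_assoc, smul_smul, ← add_smul]; congr 2; ring
  simp_rw [e1, e2, norm_smul, he, mul_one, Real.norm_eq_abs, sq_abs] at h1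
  have h2 := intervalIntegral.mul_integral_comp_add_mul (a := 0) (b := 1)
    (f := fun t : ℝ => ‖fderiv ℝ u (p + t • e)‖^2) (b - a) a
  simp only [mul_zero, add_zero, mul_one, add_sub_cancel] at h2
  rw [sq (b - a), mul_assoc, h2] at h1
  have h0 : 0 ≤ ∫ τ in a..b, ‖fderiv ℝ u (p + τ • e)‖^2 :=
    intervalIntegral.integral_nonneg h fun _ _ => by positivity
  have h3 : (u (p + b • e) - u (p + a • e))^2 ≤ ∫ τ in a..b, ‖fderiv ℝ u (p + τ • e)‖^2 :=
    h1.trans (mul_le_of_le_one_left h0 ((le_abs_self _).trans hab))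
  refine (ENNReal.ofReal_le_ofReal h3).trans ?_
  rw [intervalIntegral.integral_of_le h, ofReal_integral_eq_lintegral_ofReal]
  · refine le_trans ?_ (setLIntegral_le_lintegral (Ioc a b) _)
    refine setLIntegral_mono' measurableSet_Ioc fun t ht => ?_
    rw [indicator_of_mem (hD t (Ioc_subset_Icc_self ht))]
  · exact (hc.integrableOn_Icc (a := a) (b := b)).mono_set Ioc_subset_Icc_self
  · exact ae_of_all _ fun _ => by positivity

lemma e0_norm : ‖e0‖ = 1 := by simp [e0]
lemma e1_norm : ‖e1‖ = 1 := by simp [e1]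

lemma symm0 (z : ℝ × ℝ) : (prodE.symm z) 0 = z.1 := by simp [prodE_symm_apply]
lemma symm1 (z : ℝ × ℝ) : (prodE.symm z) 1 = z.2 := by simp [prodE_symm_apply]

lemma cell_poincare {η : ℝ} (hη : 0 < η) (hη8 : η ≤ 1/8) {u : E2 → ℝ} (hu : SmoothF u) :
    ∃ m : ℝ, ∫⁻ x in cell0 \ hole0 η, ENNReal.ofReal ((u x - m)^2) ≤
      15 * ∫⁻ x in cell0 \ hole0 η, ENNReal.ofReal (‖fderiv ℝ u x‖^2) := by
  set D := cell0 \ hole0 η with hDdef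
  have hDo : IsOpen D := cell0_open.sdiff (hole0_closed η)
  have hDm : MeasurableSet D := hDo.measurableSet
  set G : E2 → ENNReal := D.indicator (fun x => ENNReal.ofReal (‖fderiv ℝ u x‖^2)) with hG
  have hGm : Measurable G :=
    (ENNReal.continuous_ofReal.comp hu.cont_grad).measurable.indicator hDm
  have hGm2 : Measurable fun z : ℝ × ℝ => G (prodE.symm z) :=
    hGm.comp prodE.symm.continuous.measurable
  set H : ℝ → ENNReal := fun s => ∫⁻ t, G (prodE.symm (s, t)) with hH
  set K : ℝ → ENNReal := fun t => ∫⁻ s, G (prodE.symm (s, t)) with hK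
  have hHm : Measurable H := hGm2.lintegral_prod_right'
  have hKm : Measurable K := hGm2.lintegral_prod_left'
  set E := ∫⁻ x in D, ENNReal.ofReal (‖fderiv ℝ u x‖^2) with hE
  have eE : ∫⁻ z : ℝ × ℝ, G (prodE.symm z) = E := by
    rw [hE, ← lintegral_indicator hDm]
    exact prodE_symm_mp.lintegral_comp hGm
  have eH : ∫⁻ s, H s = E := by
    rw [← eE, Measure.volume_eq_prod, lintegral_prod _ hGm2.aemeasurable]
  have eK : ∫⁻ t, K t = E := by
    rw [← eE, Measure.volume_eq_prod, lintegral_prod_symm _ hGm2.aemeasurable]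
  have pick : ∀ F : ℝ → ENNReal, Measurable F → ∫⁻ s, F s = E →
      ∃ y ∈ Ioo η (1/2), F y ≤ ENNReal.ofReal (8/3) * E := by
    intro F hF hFE
    have hv : volume (Ioo η (1/2)) = ENNReal.ofReal (1/2 - η) := Real.volume_Ioo
    obtain ⟨y, hy, hle⟩ := exists_le_setLAverage (μ := volume) (s := Ioo η (1/2)) (f := F)
      (by rw [hv]; simp; linarith) (by rw [hv]; exact ENNReal.ofReal_ne_top) hF.aemeasurable
    refine ⟨y, hy, hle.trans ?_⟩
    rw [setLAverage_eq, hv, ENNReal.div_eq_inv_mul, ← ENNReal.ofReal_inv_of_pos (by linarith)]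
    refine mul_le_mul' (ENNReal.ofReal_le_ofReal ?_)
      ((setLIntegral_le_lintegral _ _).trans hFE.le)
    rw [inv_le_comm₀ (by linarith) (by norm_num)]; norm_num; linarith
  obtain ⟨y0, hy0, hHy⟩ := pick H hHm eH
  obtain ⟨y1, hy1, hKy⟩ := pick K hKm eK
  have memD : ∀ s t, prodE.symm (s, t) ∈ D ↔ (|s| < 1/2 ∧ |t| < 1/2) ∧ (η < |s| ∨ η < |t|) := by
    intro s t
    rw [hDdef]
    simp only [cell0, hole0, Set.mem_sdiff, mem_ofPred_eq, symm0, symm1]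
    rw [not_and_or]; simp only [not_le]
  have lineV : ∀ s a b, |s| < 1/2 → |a| < 1/2 → |b| < 1/2 → (∀ t ∈ uIcc a b, η < |s| ∨ η < |t|) →
      ENNReal.ofReal ((u (prodE.symm (s, b)) - u (prodE.symm (s, a)))^2) ≤ H s := by
    intro s a b hs ha hb h
    have := line_lint hu (D := D) (s • e0) e1 e1_norm (a := a) (b := b)
      (by rw [abs_lt] at ha hb; rw [abs_le]; constructor <;> linarith) (by
        intro t ht
        rw [← symm_eq, memD]
        refine ⟨⟨hs, ?_⟩, h t ht⟩
        have : t ∈ Ioo (-(1/2):ℝ) (1/2) := ordConnected_Ioo.uIcc_subset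
          (show a ∈ Ioo (-(1/2):ℝ) (1/2) from abs_lt.1 ha) (show b ∈ Ioo (-(1/2):ℝ) (1/2) from abs_lt.1 hb) ht
        exact abs_lt.2 this)
    simp only [← symm_eq] at this
    exact this
  have lineH : ∀ t a b, |t| < 1/2 → |a| < 1/2 → |b| < 1/2 → (∀ s ∈ uIcc a b, η < |s| ∨ η < |t|) →
      ENNReal.ofReal ((u (prodE.symm (b, t)) - u (prodE.symm (a, t)))^2) ≤ K t := by
    intro s a b hs ha hb h
    have := line_lint hu (D := D) (s • e1) e0 e0_norm (a := a) (b := b)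
      (by rw [abs_lt] at ha hb; rw [abs_le]; constructor <;> linarith) (by
        intro t ht
        rw [add_comm, ← symm_eq, memD]
        refine ⟨⟨?_, hs⟩, h t ht⟩
        have : t ∈ Ioo (-(1/2):ℝ) (1/2) := ordConnected_Ioo.uIcc_subset
          (show a ∈ Ioo (-(1/2):ℝ) (1/2) from abs_lt.1 ha) (show b ∈ Ioo (-(1/2):ℝ) (1/2) from abs_lt.1 hb) ht
        exact abs_lt.2 this)
    simp only [add_comm (s • e1), ← symm_eq] at this
    exact this
  have ay0 : |y0| < 1/2 := by rw [abs_of_pos (hη.trans hy0.1)]; exact hy0.2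
  have ay1 : |y1| < 1/2 := by rw [abs_of_pos (hη.trans hy1.1)]; exact hy1.2
  have hy0' : η < |y0| := hy0.1.trans_le (le_abs_self _)
  have hy1' : η < |y1| := hy1.1.trans_le (le_abs_self _)
  have comb : ∀ a b c : ℝ, ∀ A B : ENNReal, ENNReal.ofReal ((b - a)^2) ≤ A →
      ENNReal.ofReal ((b - c)^2) ≤ B → ENNReal.ofReal ((a - c)^2) ≤ 2 * (A + B) := by
    intro a b c A B hA hB
    refine le_trans ?_ (mul_le_mul' le_rfl (add_le_add hA hB))
    rw [← ENNReal.ofReal_add (by positivity) (by positivity),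
      show (2:ENNReal) = ENNReal.ofReal 2 by simp, ← ENNReal.ofReal_mul (by norm_num)]
    refine ENNReal.ofReal_le_ofReal ?_
    nlinarith [sq_nonneg (b - a + (b - c))]
  have pt : ∀ s t, prodE.symm (s, t) ∈ D →
      ENNReal.ofReal ((u (prodE.symm (s,t)) - u (prodE.symm (y0,y1)))^2) ≤
        2 * (H s + K t + ENNReal.ofReal (16/3) * E) := by
    intro s t hst
    rw [memD] at hst
    obtain ⟨⟨hs, ht⟩, hor⟩ := hst
    have e16 : ENNReal.ofReal (16/3) * E = ENNReal.ofReal (8/3) * E + ENNReal.ofReal (8/3) * E := by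
      rw [← add_mul, ← ENNReal.ofReal_add (by norm_num) (by norm_num)]; norm_num
    rw [e16]
    by_cases h : η < |s|
    · have l1 := lineV s t y1 hs ht ay1 (fun _ _ => Or.inl h)
      have l2 := lineH y1 y0 s ay1 ay0 hs (fun _ _ => Or.inr hy1')
      refine (comb _ _ _ _ _ l1 (l2.trans hKy)).trans (mul_le_mul' le_rfl ?_)
      refine add_le_add le_self_add le_self_add
    · have ht' : η < |t| := hor.resolve_left h
      have l1 := lineH t s y0 ht hs ay0 (fun _ _ => Or.inr ht')
      have l2 := lineV y0 y1 t ay0 ay1 ht (fun _ _ => Or.inl hy0')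
      refine (comb _ _ _ _ _ l1 (l2.trans hHy)).trans (mul_le_mul' le_rfl ?_)
      refine add_le_add le_add_self le_self_add
  refine ⟨u (prodE.symm (y0, y1)), ?_⟩
  set I : Set ℝ := Ioo (-(1/2)) (1/2) with hI
  have hIv : volume I = 1 := by rw [hI, Real.volume_Ioo]; norm_num
  set m := u (prodE.symm (y0, y1))
  have hFm : Measurable (D.indicator fun x => ENNReal.ofReal ((u x - m)^2)) := by
    have := hu.continuous
    exact (ENNReal.continuous_ofReal.comp (by fun_prop)).measurable.indicator hDm
  calc ∫⁻ x in D, ENNReal.ofReal ((u x - m)^2)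
      = ∫⁻ z : ℝ × ℝ, D.indicator (fun x => ENNReal.ofReal ((u x - m)^2)) (prodE.symm z) := by
        rw [← lintegral_indicator hDm]
        exact (prodE_symm_mp.lintegral_comp hFm).symm
    _ ≤ ∫⁻ z : ℝ × ℝ in I ×ˢ I, 2 * (H z.1 + K z.2 + ENNReal.ofReal (16/3) * E) := by
        rw [← lintegral_indicator (measurableSet_Ioo.prod measurableSet_Ioo)]
        refine lintegral_mono fun z => ?_
        by_cases hz : prodE.symm z ∈ D
        · have hz' : z ∈ I ×ˢ I := by
            have := ((memD z.1 z.2).1 hz).1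
            exact ⟨abs_lt.1 this.1, abs_lt.1 this.2⟩
          rw [indicator_of_mem hz, indicator_of_mem hz']
          exact pt z.1 z.2 hz
        · rw [indicator_of_notMem hz]; exact zero_le
    _ = 2 * (∫⁻ z : ℝ × ℝ in I ×ˢ I, (H z.1 + K z.2 + ENNReal.ofReal (16/3) * E)) := by
        rw [lintegral_const_mul' _ _ (by simp)]
    _ ≤ 2 * (E + E + ENNReal.ofReal (16/3) * E) := by
        refine mul_le_mul' le_rfl ?_
        rw [lintegral_add_left (by fun_prop), lintegral_add_left (by fun_prop)]
        have r : (volume : Measure (ℝ × ℝ)).restrict (I ×ˢ I)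
            = (volume.restrict I).prod (volume.restrict I) := by
          rw [Measure.volume_eq_prod, Measure.prod_restrict]
        refine add_le_add (add_le_add ?_ ?_) ?_
        · rw [r, lintegral_prod _ (by fun_prop)]
          simp only [lintegral_const, Measure.restrict_apply MeasurableSet.univ, univ_inter, hIv,
            mul_one]
          exact (setLIntegral_le_lintegral _ _).trans eH.le
        · rw [r, lintegral_prod _ (by fun_prop)]
          simp only [lintegral_const, Measure.restrict_apply MeasurableSet.univ, univ_inter, hIv,
            mul_one]
          exact (setLIntegral_le_lintegral _ _).trans eK.le
        · rw [r, lintegral_const, ← univ_prod_univ, Measure.prod_prod]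
          simp [hIv]
    _ ≤ 15 * E := by
        have : E + E + ENNReal.ofReal (16/3) * E = ENNReal.ofReal (22/3) * E := by
          rw [show ENNReal.ofReal (22/3) = 1 + 1 + ENNReal.ofReal (16/3) by
            rw [show (22/3:ℝ) = 1 + 1 + 16/3 by norm_num, ENNReal.ofReal_add (by norm_num)
              (by norm_num), ENNReal.ofReal_add (by norm_num) (by norm_num)]; simp]
          ring
        rw [this, ← mul_assoc]
        refine mul_le_mul' ?_ le_rfl
        rw [show (2:ENNReal) = ENNReal.ofReal 2 by simp, ← ENNReal.ofReal_mul (by norm_num),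
          show (15:ENNReal) = ENNReal.ofReal 15 by simp]
        exact ENNReal.ofReal_le_ofReal (by norm_num)

end

noncomputable section

def lat (p : ℤ × ℤ) : E2 := prodE.symm ((p.1 : ℝ), (p.2 : ℝ))
def hole (p : ℤ × ℤ) (η : ℝ) : Set E2 := {x | x - lat p ∈ hole0 η}
def cell (p : ℤ × ℤ) : Set E2 := {x | x - lat p ∈ cell0}

lemma lat0 (p : ℤ × ℤ) : (lat p) 0 = p.1 := symm0 _
lemma lat1 (p : ℤ × ℤ) : (lat p) 1 = p.2 := symm1 _

lemma cell_open (p : ℤ × ℤ) : IsOpen (cell p) := cell0_open.preimage (by fun_prop)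
lemma hole_closed (p : ℤ × ℤ) (η : ℝ) : IsClosed (hole p η) :=
  (hole0_closed η).preimage (by fun_prop)

lemma mem_cell {p : ℤ × ℤ} {x : E2} : x ∈ cell p ↔ |x 0 - p.1| < 1/2 ∧ |x 1 - p.2| < 1/2 := by
  simp [cell, cell0, lat0, lat1]
lemma mem_hole {p : ℤ × ℤ} {η : ℝ} {x : E2} :
    x ∈ hole p η ↔ |x 0 - p.1| ≤ η ∧ |x 1 - p.2| ≤ η := by
  simp [hole, hole0, lat0, lat1]

lemma hole0_sub {η : ℝ} (hη : η < 1/2) : hole0 η ⊆ cell0 :=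
  fun _ h => ⟨h.1.trans_lt hη, h.2.trans_lt hη⟩
lemma hole_sub {η : ℝ} (hη : η < 1/2) (p) : hole p η ⊆ cell p := fun _ h => hole0_sub hη h

lemma int_close {a b : ℤ} {x : ℝ} (h1 : |x - a| < 1/2) (h2 : |x - b| < 1/2) : a = b := by
  rw [abs_lt] at h1 h2
  have : (a:ℝ) < b + 1 := by linarith
  have h3 : (b:ℝ) < a + 1 := by linarith
  have h4 : a < b + 1 := by exact_mod_cast this
  have h5 : b < a + 1 := by exact_mod_cast h3
  omega

lemma cell_eq {p q : ℤ × ℤ} {x : E2} (h1 : x ∈ cell p) (h2 : x ∈ cell q) : p = q := by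
  rw [mem_cell] at h1 h2
  exact Prod.ext (int_close h1.1 h2.1) (int_close h1.2 h2.2)

/-- perforated domain -/
def perf (U : Set E2) (P : Finset (ℤ × ℤ)) (η : ℝ) : Set E2 := U \ ⋃ p ∈ P, hole p η

lemma perf_open {U : Set E2} (hU : IsOpen U) (P : Finset (ℤ × ℤ)) (η : ℝ) : IsOpen (perf U P η) :=
  hU.sdiff (P.finite_toSet.isClosed_biUnion fun p _ => hole_closed p η)

lemma cell_poincare_p {η : ℝ} (hη : 0 < η) (hη8 : η ≤ 1/8) {u : E2 → ℝ} (hu : SmoothF u) (p : ℤ × ℤ) :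
    ∃ m : ℝ, ∫⁻ x in cell p \ hole p η, ENNReal.ofReal ((u x - m)^2) ≤
      15 * ∫⁻ x in cell p \ hole p η, ENNReal.ofReal (‖fderiv ℝ u x‖^2) := by
  have hs : SmoothF (fun x => u (x + lat p)) := hu.comp (contDiff_id.add contDiff_const)
  obtain ⟨m, hm⟩ := cell_poincare hη hη8 hs
  refine ⟨m, ?_⟩
  have hm0 : MeasurableSet (cell0 \ hole0 η) := (cell0_open.sdiff (hole0_closed η)).measurableSet
  have hm1 : MeasurableSet (cell p \ hole p η) := ((cell_open p).sdiff (hole_closed p η)).measurableSet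
  have tr : ∀ f : E2 → ENNReal, ∫⁻ x in cell p \ hole p η, f x =
      ∫⁻ x in cell0 \ hole0 η, f (x + lat p) := by
    intro f
    rw [← lintegral_indicator hm0, ← lintegral_indicator hm1,
      ← lintegral_add_right_eq_self (μ := (volume : Measure E2)) _ (lat p)]
    refine lintegral_congr fun x => ?_
    have : x + lat p ∈ cell p \ hole p η ↔ x ∈ cell0 \ hole0 η := by
      simp [cell, hole]
    by_cases h : x ∈ cell0 \ hole0 η
    · rw [indicator_of_mem h, indicator_of_mem (this.2 h)]
    · rw [indicator_of_notMem h, indicator_of_notMem (fun h' => h (this.1 h'))]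
  rw [tr, tr]
  have e : ∀ x, fderiv ℝ (fun x => u (x + lat p)) x = fderiv ℝ u (x + lat p) := fun x =>
    fderiv_comp_add_right _
  simp_rw [e] at hm
  exact hm

lemma exists_chi {η : ℝ} (hη : 0 < η) : ∃ (χ : E2 → ℝ) (G : ℝ), SmoothF χ ∧ (∀ x, 0 ≤ χ x) ∧
    (∀ x, χ x ≤ 1) ∧ (∀ x ∈ hole0 η, χ =ᶠ[nhds x] 1) ∧ tsupport χ ⊆ hole0 (2 * η) ∧
    0 ≤ G ∧ ∀ x, ‖fderiv ℝ χ x‖ ≤ G := by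
  let f : ContDiffBump (0:E2) := ⟨1.5 * η, 1.9 * η, by positivity, by nlinarith⟩
  have hc : HasCompactSupport f := f.hasCompactSupport
  obtain ⟨G, hG⟩ := (hc.fderiv ℝ).exists_bound_of_continuous
    (SmoothF.cont_fd (u := f) f.contDiff)
  refine ⟨f, G, f.contDiff, fun _ => f.nonneg, fun _ => f.le_one, ?_, ?_,
    (norm_nonneg _).trans (hG 0), hG⟩
  · intro x hx
    refine f.eventuallyEq_one_of_mem_ball ?_
    rw [mem_ball_zero_iff, ← abs_of_nonneg (norm_nonneg x)]
    change |‖x‖| < 1.5 * η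
    apply abs_lt_of_sq_lt_sq _ (by positivity)
    rw [EuclideanSpace.norm_sq_eq, Fin.sum_univ_two]
    have h1 := sq_le_sq' (abs_le.1 hx.1).1 (abs_le.1 hx.1).2
    have h2 := sq_le_sq' (abs_le.1 hx.2).1 (abs_le.1 hx.2).2
    simp only [Real.norm_eq_abs, sq_abs]
    nlinarith
  · rw [f.tsupport_eq]
    intro x hx
    rw [mem_closedBall_zero_iff] at hx
    change ‖x‖ ≤ 1.9 * η at hx
    exact ⟨(coord_le_norm x 0).trans (hx.trans (by nlinarith)),
      (coord_le_norm x 1).trans (hx.trans (by nlinarith))⟩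

lemma lint_split {U : Set E2} (_hU : MeasurableSet U) {P : Finset (ℤ × ℤ)}
    (hP : ∀ p ∈ P, cell p ⊆ U) (f : E2 → ENNReal) :
    ∫⁻ x in U, f x = (∫⁻ x in U \ ⋃ p ∈ P, cell p, f x) + ∑ p ∈ P, ∫⁻ x in cell p, f x := by
  have hm : MeasurableSet (⋃ p ∈ P, cell p) :=
    Finset.measurableSet_biUnion _ fun p _ => (cell_open p).measurableSet
  rw [← lintegral_inter_add_sdiff f U hm, add_comm]
  congr 1
  rw [inter_eq_right.2 (iUnion₂_subset hP), lintegral_biUnion_finset]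
  · intro p _ q _ hpq
    exact disjoint_left.2 fun x h1 h2 => hpq (cell_eq h1 h2)
  · exact fun p _ => (cell_open p).measurableSet

lemma lint_split_perf {U : Set E2} (hU : IsOpen U) {P : Finset (ℤ × ℤ)} {η : ℝ} (hη : η < 1/2)
    (hP : ∀ p ∈ P, cell p ⊆ U) (f : E2 → ENNReal) :
    ∫⁻ x in perf U P η, f x = (∫⁻ x in U \ ⋃ p ∈ P, cell p, f x) +
      ∑ p ∈ P, ∫⁻ x in cell p \ hole p η, f x := by
  have hW := (perf_open hU P η).measurableSet
  have hm : MeasurableSet (⋃ p ∈ P, cell p) :=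
    Finset.measurableSet_biUnion _ fun p _ => (cell_open p).measurableSet
  have key := lint_split hU.measurableSet hP ((perf U P η).indicator f)
  have hWU : perf U P η ∩ U = perf U P η := inter_eq_left.2 sdiff_subset
  rw [setLIntegral_indicator hW, hWU] at key
  rw [key, setLIntegral_indicator hW]
  congr 1
  · congr 2
    rw [inter_eq_right]
    intro x hx
    refine ⟨hx.1, fun h => hx.2 ?_⟩
    simp only [mem_iUnion] at h ⊢
    obtain ⟨p, hp, h⟩ := h
    exact ⟨p, hp, hole_sub hη p h⟩
  · refine Finset.sum_congr rfl fun p hp => ?_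
    rw [setLIntegral_indicator hW]
    congr 2
    ext x
    constructor
    · rintro ⟨h1, h2⟩
      refine ⟨h2, fun h => h1.2 ?_⟩
      simp only [mem_iUnion]
      exact ⟨p, hp, h⟩
    · rintro ⟨h1, h2⟩
      refine ⟨⟨hP p hp h1, fun h => ?_⟩, h1⟩
      simp only [mem_iUnion] at h
      obtain ⟨q, hq, h⟩ := h
      obtain rfl := cell_eq h1 (hole_sub hη q h)
      exact h2 h

lemma of_lint2 {A B : Set E2} {f g : E2 → ℝ} (hf : IntegrableOn f A) (hg : IntegrableOn g B)
    (f0 : ∀ x, 0 ≤ f x) (g0 : ∀ x, 0 ≤ g x) {C : ℝ} (hC : 0 ≤ C)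
    (h : ∫⁻ x in A, ENNReal.ofReal (f x) ≤ ENNReal.ofReal C * ∫⁻ x in B, ENNReal.ofReal (g x)) :
    ∫ x in A, f x ≤ C * ∫ x in B, g x := by
  rw [← ofReal_integral_eq_lintegral_ofReal hf (ae_of_all _ f0),
    ← ofReal_integral_eq_lintegral_ofReal hg (ae_of_all _ g0), ← ENNReal.ofReal_mul hC] at h
  exact (ENNReal.ofReal_le_ofReal_iff (mul_nonneg hC (integral_nonneg g0))).1 h

lemma ext_exists {η : ℝ} (hη : 0 < η) (hη8 : η ≤ 1/8) : ∃ C : ℝ, 0 < C ∧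
    ∀ (U : Set E2) (P : Finset (ℤ × ℤ)), Dom U → (∀ p ∈ P, cell p ⊆ U) →
    ∀ u : E2 → ℝ, SmoothF u → ∃ v : E2 → ℝ, SmoothF v ∧
      (∫ x in U, ‖fderiv ℝ v x‖^2 ≤ C * ∫ x in perf U P η, ‖fderiv ℝ u x‖^2) ∧
      (∫ x in perf U P η, (u x - v x)^2 ≤ C * ∫ x in perf U P η, ‖fderiv ℝ u x‖^2) ∧
      (∫ x in U \ bad η, ‖fderiv ℝ v x‖^2 ≤ ∫ x in perf U P η, ‖fderiv ℝ u x‖^2) := by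
  obtain ⟨χ, G, hχ, χ0, χ1, χh, χs, G0, hG⟩ := exists_chi hη
  refine ⟨15 + 30 * G^2, by positivity, ?_⟩
  intro U P hU hP u hu
  choose m hm using fun p => cell_poincare_p hη hη8 hu p
  have hsub : hole0 (2 * η) ⊆ cell0 := hole0_sub (by linarith)
  let v : E2 → ℝ := fun x => u x + ∑ p ∈ P, χ (x - lat p) * (m p - u x)
  have hχp : ∀ p, SmoothF fun x => χ (x - lat p) := fun p => hχ.comp (contDiff_id.sub contDiff_const)
  have hv : SmoothF v := hu.add (ContDiff.sum fun p _ => (hχp p).mul (contDiff_const.sub hu))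
  have χz : ∀ x p, x ∉ cell p → χ (x - lat p) = 0 := fun x p hx =>
    image_eq_zero_of_notMem_tsupport fun h => hx (hsub (χs h))
  -- value on a cell
  have vcell : ∀ p ∈ P, ∀ x ∈ cell p, v x = u x + χ (x - lat p) * (m p - u x) := by
    intro p hp x hx
    change u x + _ = _
    rw [Finset.sum_eq_single p]
    · intro q _ hq
      rw [χz x q (fun h => hq (cell_eq h hx)), zero_mul]
    · exact fun h => absurd hp h
  have vout : ∀ x, (∀ p ∈ P, x - lat p ∉ tsupport χ) → v =ᶠ[nhds x] u := by
    intro x hx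
    have : ∀ p ∈ P, ∀ᶠ y in nhds x, χ (y - lat p) = 0 := by
      intro p hp
      have h1 := notMem_tsupport_iff_eventuallyEq.1 (hx p hp)
      have h2 : Tendsto (fun y : E2 => y - lat p) (nhds x) (nhds (x - lat p)) :=
        (by fun_prop : Continuous fun y : E2 => y - lat p).tendsto x
      exact h2.eventually h1
    have h3 := (Filter.eventually_all_finset P).2 this
    filter_upwards [h3] with y hy
    change u y + _ = _
    rw [Finset.sum_eq_zero, add_zero]
    intro p hp
    rw [hy p hp, zero_mul]
  have gout : ∀ x, x ∉ ⋃ p ∈ P, cell p → fderiv ℝ v x = fderiv ℝ u x := by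
    intro x hx
    refine (vout x fun p hp h => hx ?_).fderiv_eq
    simp only [mem_iUnion]
    exact ⟨p, hp, hsub (χs h)⟩
  have ghole : ∀ p ∈ P, ∀ x ∈ hole p η, fderiv ℝ v x = 0 := by
    intro p hp x hx
    have h2 : Tendsto (fun y : E2 => y - lat p) (nhds x) (nhds (x - lat p)) :=
        (by fun_prop : Continuous fun y : E2 => y - lat p).tendsto x
    have h1 := h2.eventually (χh _ hx)
    have h3 : v =ᶠ[nhds x] fun _ => m p := by
      filter_upwards [h1, (cell_open p).mem_nhds (hole_sub (by linarith) p hx)] with y h1 h2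
      rw [vcell p hp y h2, h1]; simp
    rw [h3.fderiv_eq]; simp
  have gcell : ∀ p ∈ P, ∀ x ∈ cell p, ‖fderiv ℝ v x‖^2 ≤
      2 * ‖fderiv ℝ u x‖^2 + 2 * G^2 * (u x - m p)^2 := by
    intro p hp x hx
    have h3 : v =ᶠ[nhds x] fun x => u x + χ (x - lat p) * (m p - u x) := by
      filter_upwards [(cell_open p).mem_nhds hx] with y hy using vcell p hp y hy
    have hu' : HasFDerivAt u (fderiv ℝ u x) x := (hu.differentiable (by simp) _).hasFDerivAt
    have hχ' : HasFDerivAt (fun x => χ (x - lat p)) (fderiv ℝ χ (x - lat p)) x := by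
      have := ((hχp p).differentiable (by simp) x).hasFDerivAt
      rwa [fderiv_comp_sub] at this
    have h4 := hu'.add (hχ'.mul (hu'.const_sub (m p)))
    rw [h3.fderiv_eq, HasFDerivAt.fderiv (f := fun x => u x + χ (x - lat p) * (m p - u x)) h4]
    have e : fderiv ℝ u x + (χ (x - lat p) • -fderiv ℝ u x + (m p - u x) • fderiv ℝ χ (x - lat p))
        = (1 - χ (x - lat p)) • fderiv ℝ u x + (m p - u x) • fderiv ℝ χ (x - lat p) := by
      module
    rw [e]
    have b1 : ‖(1 - χ (x - lat p)) • fderiv ℝ u x‖ ≤ ‖fderiv ℝ u x‖ := by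
      rw [norm_smul]
      refine mul_le_of_le_one_left (norm_nonneg _) ?_
      rw [Real.norm_eq_abs, abs_le]
      constructor <;> linarith [χ0 (x - lat p), χ1 (x - lat p)]
    have b2 : ‖(m p - u x) • fderiv ℝ χ (x - lat p)‖ ≤ |u x - m p| * G := by
      rw [norm_smul, Real.norm_eq_abs, abs_sub_comm]
      exact mul_le_mul_of_nonneg_left (hG _) (abs_nonneg _)
    have b3 := (norm_add_le ((1 - χ (x - lat p)) • fderiv ℝ u x)
      ((m p - u x) • fderiv ℝ χ (x - lat p))).trans (add_le_add b1 b2)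
    refine (pow_le_pow_left₀ (norm_nonneg _) b3 2).trans ?_
    have : (|u x - m p| * G)^2 = G^2 * (u x - m p)^2 := by rw [mul_pow, sq_abs]; ring
    nlinarith [sq_nonneg (‖fderiv ℝ u x‖ - |u x - m p| * G)]
  set F : E2 → ENNReal := fun x => ENNReal.ofReal (‖fderiv ℝ u x‖^2) with hF
  have hWo := perf_open hU.op P η
  have hWs : perf U P η ⊆ U := sdiff_subset
  have hUu := hU.intOn hu.cont_grad
  have hη2 : η < 1/2 := by linarith
  have Fm : Measurable F := (ENNReal.continuous_ofReal.comp hu.cont_grad).measurable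
  have hDm : ∀ p, MeasurableSet (cell p \ hole p η) := fun p =>
    ((cell_open p).sdiff (hole_closed p η)).measurableSet
  have huc := hu.continuous
  have hvc := hv.continuous
  have c15 : (15:ENNReal) = ENNReal.ofReal 15 := by simp
  have one_le : (1:ENNReal) ≤ ENNReal.ofReal (15 + 30 * G^2) := by
    rw [← ENNReal.ofReal_one]; exact ENNReal.ofReal_le_ofReal (by nlinarith [sq_nonneg G])
  refine ⟨v, hv, ?_, ?_, ?_⟩
  · refine of_lint2 (hU.intOn hv.cont_grad) (hUu.mono_set hWs) (fun _ => by positivity)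
      (fun _ => by positivity) (by positivity) ?_
    rw [lint_split hU.meas hP, lint_split_perf hU.op hη2 hP, mul_add, Finset.mul_sum]
    refine add_le_add ?_ (Finset.sum_le_sum fun p hp => ?_)
    · have : ∫⁻ x in U \ ⋃ p ∈ P, cell p, ENNReal.ofReal (‖fderiv ℝ v x‖^2)
          = ∫⁻ x in U \ ⋃ p ∈ P, cell p, F x := by
        refine setLIntegral_congr_fun (hU.meas.diff (Finset.measurableSet_biUnion _ fun p _ =>
          (cell_open p).measurableSet)) fun x hx => ?_
        simp only [hF]
        rw [gout x hx.2]
      rw [this]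
      exact le_mul_of_one_le_left (zero_le) one_le
    · have hz : ∫⁻ x in cell p, ENNReal.ofReal (‖fderiv ℝ v x‖^2)
          = ∫⁻ x in cell p \ hole p η, ENNReal.ofReal (‖fderiv ℝ v x‖^2) := by
        rw [← lintegral_inter_add_sdiff _ (cell p) (hole_closed p η).measurableSet]
        have : ∫⁻ x in cell p ∩ hole p η, ENNReal.ofReal (‖fderiv ℝ v x‖^2) = 0 := by
          rw [setLIntegral_congr_fun (g := fun _ => 0)
            ((cell_open p).measurableSet.inter (hole_closed p η).measurableSet)]
          · simp
          · intro x hx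
            simp [ghole p hp x hx.2]
        rw [this, zero_add]
      rw [hz]
      calc _ ≤ ∫⁻ x in cell p \ hole p η, (ENNReal.ofReal 2 * F x +
            ENNReal.ofReal (2 * G^2) * ENNReal.ofReal ((u x - m p)^2)) := by
            refine setLIntegral_mono' (hDm p) fun x hx => ?_
            rw [hF, ← ENNReal.ofReal_mul (by norm_num), ← ENNReal.ofReal_mul (by positivity),
              ← ENNReal.ofReal_add (by positivity) (by positivity)]
            exact ENNReal.ofReal_le_ofReal (gcell p hp x hx.1)
        _ = ENNReal.ofReal 2 * (∫⁻ x in cell p \ hole p η, F x) + ENNReal.ofReal (2 * G^2) *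
            ∫⁻ x in cell p \ hole p η, ENNReal.ofReal ((u x - m p)^2) := by
            rw [lintegral_add_left (Fm.const_mul _), lintegral_const_mul' _ _ ENNReal.ofReal_ne_top,
              lintegral_const_mul' _ _ ENNReal.ofReal_ne_top]
        _ ≤ ENNReal.ofReal 2 * (∫⁻ x in cell p \ hole p η, F x) + ENNReal.ofReal (2 * G^2) *
            (15 * ∫⁻ x in cell p \ hole p η, F x) := add_le_add le_rfl (mul_le_mul' le_rfl (hm p))
        _ ≤ _ := by
            rw [← mul_assoc, ← add_mul, c15, ← ENNReal.ofReal_mul (by positivity),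
              ← ENNReal.ofReal_add (by positivity) (by positivity)]
            refine mul_le_mul' (ENNReal.ofReal_le_ofReal ?_) le_rfl
            nlinarith
  · refine of_lint2 ((hU.intOn (by fun_prop)).mono_set hWs) (hUu.mono_set hWs)
      (fun _ => by positivity) (fun _ => by positivity) (by positivity) ?_
    rw [lint_split_perf hU.op hη2 hP, lint_split_perf hU.op hη2 hP, mul_add, Finset.mul_sum]
    refine add_le_add ?_ (Finset.sum_le_sum fun p hp => ?_)
    · rw [setLIntegral_congr_fun (g := fun _ => 0) (hU.meas.diff
        (Finset.measurableSet_biUnion _ fun p _ => (cell_open p).measurableSet))]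
      · simp
      · intro x hx
        have : v x = u x := (vout x fun p hp h => hx.2 (by
          simp only [mem_iUnion]; exact ⟨p, hp, hsub (χs h)⟩)).self_of_nhds
        simp [this]
    · refine le_trans (setLIntegral_mono' (hDm p) fun x hx => ?_) ((hm p).trans ?_)
      · refine ENNReal.ofReal_le_ofReal ?_
        rw [vcell p hp x hx.1]
        have : u x - (u x + χ (x - lat p) * (m p - u x)) = χ (x - lat p) * (u x - m p) := by ring
        rw [this, mul_pow]
        refine mul_le_of_le_one_left (sq_nonneg _) ?_
        exact pow_le_one₀ (χ0 _) (χ1 _)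
      · rw [c15]
        exact mul_le_mul' (ENNReal.ofReal_le_ofReal (by nlinarith [sq_nonneg G])) le_rfl
  · have h1 : ∫ x in U \ bad η, ‖fderiv ℝ v x‖^2 = ∫ x in U \ bad η, ‖fderiv ℝ u x‖^2 := by
      refine setIntegral_congr_fun (hU.meas.diff (bad_meas η)) fun x hx => ?_
      rw [(vout x fun p _ h => hx.2 ?_).fderiv_eq]
      have := mem_hole.1 (χs h : x ∈ hole p (2 * η))
      exact ⟨⟨p.1, this.1⟩, ⟨p.2, this.2⟩⟩
    rw [h1]
    refine setIntegral_mono_set (hUu.mono_set hWs) (ae_of_all _ fun _ => by positivity)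
      (LE.le.eventuallyLE fun x hx => ⟨hx.1, fun h => hx.2 ?_⟩)
    simp only [mem_iUnion] at h
    obtain ⟨p, _, h⟩ := h
    have := mem_hole.1 h
    exact ⟨⟨p.1, this.1.trans (by linarith)⟩, ⟨p.2, this.2.trans (by linarith)⟩⟩

end

noncomputable section

open Pointwise in
lemma neumann_lower {Ω : Set E2} (hΩ : Dom Ω) {κ : ℝ} (hκ : 0 < κ)
    (hstar : ∀ b : E2, ‖b‖ < κ → StarConvex ℝ b Ω) (hpos : 0 < nEig1 Ω) {ε η : ℝ} {β : ℝ → ℝ}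
    (hε : 0 < ε) (hη : 0 < η) (hη8 : η ≤ 1/8) (hβ : Wt ε η β) :
    ∃ A N0 : ℝ, 0 < A ∧ 0 < N0 ∧ ∀ N : ℝ, N0 ≤ N → ∀ P : Finset (ℤ × ℤ),
      (∀ p ∈ P, cell p ⊆ N • Ω) → Dom (perf (N • Ω) P η) →
      PC (perf (N • Ω) P η) (A + (1 + ε)^2 * (N / √(nEig1 Ω))) := by
  obtain ⟨C, hC, hext⟩ := ext_exists hη hη8
  obtain ⟨M, hM0, hM⟩ : ∃ M : ℝ, 0 < M ∧ ∀ x ∈ Ω, ‖x‖ ≤ M := hΩ.bd.exists_pos_norm_le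
  set K0 : ℝ := 3 / κ with hK0
  have hK0p : 0 < K0 := by positivity
  set L : ℝ := 2 + K0 * M with hL
  have hLp : 0 < L := by positivity
  refine ⟨√C + (1 + ε) * (2 * L) * √C, 2 * K0, by positivity, by positivity, ?_⟩
  intro N hN P hP hW
  have hNp : 0 < N := by linarith
  set U := N • Ω with hUdef
  have hU : Dom U := hΩ.smul hNp
  set W := perf U P η with hWdef
  have hWU : W ⊆ U := sdiff_subset
  set θ : ℝ := 1 - K0 / N with hθ
  have hq : K0 / N ≤ 1/2 := by rw [div_le_iff₀ hNp]; linarith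
  have hq0 : 0 < K0 / N := by positivity
  have hθ2 : 1/2 ≤ θ := by linarith
  have hθp : 0 < θ := by linarith
  have hUM : ∀ x ∈ U, ‖x‖ ≤ N * M := by
    rintro _ ⟨w, hw, rfl⟩
    simp only
    rw [norm_smul, Real.norm_eq_abs, abs_of_pos hNp]
    exact mul_le_mul_of_nonneg_left (hM w hw) hNp.le
  have hseg : ∀ z ∈ Sq, ∀ x ∈ U, ∀ τ : ℝ, 0 ≤ τ → τ ≤ 1 →
      x + τ • (θ • x + prodE.symm z - x) ∈ U := by
    rintro z hz _ ⟨w, hw, rfl⟩ τ h0 h1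
    have hb : ‖K0⁻¹ • prodE.symm z‖ < κ := by
      rw [norm_smul, norm_inv, Real.norm_eq_abs, abs_of_pos hK0p, hK0, inv_div]
      have := Sq_norm hz
      calc κ / 3 * _ ≤ κ / 3 * 2 := mul_le_mul_of_nonneg_left this (by positivity)
        _ < κ := by linarith
    have hst := hstar _ hb
    have hs := hst hw (show 0 ≤ τ * (K0 / N) by positivity)
      (show 0 ≤ 1 - τ * (K0 / N) by nlinarith) (by ring)
    refine ⟨_, hs, ?_⟩
    simp only [smul_add, smul_smul, smul_sub]
    have e1 : N * (τ * (K0 / N) * K0⁻¹) = τ := by field_simp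
    have e2 : N * (1 - τ * (K0 / N)) = N + τ * θ * N - τ * N := by rw [hθ]; field_simp; ring
    rw [e1, e2]
    module
  have hmap : ∀ x ∈ U, ∀ z ∈ Sq, θ • x + prodE.symm z ∈ U := by
    intro x hx z hz
    have := hseg z hz x hx 1 zero_le_one le_rfl
    rwa [one_smul, add_sub_cancel] at this
  have hLL : ∀ z ∈ Sq, ∀ x ∈ U, ‖θ • x + prodE.symm z - x‖ ≤ L := by
    intro z hz x hx
    have e : θ • x + prodE.symm z - x = prodE.symm z - (K0 / N) • x := by
      rw [hθ, sub_smul, one_smul]; abel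
    rw [e]
    refine (norm_sub_le _ _).trans (add_le_add (Sq_norm hz) ?_)
    rw [norm_smul, Real.norm_eq_abs, abs_of_pos hq0]
    calc K0 / N * ‖x‖ ≤ K0 / N * (N * M) := mul_le_mul_of_nonneg_left (hUM x hx) hq0.le
      _ = K0 * M := by field_simp
  intro u hu
  obtain ⟨v, hv, g1, g2, g3⟩ := hext U P hU hP u hu
  set E := ∫ x in W, ‖fderiv ℝ u x‖^2 with hE
  have hE0 : 0 ≤ E := integral_nonneg fun _ => by positivity
  set w : E2 → ℝ := fun x => avg (fun y => Bw β y * v y) (θ • x) with hw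
  have hw1 : ContDiff ℝ 1 w := (avg_c1 ((hβ.Bw_smooth.mul hv).of_le
    (by exact_mod_cast le_top))).comp (contDiff_const_smul θ)
  have hwc := hw1.continuous
  have huc := hu.continuous
  have hvc := hv.continuous
  have gi := hβ.grad_int hv hU hθp hmap
  have ac := hβ.avg_close hv hU hθp (by linarith) hseg hLL
  have nc := nEig1_c1 hU hw1
  have hnU : nEig1 U = nEig1 Ω / N^2 := by
    rw [eq_div_iff (by positivity), mul_comm]; exact nEig1_smul hΩ hNp
  have hnp : 0 < nEig1 U := by rw [hnU]; positivity
  refine ⟨mean U w, ?_⟩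
  have t3 : ∫ x in W, (w x - mean U w)^2 ≤ ((1 + ε)^2 * (N / √(nEig1 Ω)))^2 * E := by
    have h1 : ∫ x in W, (w x - mean U w)^2 ≤ ∫ x in U, (w x - mean U w)^2 :=
      int_mono_set hU hWU (by fun_prop) (fun _ => by positivity)
    have h2 : ∫ x in U, (w x - mean U w)^2 = (∫ x in U, (w x)^2) - (∫ x in U, w x)^2 / area U := by
      rw [int_sub_const_sq hU hwc, mean]
      have := hU.pos
      field_simp; ring
    rw [← h2] at nc
    have h3 : nEig1 U * ∫ x in U, (w x - mean U w)^2 ≤ (1 + ε)^3 * E :=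
      nc.trans (gi.trans (mul_le_mul_of_nonneg_left g3 (by positivity)))
    refine h1.trans ?_
    rw [mul_pow, div_pow, Real.sq_sqrt hpos.le]
    rw [hnU] at h3
    have h4 : ∫ x in U, (w x - mean U w)^2 ≤ (1 + ε)^3 * (N^2 / nEig1 Ω) * E := by
      rw [div_mul_eq_mul_div, div_le_iff₀ (by positivity)] at h3
      rw [mul_assoc, mul_comm, mul_assoc, div_mul_eq_mul_div, le_div_iff₀ hpos]
      linarith
    refine h4.trans (mul_le_mul_of_nonneg_right (mul_le_mul_of_nonneg_right ?_ (by positivity)) hE0)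
    rw [← pow_mul]
    exact pow_le_pow_right₀ (by linarith) (by norm_num)
  have t2 : ∫ x in W, (v x - w x)^2 ≤ ((1 + ε) * (2 * L) * √C)^2 * E := by
    have h1 : ∫ x in W, (v x - w x)^2 ≤ ∫ x in U, (v x - w x)^2 :=
      int_mono_set hU hWU (by fun_prop) (fun _ => by positivity)
    refine h1.trans (ac.trans ?_)
    rw [mul_pow, Real.sq_sqrt hC.le, mul_assoc _ C]
    refine mul_le_mul ?_ g1 (integral_nonneg fun _ => by positivity) (by positivity)
    rw [mul_pow, mul_pow 2 L, mul_comm (2^2) (L^2)]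
    refine mul_le_mul_of_nonneg_left (mul_le_mul_of_nonneg_left ?_ (by positivity)) (by positivity)
    rw [inv_le_comm₀ (by positivity) (by norm_num)]
    nlinarith
  have t1 : ∫ x in W, (u x - v x)^2 ≤ (√C)^2 * E := by rwa [Real.sq_sqrt hC.le]
  have s1 := hW.mink (f := fun x => u x - v x) (g := fun x => v x - w x) (by fun_prop)
    (by fun_prop) (Real.sqrt_pos.2 hC) (by positivity) t1 t2
  have s2 := hW.mink (f := fun x => (u x - v x) + (v x - w x)) (g := fun x => w x - mean U w)
    (by fun_prop) (by fun_prop) (by positivity) (by positivity) s1 t3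
  refine le_trans (le_of_eq ?_) s2
  refine integral_congr_ae (ae_of_all _ fun x => ?_)
  simp only; ring

end

noncomputable section

lemma area_add_sdiff {Ω Ω' : Set E2} (h : Dom Ω) (h' : Dom Ω') (hs : Ω' ⊆ Ω) :
    area (Ω \ Ω') = area Ω - area Ω' := by
  have := measureReal_sdiff (μ := (volume : Measure E2)) hs h'.meas h.fin.ne
  exact this

lemma abs_int_le {A : Set E2} (hA : MeasurableSet A) (hf : volume A < ⊤) {f : E2 → ℝ} {B : ℝ}
    (hB : ∀ x ∈ A, |f x| ≤ B) : |∫ x in A, f x| ≤ B * area A := by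
  have := norm_setIntegral_le_of_norm_le_const (μ := (volume : Measure E2)) (f := f) (C := B) hf hB
  exact this

lemma neumann_upper {Ω : Set E2} (h : Dom Ω) {δ : ℝ} (hδ : 0 < δ) : ∃ η0 > 0, ∀ Ω' : Set E2,
    Dom Ω' → Ω' ⊆ Ω → area Ω - area Ω' ≤ η0 → nEig1 Ω' ≤ nEig1 Ω + δ := by
  obtain ⟨u, hu, h0, hS, hD⟩ := nEig1_near h (half_pos hδ)
  set S := ∫ x in Ω, (u x)^2 with hSdef
  have hn := nEig1_nonneg Ω
  have huc := hu.continuous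
  obtain ⟨B, hB⟩ := h.bd.isCompact_closure.exists_bound_of_continuousOn huc.continuousOn
  have hB' : ∀ x ∈ Ω, |u x| ≤ B := fun x hx => hB x (subset_closure hx)
  have hB0 : 0 ≤ B := by obtain ⟨x, hx⟩ := h.ne; exact (abs_nonneg _).trans (hB' x hx)
  have ha := h.pos
  set n := nEig1 Ω with hndef
  refine ⟨min (area Ω / 2) (δ * S / (4 * (n + δ) * (B^2 + 1))),
    lt_min (by positivity) (by positivity), ?_⟩
  intro Ω' h' hs hη
  set r := area Ω - area Ω' with hr
  have hr1 : r ≤ area Ω / 2 := hη.trans (min_le_left _ _)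
  have hr2 : r ≤ δ * S / (4 * (n + δ) * (B^2 + 1)) := hη.trans (min_le_right _ _)
  have hdm : MeasurableSet (Ω \ Ω') := h.meas.diff h'.meas
  have hdf : volume (Ω \ Ω') < ⊤ := (measure_mono sdiff_subset).trans_lt h.fin
  have hda := area_add_sdiff h h' hs
  have hr0 : 0 ≤ r := by rw [hr, ← hda]; exact ENNReal.toReal_nonneg
  have i1 : |∫ x in Ω \ Ω', u x| ≤ B * r := by
    have := abs_int_le hdm hdf (f := u) (fun x hx => hB' x hx.1); rwa [hda] at this
  have i2 : |∫ x in Ω \ Ω', (u x)^2| ≤ B^2 * r := by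
    have := abs_int_le hdm hdf (f := fun x => (u x)^2) (B := B^2) (fun x hx => by
      rw [abs_pow]; exact pow_le_pow_left₀ (abs_nonneg _) (hB' x hx.1) 2)
    rwa [hda] at this
  have e1 : ∫ x in Ω \ Ω', u x = (∫ x in Ω, u x) - ∫ x in Ω', u x :=
    setIntegral_sdiff h'.meas (h.intOn huc) hs
  have e2 : ∫ x in Ω \ Ω', (u x)^2 = S - ∫ x in Ω', (u x)^2 :=
    setIntegral_sdiff h'.meas (h.intOn (by fun_prop)) hs
  rw [e1, h0, zero_sub, abs_neg] at i1
  rw [e2] at i2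
  have hv := nEig1_le_var h' hu
  have hDD : ∫ x in Ω', ‖fderiv ℝ u x‖^2 ≤ (n + δ / 2) * S :=
    (int_mono_set h hs hu.cont_grad (fun _ => by positivity)).trans hD
  have ha' : area Ω / 2 ≤ area Ω' := by linarith
  have ha'p := h'.pos
  have q : (∫ x in Ω', u x)^2 / area Ω' ≤ B^2 * r := by
    rw [div_le_iff₀ ha'p]
    have : (∫ x in Ω', u x)^2 ≤ (B * r)^2 := by
      rw [← sq_abs]; exact pow_le_pow_left₀ (abs_nonneg _) i1 2
    have h3 : r ≤ area Ω' := by linarith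
    have h4 : r * r ≤ r * area Ω' := mul_le_mul_of_nonneg_left h3 hr0
    have h5 : B^2 * (r * r) ≤ B^2 * (r * area Ω') := mul_le_mul_of_nonneg_left h4 (by positivity)
    nlinarith
  have i3 := (abs_le.1 i2).2
  have var : S - 2 * (B^2 * r) ≤ (∫ x in Ω', (u x)^2) - (∫ x in Ω', u x)^2 / area Ω' := by linarith
  have hn' := nEig1_nonneg Ω'
  have f1 : nEig1 Ω' * (S - 2 * (B^2 * r)) ≤ (n + δ/2) * S :=
    (mul_le_mul_of_nonneg_left var hn').trans (hv.trans hDD)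
  have f2 : (n + δ) * (2 * (B^2 * r)) ≤ δ / 2 * S := by
    rw [le_div_iff₀ (by positivity)] at hr2
    nlinarith [mul_nonneg (add_pos_of_nonneg_of_pos hn hδ).le hr0]
  have f3 : 0 < S - 2 * (B^2 * r) := by
    by_contra hneg
    push Not at hneg
    have : (n + δ) * S ≤ (n + δ) * (2 * (B^2 * r)) := mul_le_mul_of_nonneg_left (by linarith) (by linarith)
    nlinarith
  by_contra hcon
  push Not at hcon
  have : (n + δ) * (S - 2 * (B^2 * r)) < nEig1 Ω' * (S - 2 * (B^2 * r)) :=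
    mul_lt_mul_of_pos_right hcon f3
  nlinarith

lemma vol_cell (p : ℤ × ℤ) : volume (cell p) = 1 := by
  have : cell p = {x : E2 | x 0 ∈ Ioo ((p.1:ℝ) - 1/2) (p.1 + 1/2) ∧ x 1 ∈ Ioo ((p.2:ℝ) - 1/2) (p.2 + 1/2)} := by
    ext x
    rw [mem_cell, abs_lt, abs_lt]
    simp only [mem_ofPred_eq, mem_Ioo]
    constructor
    · rintro ⟨⟨_, _⟩, _, _⟩; refine ⟨⟨?_, ?_⟩, ?_, ?_⟩ <;> linarith
    · rintro ⟨⟨_, _⟩, _, _⟩; refine ⟨⟨?_, ?_⟩, ?_, ?_⟩ <;> linarith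
  rw [this, vol_box]
  norm_num

lemma vol_hole_le (p : ℤ × ℤ) {η : ℝ} (hη : 0 < η) : volume (hole p η) ≤ ENNReal.ofReal (16 * η^2) := by
  have : hole p η ⊆ {x : E2 | x 0 ∈ Ioo ((p.1:ℝ) - 2*η) (p.1 + 2*η) ∧ x 1 ∈ Ioo ((p.2:ℝ) - 2*η) (p.2 + 2*η)} := by
    intro x
    rw [mem_hole, abs_le, abs_le]
    simp only [mem_ofPred_eq, mem_Ioo]
    rintro ⟨⟨_, _⟩, _, _⟩; refine ⟨⟨?_, ?_⟩, ?_, ?_⟩ <;> linarith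
  refine (measure_mono this).trans ?_
  rw [vol_box, ← ENNReal.ofReal_mul (by linarith)]
  exact ENNReal.ofReal_le_ofReal (by nlinarith)

lemma card_le {U : Set E2} (hU : Dom U) {P : Finset (ℤ × ℤ)} (hP : ∀ p ∈ P, cell p ⊆ U) :
    (P.card : ENNReal) ≤ volume U := by
  calc (P.card : ENNReal) = ∑ p ∈ P, volume (cell p) := by simp [vol_cell]
    _ = volume (⋃ p ∈ P, cell p) := by
      rw [measure_biUnion_finset]
      · intro p _ q _ hpq
        exact disjoint_left.2 fun x h1 h2 => hpq (cell_eq h1 h2)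
      · exact fun p _ => (cell_open p).measurableSet
    _ ≤ _ := measure_mono (iUnion₂_subset hP)

lemma perf_area {U : Set E2} (hU : Dom U) {P : Finset (ℤ × ℤ)} (hP : ∀ p ∈ P, cell p ⊆ U) {η : ℝ}
    (hη : 0 < η) : area U - area (perf U P η) ≤ 16 * η^2 * area U := by
  have h1 : volume U ≤ volume (perf U P η) + ENNReal.ofReal (16 * η^2) * volume U := by
    calc volume U ≤ volume (perf U P η ∪ ⋃ p ∈ P, hole p η) := measure_mono fun x hx => by
            by_cases h : x ∈ ⋃ p ∈ P, hole p η
            · exact Or.inr h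
            · exact Or.inl ⟨hx, h⟩
      _ ≤ volume (perf U P η) + volume (⋃ p ∈ P, hole p η) := measure_union_le _ _
      _ ≤ volume (perf U P η) + ∑ p ∈ P, volume (hole p η) :=
            add_le_add le_rfl (measure_biUnion_finset_le _ _)
      _ ≤ volume (perf U P η) + ∑ p ∈ P, ENNReal.ofReal (16 * η^2) :=
            add_le_add le_rfl (Finset.sum_le_sum fun p _ => vol_hole_le p hη)
      _ ≤ _ := by
            rw [Finset.sum_const, nsmul_eq_mul, mul_comm]
            exact add_le_add le_rfl (mul_le_mul' le_rfl (card_le hU hP))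
  have hf : volume (perf U P η) ≠ ⊤ := ((measure_mono sdiff_subset).trans_lt hU.fin).ne
  have h2 := ENNReal.toReal_mono (ENNReal.add_ne_top.2 ⟨hf, ENNReal.mul_ne_top ENNReal.ofReal_ne_top hU.fin.ne⟩) h1
  rw [ENNReal.toReal_add hf (ENNReal.mul_ne_top ENNReal.ofReal_ne_top hU.fin.ne), ENNReal.toReal_mul,
    ENNReal.toReal_ofReal (by positivity)] at h2
  unfold area
  linarith

end

noncomputable section

/-- Functions vanishing on balls close to every point of `A` satisfy a Poincaré inequality. -/
lemma cap_est {W A : Set E2} (hA : MeasurableSet A) {ℓ η : ℝ} (hℓ : 0 ≤ ℓ) (hη : 0 < η)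
    (H : ∀ y ∈ A, y ∈ W → ∃ z, ‖z - y‖ ≤ ℓ ∧ Disjoint (Metric.ball z η) W)
    {u : E2 → ℝ} (hu : SmoothF u) (hc : HasCompactSupport u) (hs : tsupport u ⊆ W) :
    ∫ x in A, (u x)^2 ≤ ((ℓ + η)^4 / η^2) * ∫ x, ‖fderiv ℝ u x‖^2 := by
  set R := ℓ + η with hR
  have hR0 : 0 < R := by positivity
  have huc := hu.continuous
  have hz : ∀ x, x ∉ W → u x = 0 := fun x hx => image_eq_zero_of_notMem_tsupport fun h => hx (hs h)
  have vb : ∀ (c : E2) {r : ℝ}, 0 ≤ r → volume (Metric.ball c r) = ENNReal.ofReal (π * r^2) := by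
    intro c r hr
    rw [← area_ball c hr, area, ENNReal.ofReal_toReal Metric.isBounded_ball.measure_lt_top.ne]
  have p1 : ∀ y ∈ A, ENNReal.ofReal (π * η^2) * ENNReal.ofReal ((u y)^2) ≤
      ∫⁻ h in Metric.ball (0:E2) R, ENNReal.ofReal ((u (y + h) - u y)^2) := by
    intro y hy
    by_cases hyW : y ∈ W
    · obtain ⟨z, hz1, hz2⟩ := H y hy hyW
      have hsub : Metric.ball (z - y) η ⊆ Metric.ball (0:E2) R := by
        apply Metric.ball_subset_ball'
        rw [dist_zero_right]; linarith
      calc ENNReal.ofReal (π * η^2) * ENNReal.ofReal ((u y)^2)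
          = ∫⁻ h in Metric.ball (z - y) η, ENNReal.ofReal ((u y)^2) := by
            rw [setLIntegral_const, vb _ hη.le, mul_comm]
        _ = ∫⁻ h in Metric.ball (z - y) η, ENNReal.ofReal ((u (y + h) - u y)^2) := by
            refine setLIntegral_congr_fun Metric.isOpen_ball.measurableSet fun h hh => ?_
            have : y + h ∉ W := by
              refine disjoint_left.1 hz2 ?_
              rw [mem_ball_iff_norm] at hh ⊢
              rwa [show y + h - z = h - (z - y) by abel]
            rw [hz _ this]; congr 1; ring
        _ ≤ _ := lintegral_mono_set hsub
    · rw [hz y hyW]; simp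
  have p2 : ENNReal.ofReal (π * η^2) * ∫⁻ y in A, ENNReal.ofReal ((u y)^2) ≤
      ENNReal.ofReal (π * R^4) * ∫⁻ x, ENNReal.ofReal (‖fderiv ℝ u x‖^2) := by
    calc ENNReal.ofReal (π * η^2) * ∫⁻ y in A, ENNReal.ofReal ((u y)^2)
        = ∫⁻ y in A, ENNReal.ofReal (π * η^2) * ENNReal.ofReal ((u y)^2) :=
          (lintegral_const_mul' _ _ ENNReal.ofReal_ne_top).symm
      _ ≤ ∫⁻ y in A, ∫⁻ h in Metric.ball (0:E2) R, ENNReal.ofReal ((u (y + h) - u y)^2) :=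
          setLIntegral_mono' hA p1
      _ ≤ ∫⁻ y, ∫⁻ h in Metric.ball (0:E2) R, ENNReal.ofReal ((u (y + h) - u y)^2) :=
          setLIntegral_le_lintegral _ _
      _ = ∫⁻ h in Metric.ball (0:E2) R, ∫⁻ y, ENNReal.ofReal ((u (y + h) - u y)^2) := by
          rw [lintegral_lintegral_swap]
          have : Measurable (fun q : E2 × E2 => ENNReal.ofReal ((u (q.1 + q.2) - u q.1)^2)) :=
            (by fun_prop : Continuous fun q : E2 × E2 => (u (q.1 + q.2) - u q.1)^2).measurable.ennreal_ofReal
          exact this.aemeasurable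
      _ ≤ ∫⁻ h in Metric.ball (0:E2) R, ENNReal.ofReal (R^2) * ∫⁻ x, ENNReal.ofReal (‖fderiv ℝ u x‖^2) := by
          refine setLIntegral_mono' Metric.isOpen_ball.measurableSet fun h hh => ?_
          refine (trans_est hu h).trans (mul_le_mul' (ENNReal.ofReal_le_ofReal ?_) le_rfl)
          rw [mem_ball_zero_iff] at hh
          exact pow_le_pow_left₀ (norm_nonneg _) hh.le 2
      _ = _ := by
          rw [setLIntegral_const, vb _ hR0.le, mul_comm, ← mul_assoc, ← ENNReal.ofReal_mul (by positivity)]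
          congr 2; ring
  have p3 := of_lint2 (A := A) (B := univ) (f := fun x => π * η^2 * (u x)^2)
    (g := fun x => ‖fderiv ℝ u x‖^2) (C := π * R^4)
    (((cs_sq_int hu hc).const_mul _).integrableOn) (by simpa using cs_grad_int hu hc)
    (fun x => by positivity) (fun x => by positivity) (by positivity) (by
      simp only [Measure.restrict_univ]
      refine le_trans (le_of_eq ?_) p2
      rw [← lintegral_const_mul' _ _ ENNReal.ofReal_ne_top]
      refine lintegral_congr fun x => ?_
      rw [← ENNReal.ofReal_mul (by positivity)])
  rw [integral_const_mul, Measure.restrict_univ] at p3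
  rw [div_mul_eq_mul_div, le_div_iff₀ (by positivity)]
  have hpi := pi_pos
  have : π * ((∫ x in A, (u x)^2) * η^2) ≤ π * (R^4 * ∫ x, ‖fderiv ℝ u x‖^2) := by linarith
  exact le_of_mul_le_mul_left this hpi

lemma dEig1_pos {Ω : Set E2} (h : Dom Ω) : 0 < dEig1 Ω := by
  obtain ⟨M, hM0, hM⟩ := h.bd.exists_pos_norm_le
  set z : E2 := EuclideanSpace.single 0 (M + 1) with hz
  have hzn : ‖z‖ = M + 1 := by rw [hz, PiLp.norm_single, Real.norm_of_nonneg (by linarith)]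
  have hc : 0 < ((2 * M + 1 + 1)^4 / 1^2 : ℝ) := by positivity
  refine lt_of_lt_of_le (inv_pos.2 hc) (dEig1_ge h fun u hu hcs hs => ?_)
  have := cap_est (W := Ω) (A := univ) MeasurableSet.univ (ℓ := 2 * M + 1) (η := 1) (by linarith)
    one_pos (fun y _ hy => ⟨z, ?_, ?_⟩) hu hcs hs
  · rw [Measure.restrict_univ] at this
    rwa [inv_mul_le_iff₀ hc]
  · have := norm_sub_le z y
    linarith [hM y hy]
  · refine disjoint_left.2 fun w hw hw2 => ?_
    rw [mem_ball_iff_norm'] at hw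
    have := norm_sub_norm_le z w
    linarith [hM w hw2]

open Manifold in
lemma exists_cut {K V : Set E2} (hK : IsClosed K) (hV : Dom V) (hKV : K ⊆ V) :
    ∃ (f : E2 → ℝ) (G : ℝ), SmoothF f ∧ 0 ≤ G ∧ HasCompactSupport f ∧ tsupport f ⊆ V ∧
      (∀ x, 0 ≤ f x ∧ f x ≤ 1) ∧ (∀ x ∈ K, f x = 1 ∧ fderiv ℝ f x = 0) ∧ ∀ x, ‖fderiv ℝ f x‖ ≤ G := by
  obtain ⟨f, f0, f1, f01⟩ := exists_contMDiffMap_zero_one_nhds_of_isClosed (n := (⊤ : ℕ∞)) 𝓘(ℝ, E2)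
    hV.op.isClosed_compl hK (disjoint_left.2 fun x h1 h2 => h1 (hKV h2))
  have hf : SmoothF f := f.contMDiff.contDiff
  have hts : tsupport f ⊆ V := by
    intro x hx
    by_contra hxV
    have : ∀ᶠ y in nhds x, f y = 0 := by
      rw [eventually_nhdsSet_iff_forall] at f0
      exact f0 x hxV
    exact (notMem_tsupport_iff_eventuallyEq.2 this) hx
  have hcs : HasCompactSupport f :=
    HasCompactSupport.of_support_subset_isCompact hV.bd.isCompact_closure
      ((subset_tsupport _).trans (hts.trans subset_closure))
  obtain ⟨G, hG⟩ := (hcs.fderiv ℝ).exists_bound_of_continuous hf.cont_fd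
  refine ⟨f, G, hf, (norm_nonneg _).trans (hG 0), hcs, hts, f01, fun x hx => ?_, hG⟩
  rw [eventually_nhdsSet_iff_forall] at f1
  have := f1 x hx
  refine ⟨this.self_of_nhds, ?_⟩
  have e : (f : E2 → ℝ) =ᶠ[nhds x] fun _ => (1:ℝ) := this
  rw [e.fderiv_eq]; simp

lemma cutoff_lower {K V : Set E2} (hK : IsClosed K) (hV : Dom V) (hKV : K ⊆ V) {δ : ℝ} (hδ : 0 < δ) :
    ∃ c0 > 0, ∀ W c, Dom W → 0 ≤ c → c ≤ c0 →
      (∀ u, SmoothF u → HasCompactSupport u → tsupport u ⊆ W →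
        ∫ x in Kᶜ, (u x)^2 ≤ c * ∫ x, ‖fderiv ℝ u x‖^2) → dEig1 V - δ ≤ dEig1 W := by
  obtain ⟨f, G, hf, hG0, hfc, hfs, f01, fK, hG⟩ := exists_cut hK hV hKV
  have hl := dEig1_pos hV
  set l := dEig1 V with hldef
  set q := δ / l with hq
  have hq0 : 0 < q := by positivity
  set X := (1 + 1/q) * G^2 + l with hX
  have hX0 : 0 < X := by positivity
  refine ⟨q^2 / X, by positivity, fun W c hW hc0 hc H => dEig1_ge hW fun u hu hcs hs => ?_⟩
  have hu2 := cs_sq_int hu hcs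
  have hug := cs_grad_int hu hcs
  set E := ∫ x, ‖fderiv ℝ u x‖^2 with hE
  set S := ∫ x, (u x)^2 with hS
  have hE0 : 0 ≤ E := integral_nonneg fun x => by positivity
  have hS0 : 0 ≤ S := integral_nonneg fun x => by positivity
  by_cases hneg : l - δ ≤ 0
  · nlinarith
  push Not at hneg
  have h1 := H u hu hcs hs
  have hw : SmoothF fun x => f x * u x := hf.mul hu
  have hwc : HasCompactSupport fun x => f x * u x := hfc.mul_right
  have hws : tsupport (fun x => f x * u x) ⊆ V := (tsupport_mul_subset_left).trans hfs
  have h2 := dEig1_le hw hwc hws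
  have hw2 := cs_sq_int hw hwc
  have hKm : MeasurableSet Kᶜ := hK.measurableSet.compl
  -- gradient bound
  have g1 : ∀ x, ‖fderiv ℝ (fun x => f x * u x) x‖^2 ≤
      (1 + q) * ‖fderiv ℝ u x‖^2 + (1 + 1/q) * G^2 * Kᶜ.indicator (fun x => (u x)^2) x := by
    intro x
    have hd : HasFDerivAt (fun x => f x * u x) (f x • fderiv ℝ u x + u x • fderiv ℝ f x) x :=
      ((hf.differentiable (by simp)) x).hasFDerivAt.mul ((hu.differentiable (by simp)) x).hasFDerivAt
    rw [hd.fderiv]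
    obtain ⟨fx0, fx1⟩ := f01 x
    have b1 : ‖f x • fderiv ℝ u x‖ ≤ ‖fderiv ℝ u x‖ := by
      rw [norm_smul, Real.norm_of_nonneg fx0]
      exact mul_le_of_le_one_left (norm_nonneg _) fx1
    by_cases hx : x ∈ K
    · rw [(fK x hx).2, smul_zero, add_zero, indicator_of_notMem (by simpa using hx)]
      have := pow_le_pow_left₀ (norm_nonneg _) b1 2
      nlinarith [sq_nonneg ‖fderiv ℝ u x‖]
    · rw [indicator_of_mem (by simpa using hx)]
      have b2 : ‖u x • fderiv ℝ f x‖ ≤ |u x| * G := by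
        rw [norm_smul, Real.norm_eq_abs]
        exact mul_le_mul_of_nonneg_left (hG x) (abs_nonneg _)
      set a := ‖fderiv ℝ u x‖
      set b := |u x| * G
      have b3 : ‖f x • fderiv ℝ u x + u x • fderiv ℝ f x‖ ≤ a + b := (norm_add_le _ _).trans (add_le_add b1 b2)
      have b4 := pow_le_pow_left₀ (norm_nonneg _) b3 2
      have b5 : (1 + 1/q) * G^2 * (u x)^2 = (1 + 1/q) * b^2 := by
        rw [mul_pow, sq_abs]; ring
      have b6 : (1 + q) * a^2 + (1 + 1/q) * b^2 - (a + b)^2 = (q * a - b)^2 / q := by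
        field_simp; ring
      have b7 : 0 ≤ (q * a - b)^2 / q := by positivity
      rw [b5]; linarith
  have i1 : Integrable (Kᶜ.indicator fun x => (u x)^2) := hu2.indicator hKm
  have g2 : ∫ x, ‖fderiv ℝ (fun x => f x * u x) x‖^2 ≤ (1 + q) * E + (1 + 1/q) * G^2 * ∫ x in Kᶜ, (u x)^2 := by
    calc _ ≤ ∫ x, ((1 + q) * ‖fderiv ℝ u x‖^2 + (1 + 1/q) * G^2 * Kᶜ.indicator (fun x => (u x)^2) x) :=
          integral_mono (cs_grad_int hw hwc) ((hug.const_mul _).add (i1.const_mul _)) g1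
      _ = _ := by
          rw [integral_add (hug.const_mul _) (i1.const_mul _), integral_const_mul, integral_const_mul,
            integral_indicator hKm]
  have g3 : S ≤ (∫ x, (f x * u x)^2) + ∫ x in Kᶜ, (u x)^2 := by
    rw [← integral_indicator hKm, ← integral_add hw2 i1]
    refine integral_mono hu2 (hw2.add i1) fun x => ?_
    simp only
    by_cases hx : x ∈ K
    · rw [(fK x hx).1, indicator_of_notMem (by simpa using hx)]; simp
    · rw [indicator_of_mem (by simpa using hx)]; nlinarith [sq_nonneg (f x * u x)]
  set T := ∫ x in Kᶜ, (u x)^2 with hT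
  set Y := ∫ x, (f x * u x)^2 with hY
  have k1 : l * S ≤ (1 + q) * E + X * T := by
    have : l * S ≤ l * (Y + T) := mul_le_mul_of_nonneg_left g3 hl.le
    have e : X * T = (1 + 1/q) * G^2 * T + l * T := by rw [hX]; ring
    linarith
  have k2 : X * T ≤ q^2 * E := by
    have : X * c ≤ q^2 := by
      rw [le_div_iff₀ hX0] at hc; linarith
    have e1 : X * T ≤ X * (c * E) := mul_le_mul_of_nonneg_left h1 hX0.le
    have e2 : X * c * E ≤ q^2 * E := mul_le_mul_of_nonneg_right this hE0
    linarith
  have k3 : l * S ≤ (1 + q + q^2) * E := by linarith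
  have hql : q * l = δ := by rw [hq]; field_simp
  have hq1 : 0 < 1 - q := by
    have : 0 < l * (1 - q) := by linarith
    exact (mul_pos_iff_of_pos_left hl).1 this
  have k4 := mul_le_mul_of_nonneg_left k3 hq1.le
  have k5 : (1 - q) * ((1 + q + q^2) * E) = E - q^3 * E := by ring
  have k6 : (1 - q) * (l * S) = (l - δ) * S := by rw [← hql]; ring
  have : 0 ≤ q^3 * E := by positivity
  linarith

end

noncomputable section

open Pointwise

lemma star_comb {Ω : Set E2} {b w : E2} (h : StarConvex ℝ b Ω) (hw : w ∈ Ω) {a c : ℝ} (ha : 0 ≤ a)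
    (hc : 0 ≤ c) (hac : 0 < a + c) : (a + c)⁻¹ • (a • b + c • w) ∈ Ω := by
  have := h hw (show 0 ≤ a / (a + c) by positivity) (show 0 ≤ c / (a + c) by positivity)
    (by field_simp)
  convert this using 1
  rw [smul_add, smul_smul, smul_smul, div_eq_inv_mul, div_eq_inv_mul]

lemma star_thick {Ω : Set E2} {κ : ℝ} (hstar : ∀ b, ‖b‖ < κ → StarConvex ℝ b Ω) {s τ : ℝ} (hs : 0 ≤ s)
    (hτ : 0 < τ) {x d : E2} (hx : x ∈ s • Ω) (hd : ‖d‖ < τ * κ) : x + d ∈ (s + τ) • Ω := by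
  obtain ⟨w, hw, rfl⟩ := hx
  have hb : ‖τ⁻¹ • d‖ < κ := by
    rw [norm_smul, Real.norm_of_nonneg (by positivity), inv_mul_lt_iff₀ hτ]; exact hd
  refine ⟨_, star_comb (hstar _ hb) hw hτ.le hs (by positivity), ?_⟩
  simp only
  rw [smul_inv_smul₀ hτ.ne', add_comm s τ, smul_inv_smul₀ (by positivity), add_comm]

lemma star_smul {Ω : Set E2} {κ c : ℝ} (hc : 0 < c) (hstar : ∀ b, ‖b‖ < κ → StarConvex ℝ b Ω) :
    ∀ b, ‖b‖ < c * κ → StarConvex ℝ b (c • Ω) := by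
  intro b hb w hw a d ha hd had
  obtain ⟨w, hw, rfl⟩ := hw
  have hb' : ‖c⁻¹ • b‖ < κ := by
    rw [norm_smul, Real.norm_of_nonneg (by positivity), inv_mul_lt_iff₀ hc]; exact hb
  refine ⟨_, hstar _ hb' hw ha hd had, ?_⟩
  simp only
  rw [smul_add, smul_comm c a, smul_inv_smul₀ hc.ne', smul_comm c d]

lemma near_lat (y : E2) : ∃ p : ℤ × ℤ, ‖y - lat p‖ ≤ 1 := by
  refine ⟨(round (y 0), round (y 1)), (norm_le_coords _).trans ?_⟩
  have h0 := abs_sub_round (y 0)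
  have h1 := abs_sub_round (y 1)
  simp only [PiLp.sub_apply, lat0, lat1]
  linarith

lemma claimZ {U V : Set E2} {κ M η : ℝ} (hκ : 0 < κ) (hη : 0 < η)
    (hstar : ∀ b, ‖b‖ < κ → StarConvex ℝ b U) (hM : ∀ x ∈ U, ‖x‖ ≤ M) {P : Finset (ℤ × ℤ)}
    (hP : ∀ p, p ∈ P ↔ Metric.ball (lat p) 2 ⊆ U ∧ Disjoint (Metric.ball (lat p) 2) V) {y : E2}
    (hy : y ∈ U) (hyV : ∀ d, ‖d‖ < 3 → y + d ∉ V) :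
    ∃ z, ‖z - y‖ ≤ 3 + η * (M + 3) / κ ∧ Disjoint (Metric.ball z η) (perf U P η) := by
  obtain ⟨p, hp⟩ := near_lat y
  have hM0 : 0 ≤ M := (norm_nonneg _).trans (hM y hy)
  have hpos : 0 ≤ η * (M + 3) / κ := by positivity
  have near : ∀ q ∈ Metric.ball (lat p) 2, ‖q - y‖ < 3 := by
    intro q hq
    rw [mem_ball_iff_norm] at hq
    have : ‖q - y‖ ≤ ‖q - lat p‖ + ‖y - lat p‖ := by
      rw [show q - y = (q - lat p) - (y - lat p) by abel]; exact norm_sub_le _ _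
    linarith
  by_cases h1 : Metric.ball (lat p) 2 ⊆ U
  · by_cases h2 : Disjoint (Metric.ball (lat p) 2) V
    · refine ⟨lat p, by rw [norm_sub_rev]; linarith, disjoint_left.2 fun w hw hw2 => hw2.2 ?_⟩
      simp only [mem_iUnion]
      refine ⟨p, (hP p).2 ⟨h1, h2⟩, ?_⟩
      rw [mem_ball_iff_norm] at hw
      exact ⟨(coord_le_norm _ _).trans hw.le, (coord_le_norm _ _).trans hw.le⟩
    · exfalso
      rw [not_disjoint_iff] at h2
      obtain ⟨v, hv1, hv2⟩ := h2
      exact hyV (v - y) (near v hv1) (by rwa [add_sub_cancel])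
  · rw [not_subset] at h1
    obtain ⟨q, hq, hqU⟩ := h1
    have hqy := near q hq
    have hqn : ‖q‖ ≤ M + 3 := by
      have := norm_add_le (q - y) y
      rw [sub_add_cancel] at this
      linarith [hM y hy]
    set t := η / κ with ht
    have ht0 : 0 < t := by positivity
    refine ⟨q + t • q, ?_, disjoint_left.2 fun w hw hw2 => hqU ?_⟩
    · have : ‖q + t • q - y‖ ≤ ‖q - y‖ + ‖t • q‖ := by
        rw [show q + t • q - y = (q - y) + t • q by abel]; exact norm_add_le _ _
      rw [norm_smul, Real.norm_of_nonneg ht0.le] at this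
      have h3 : t * ‖q‖ ≤ t * (M + 3) := mul_le_mul_of_nonneg_left hqn ht0.le
      have h4 : t * (M + 3) = η * (M + 3) / κ := by rw [ht]; ring
      linarith
    · rw [mem_ball_iff_norm'] at hw
      have hb : ‖t⁻¹ • (q + t • q - w)‖ < κ := by
        rw [norm_smul, Real.norm_of_nonneg (by positivity), inv_mul_lt_iff₀ ht0, ht]
        rwa [div_mul_cancel₀ _ hκ.ne']
      have := star_comb (hstar _ hb) hw2.1 ht0.le zero_le_one (by positivity)
      convert this using 1
      rw [smul_inv_smul₀ ht0.ne', eq_inv_smul_iff₀ (by positivity)]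
      module

lemma dir_lower {Ω : Set E2} (hΩ : Dom Ω) {κ : ℝ} (hκ : 0 < κ)
    (hstar : ∀ b, ‖b‖ < κ → StarConvex ℝ b Ω) {s η δ : ℝ} (hs : 0 < s) (hη : 0 < η) (hδ : 0 < δ) :
    ∃ N0 : ℝ, 0 < N0 ∧ ∀ N ≥ N0, ∀ P : Finset (ℤ × ℤ),
      (∀ p, p ∈ P ↔ Metric.ball (lat p) 2 ⊆ N • Ω ∧ Disjoint (Metric.ball (lat p) 2) ((N * s) • Ω)) →
      Dom (perf (N • Ω) P η) → dEig1 Ω / s^2 - δ ≤ N^2 * dEig1 (perf (N • Ω) P η) := by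
  obtain ⟨M, hM0, hM⟩ := hΩ.bd.exists_pos_norm_le
  have hct : Tendsto (fun τ : ℝ => dEig1 Ω / (s + τ + τ)^2) (nhdsWithin 0 (Ioi 0)) (nhds (dEig1 Ω / s^2)) := by
    have : ContinuousAt (fun τ : ℝ => dEig1 Ω / (s + τ + τ)^2) 0 := by
      apply ContinuousAt.div continuousAt_const (by fun_prop)
      simp [hs.ne']
    have h2 := this.tendsto
    simp only [add_zero] at h2
    exact h2.mono_left nhdsWithin_le_nhds
  obtain ⟨τ, hτ1, hτ⟩ := ((hct.eventually (lt_mem_nhds (show dEig1 Ω / s^2 - δ/2 < _ by linarith))).and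
    self_mem_nhdsWithin).exists
  have hτ0 : 0 < τ := hτ
  have hV : Dom ((s + τ + τ) • Ω) := hΩ.smul (by positivity)
  have hKV : closure ((s + τ) • Ω) ⊆ (s + τ + τ) • Ω := by
    intro x hx
    obtain ⟨y, hy, hd⟩ := Metric.mem_closure_iff.1 hx (τ * κ) (by positivity)
    have := star_thick hstar (by positivity) hτ0 hy (d := x - y) (by rwa [← dist_eq_norm])
    rwa [add_sub_cancel] at this
  obtain ⟨c0, hc0, H⟩ := cutoff_lower isClosed_closure hV hKV (half_pos hδ)
  set ℓ := 3 + η * (M + 3) / κ with hℓ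
  have hℓ0 : 0 < ℓ := by positivity
  set C := (ℓ + η)^4 / η^2 with hC
  have hC0 : 0 < C := by positivity
  refine ⟨max 1 (max (4 / (τ * κ)) (C / c0)), lt_of_lt_of_le one_pos (le_max_left _ _), ?_⟩
  intro N hN P hP hW
  have hN1 : 1 ≤ N := (le_max_left _ _).trans hN
  have hN2 : 4 / (τ * κ) ≤ N := ((le_max_left _ _).trans (le_max_right _ _)).trans hN
  have hN3 : C / c0 ≤ N := ((le_max_right _ _).trans (le_max_right _ _)).trans hN
  have hN0 : 0 < N := by linarith
  rw [div_le_iff₀ (by positivity)] at hN2 hN3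
  set W := perf (N • Ω) P η with hWdef
  have hW' := hW.smul (inv_pos.2 hN0)
  have e1 := dEig1_smul hW (inv_pos.2 hN0)
  have e2 := dEig1_smul hΩ (c := s + τ + τ) (by positivity)
  have e1' : dEig1 (N⁻¹ • W) = N^2 * dEig1 W := by
    rw [← e1]; field_simp
  have e2' : dEig1 ((s + τ + τ) • Ω) = dEig1 Ω / (s + τ + τ)^2 := by
    rw [← e2]; field_simp
  have key := H (N⁻¹ • W) (C / N^2) hW' (by positivity) (by
      rw [div_le_iff₀ (by positivity)]
      nlinarith [mul_pos hN0 hc0]) (by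
    intro u hu hcs hts
    have := cap_est (W := N⁻¹ • W) (A := (closure ((s + τ) • Ω))ᶜ) isClosed_closure.measurableSet.compl
      (ℓ := ℓ / N) (η := η / N) (by positivity) (by positivity) ?_ hu hcs hts
    · convert this using 2
      rw [hC]; field_simp
    · intro y hyK hyW
      obtain ⟨w, hw, rfl⟩ := hyW
      have hwU : w ∈ N • Ω := hw.1
      obtain ⟨z, hz1, hz2⟩ := claimZ (κ := N * κ) (M := N * M) (by positivity) hη (star_smul hN0 hstar)
        (by
          rintro x ⟨x, hx, rfl⟩
          simp only [norm_smul, Real.norm_of_nonneg hN0.le]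
          exact mul_le_mul_of_nonneg_left (hM x hx) hN0.le) hP hwU (by
          intro d hd hmem
          apply hyK
          apply subset_closure
          rw [mul_smul, mem_smul_set_iff_inv_smul_mem₀ hN0.ne', smul_add] at hmem
          have := star_thick hstar hs.le hτ0 hmem (d := -(N⁻¹ • d)) (by
            rw [norm_neg, norm_smul, Real.norm_of_nonneg (by positivity), inv_mul_lt_iff₀ hN0]
            linarith)
          simpa using this)
      refine ⟨N⁻¹ • z, ?_, ?_⟩
      · simp only
        rw [← smul_sub, norm_smul, Real.norm_of_nonneg (by positivity), ← div_eq_inv_mul]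
        refine div_le_div_of_nonneg_right (hz1.trans ?_) hN0.le
        rw [hℓ]
        have : η * (N * M + 3) / (N * κ) ≤ η * (M + 3) / κ := by
          rw [div_le_div_iff₀ (by positivity) (by positivity)]
          have : 3 ≤ N * 3 := by linarith
          nlinarith [mul_pos hη hκ]
        linarith
      · refine disjoint_left.2 fun x hx hx2 => ?_
        obtain ⟨x, hxW, rfl⟩ := hx2
        refine disjoint_left.1 hz2 ?_ hxW
        simp only at hx
        rw [mem_ball_iff_norm, ← smul_sub, norm_smul, Real.norm_of_nonneg (by positivity),
          inv_mul_lt_iff₀ hN0, mul_div_cancel₀ _ hN0.ne'] at hx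
        rwa [mem_ball_iff_norm])
  rw [e1', e2'] at key
  linarith

lemma goodP_finite {U : Set E2} (hU : Bornology.IsBounded U) (V : Set E2) :
    {p : ℤ × ℤ | Metric.ball (lat p) 2 ⊆ U ∧ Disjoint (Metric.ball (lat p) 2) V}.Finite := by
  obtain ⟨M, hM0, hM⟩ := hU.exists_pos_norm_le
  refine Set.Finite.subset ((Set.finite_Icc (-⌈M⌉) ⌈M⌉).prod (Set.finite_Icc (-⌈M⌉) ⌈M⌉)) ?_
  rintro p ⟨hp, -⟩
  have h := hM _ (hp (Metric.mem_ball_self two_pos))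
  have h0 := (coord_le_norm (lat p) 0).trans h
  have h1 := (coord_le_norm (lat p) 1).trans h
  rw [lat0] at h0
  rw [lat1] at h1
  have hc := Int.le_ceil M
  rw [abs_le] at h0 h1
  simp only [Set.mem_prod, mem_Icc]
  refine ⟨⟨?_, ?_⟩, ?_, ?_⟩ <;> · rw [← Int.cast_le (R := ℝ)]; push_cast; linarith

lemma hole_sub_ball {p : ℤ × ℤ} {η : ℝ} (hη : η < 1) : hole p η ⊆ Metric.ball (lat p) 2 := by
  rintro x ⟨h0, h1⟩
  rw [mem_ball_iff_norm]
  linarith [norm_le_coords (x - lat p)]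

lemma cell_sub_ball (p : ℤ × ℤ) : cell p ⊆ Metric.ball (lat p) 2 := by
  rintro x ⟨h0, h1⟩
  rw [mem_ball_iff_norm]
  linarith [norm_le_coords (x - lat p)]

end

noncomputable section

lemma star_closure {U : Set E2} {κ : ℝ} (hstar : ∀ b, ‖b‖ < κ → StarConvex ℝ b U) {y b : E2}
    (hy : y ∈ closure U) (hb : ‖b‖ < κ) {t : ℝ} (ht : 0 < t) (ht1 : t ≤ 1) :
    (1 - t) • y + t • b ∈ U := by
  obtain ⟨y', hy', hd⟩ := Metric.mem_closure_iff.1 hy (t * (κ - ‖b‖)) (mul_pos ht (by linarith))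
  rw [dist_eq_norm] at hd
  have hb' : ‖b + (t⁻¹ * (1 - t)) • (y - y')‖ < κ := by
    have h1 : ‖(t⁻¹ * (1 - t)) • (y - y')‖ ≤ t⁻¹ * ‖y - y'‖ := by
      rw [norm_smul, Real.norm_of_nonneg (mul_nonneg (by positivity) (by linarith))]
      refine mul_le_mul_of_nonneg_right ?_ (norm_nonneg _)
      have : 0 < t⁻¹ := by positivity
      nlinarith
    have h2 : t⁻¹ * ‖y - y'‖ < κ - ‖b‖ := by rwa [inv_mul_lt_iff₀ ht]
    linarith [norm_add_le b ((t⁻¹ * (1 - t)) • (y - y'))]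
  have := hstar _ hb' hy' ht.le (show 0 ≤ 1 - t by linarith) (by ring)
  convert this using 1
  rw [smul_add, smul_smul, ← mul_assoc, mul_inv_cancel₀ ht.ne']
  module

lemma cone_dir {y ξ z : E2} {ε : ℝ} (hξ : ‖ξ‖ = 1) (hε : 0 < ε) (hz : z ∈ coneSet y ξ ε) :
    ‖(z - y) - ‖z - y‖ • ξ‖ ≤ ε * ‖z - y‖ := by
  obtain ⟨h1, h2, -⟩ := hz
  set v := z - y
  refine le_of_sq_le_sq ?_ (by positivity)
  rw [norm_sub_sq_real, norm_smul, hξ, inner_smul_right, norm_norm]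
  have hc := Real.one_sub_sq_div_two_le_cos (x := ε)
  have h3 : (1 - ε^2/2) * ‖v‖ ≤ ⟪v, ξ⟫ := (mul_le_mul_of_nonneg_right hc h2.le).trans h1
  have h4 := mul_le_mul_of_nonneg_left h3 h2.le
  nlinarith

lemma exists_sgn (a : ℝ) : ∃ s : ℝ, (s = 1 ∨ s = -1) ∧ 0 ≤ s * a := by
  rcases le_total 0 a with h | h
  · exact ⟨1, Or.inl rfl, by linarith⟩
  · exact ⟨-1, Or.inr rfl, by linarith⟩

lemma sgn_lower {s a c v η δ : ℝ} (hs : s = 1 ∨ s = -1) (ha : 0 ≤ s * a) (hac : |c - a| < δ) (hδ : δ ≤ η)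
    (hc : η ≤ |c|) (hv : 0 < s * v) : η < |c + v| := by
  rw [abs_lt] at hac
  rcases hs with rfl | rfl
  · rcases le_abs.1 hc with h | h
    · exact lt_of_lt_of_le (by linarith) (le_abs_self _)
    · linarith
  · rcases le_abs.1 hc with h | h
    · linarith
    · exact lt_of_lt_of_le (by linarith) (neg_le_abs _)

lemma cone_perf {U : Set E2} (hU : Dom U) {κ : ℝ} (hκ : 0 < κ)
    (hstar : ∀ b, ‖b‖ < κ → StarConvex ℝ b U) (hball : Metric.ball 0 κ ⊆ U) {P : Finset (ℤ × ℤ)}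
    {η : ℝ} (hη : 0 < η) (hη8 : η ≤ 1/8) (hP : ∀ p ∈ P, Metric.ball (lat p) 2 ⊆ U) :
    ∃ ε > 0, ConeProperty (perf U P η) ε := by
  obtain ⟨M, hM0, hM⟩ := (Metric.isBounded_closure_iff.2 hU.bd).exists_pos_norm_le
  set W := perf U P η with hWdef
  have hWo : IsOpen W := perf_open hU.op P η
  set δ := min η (κ / (M + 2)) with hδdef
  have hδ0 : 0 < δ := lt_min hη (by positivity)
  have hδη : δ ≤ η := min_le_left _ _
  have hδκ : δ * (M + 2) ≤ κ := by
    have : δ ≤ κ / (M + 2) := min_le_right _ _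
    rwa [le_div_iff₀ (by positivity)] at this
  refine ⟨δ, hδ0, fun x hx => ?_⟩
  rw [hWo.frontier_eq] at hx
  obtain ⟨hxc, hxW⟩ := hx
  have hWU : closure W ⊆ closure U := closure_mono sdiff_subset
  by_cases hxU : x ∈ U
  · -- boundary of a hole
    have : ∃ p ∈ P, x ∈ hole p η := by
      by_contra hcon
      refine hxW ⟨hxU, fun h => hcon ?_⟩
      simpa using h
    obtain ⟨p, hp, hxp⟩ := this
    obtain ⟨s0, hs0, hs0a⟩ := exists_sgn ((x - lat p) 0)
    obtain ⟨s1, hs1, hs1a⟩ := exists_sgn ((x - lat p) 1)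
    have q0 : s0^2 = 1 := by rcases hs0 with rfl | rfl <;> norm_num
    have q1 : s1^2 = 1 := by rcases hs1 with rfl | rfl <;> norm_num
    have a0 : |s0| = 1 := by rcases hs0 with rfl | rfl <;> norm_num
    have a1 : |s1| = 1 := by rcases hs1 with rfl | rfl <;> norm_num
    have hξ : ‖(!₂[3/5 * s0, 4/5 * s1] : E2)‖ = 1 := by
      rw [EuclideanSpace.norm_eq, Fin.sum_univ_two]
      simp only [Real.norm_eq_abs, sq_abs, Matrix.cons_val_zero, Matrix.cons_val_one, mul_pow, q0, q1]
      norm_num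
    refine ⟨_, hξ, fun y hy z hz => ?_⟩
    obtain ⟨hyc, hyx⟩ := hy
    have hdir := cone_dir hξ hδ0 hz
    obtain ⟨-, hz0, hzδ⟩ := hz
    rw [mem_ball_iff_norm] at hyx
    obtain ⟨hx0, hx1⟩ := hxp
    set v := z - y with hv
    have c0 := (coord_le_norm _ 0).trans hdir
    have c1 := (coord_le_norm _ 1).trans hdir
    simp only [PiLp.sub_apply, PiLp.smul_apply, smul_eq_mul, Matrix.cons_val_zero, Matrix.cons_val_one] at c0 c1
    have d8 : δ * ‖v‖ ≤ 1/8 * ‖v‖ := mul_le_mul_of_nonneg_right (by linarith) hz0.le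
    have v0 : 0 < s0 * v 0 := by
      rw [abs_le] at c0
      rcases hs0 with rfl | rfl <;> linarith [c0.1, c0.2]
    have v1 : 0 < s1 * v 1 := by
      rw [abs_le] at c1
      rcases hs1 with rfl | rfl <;> linarith [c1.1, c1.2]
    have y0 : |(y - lat p) 0 - (x - lat p) 0| < δ := by
      have := (coord_le_norm (y - x) 0).trans_lt hyx
      simpa using this
    have y1 : |(y - lat p) 1 - (x - lat p) 1| < δ := by
      have := (coord_le_norm (y - x) 1).trans_lt hyx
      simpa using this
    have w0 := (coord_le_norm v 0).trans_lt hzδ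
    have w1 := (coord_le_norm v 1).trans_lt hzδ
    have ze : z - lat p = (y - lat p) + v := by rw [hv]; abel
    have ze0 : (z - lat p) 0 = (y - lat p) 0 + v 0 := by rw [ze]; rfl
    have ze1 : (z - lat p) 1 = (y - lat p) 1 + v 1 := by rw [ze]; rfl
    have hzcell : z ∈ cell p := by
      refine ⟨?_, ?_⟩
      · rw [ze0]
        rw [abs_lt] at *
        rw [abs_le] at hx0
        constructor <;> linarith [y0.1, y0.2, w0.1, w0.2, hx0.1, hx0.2]
      · rw [ze1]
        rw [abs_lt] at *
        rw [abs_le] at hx1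
        constructor <;> linarith [y1.1, y1.2, w1.1, w1.2, hx1.1, hx1.2]
    have hyout : η ≤ |(y - lat p) 0| ∨ η ≤ |(y - lat p) 1| := by
      by_contra hcon
      push Not at hcon
      have hop : IsOpen {w : E2 | |(w - lat p) 0| < η ∧ |(w - lat p) 1| < η} := by
        have k0 : Continuous fun w : E2 => |(w - lat p) 0| := by
          have := cont_coord 0; simp only [PiLp.sub_apply]; fun_prop
        have k1 : Continuous fun w : E2 => |(w - lat p) 1| := by
          have := cont_coord 1; simp only [PiLp.sub_apply]; fun_prop
        exact (isOpen_lt k0 continuous_const).inter (isOpen_lt k1 continuous_const)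
      obtain ⟨w, hw1, hw2⟩ := mem_closure_iff.1 hyc _ hop hcon
      refine hw2.2 ?_
      simp only [mem_iUnion]
      exact ⟨p, hp, hw1.1.le, hw1.2.le⟩
    refine ⟨hP p hp (cell_sub_ball p hzcell), fun hcon => ?_⟩
    simp only [mem_iUnion] at hcon
    obtain ⟨q, hq, hzq⟩ := hcon
    obtain rfl := cell_eq hzcell (hole_sub (by linarith) q hzq)
    obtain ⟨z0, z1⟩ := hzq
    rw [ze0] at z0
    rw [ze1] at z1
    rcases hyout with h | h
    · linarith [sgn_lower hs0 hs0a y0 hδη h v0]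
    · linarith [sgn_lower hs1 hs1a y1 hδη h v1]
  · -- outer boundary
    have hxκ : κ ≤ ‖x‖ := by
      by_contra hcon
      push Not at hcon
      exact hxU (hball (by simpa using hcon))
    have hx0 : 0 < ‖x‖ := by linarith
    have hξ : ‖-(‖x‖⁻¹ • x)‖ = 1 := by
      rw [norm_neg, norm_smul, norm_inv, norm_norm, inv_mul_cancel₀ hx0.ne']
    refine ⟨_, hξ, fun y hy z hz => ?_⟩
    obtain ⟨hyc, hyx⟩ := hy
    have hdir := cone_dir hξ hδ0 hz
    obtain ⟨-, hz0, hzδ⟩ := hz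
    rw [mem_ball_iff_norm] at hyx
    have hxM := hM x (hWU hxc)
    set v := z - y with hv
    have hzv : z = y + v := by rw [hv]; abel
    clear_value v
    refine ⟨?_, fun hcon => ?_⟩
    · have hb : ‖y + (‖x‖ / ‖v‖) • v‖ < κ := by
        have e : y + (‖x‖ / ‖v‖) • v = (y - x) + (‖x‖ / ‖v‖) • (v - ‖v‖ • (-(‖x‖⁻¹ • x))) := by
          rw [smul_sub, smul_smul, div_mul_cancel₀ _ hz0.ne', smul_neg, smul_inv_smul₀ hx0.ne']
          abel
        rw [e]
        have h1 : ‖(‖x‖ / ‖v‖) • (v - ‖v‖ • (-(‖x‖⁻¹ • x)))‖ ≤ ‖x‖ * δ := by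
          rw [norm_smul, Real.norm_of_nonneg (by positivity), div_mul_eq_mul_div, div_le_iff₀ hz0, mul_assoc]
          exact mul_le_mul_of_nonneg_left hdir hx0.le
        have h2 := norm_add_le (y - x) ((‖x‖ / ‖v‖) • (v - ‖v‖ • (-(‖x‖⁻¹ • x))))
        nlinarith
      have := star_closure hstar (hWU hyc) hb (t := ‖v‖ / ‖x‖) (by positivity)
        (by rw [div_le_one hx0]; nlinarith)
      convert this using 1
      rw [smul_add, smul_smul, div_mul_div_cancel₀ hx0.ne', div_self hz0.ne', hzv]
      module
    · simp only [mem_iUnion] at hcon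
      obtain ⟨p, hp, hzp⟩ := hcon
      have h1 : 2 ≤ ‖x - lat p‖ := by
        by_contra h
        push Not at h
        exact hxU (hP p hp (by rwa [mem_ball_iff_norm]))
      have h2 := norm_le_coords (z - lat p)
      have h3 : ‖x - lat p‖ ≤ ‖z - lat p‖ + (‖v‖ + ‖y - x‖) := by
        rw [show x - lat p = (z - lat p) - (v + (y - x)) by rw [hv]; abel]
        exact (norm_sub_le _ _).trans (add_le_add le_rfl (norm_add_le _ _))
      linarith [hzp.1, hzp.2]

end

noncomputable section

open Pointwise

lemma mul_close (x y : ℝ) {δ : ℝ} (hδ : 0 < δ) : ∃ θ > 0, ∀ a b, |a - x| ≤ θ → |b - y| ≤ θ →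
    |a * b - x * y| ≤ δ := by
  refine ⟨min 1 (δ / (|x| + |y| + 1)), lt_min one_pos (by positivity), fun a b ha hb => ?_⟩
  set θ := min 1 (δ / (|x| + |y| + 1))
  have h0 : 0 ≤ θ := (abs_nonneg _).trans ha
  have h1 : θ ≤ 1 := min_le_left _ _
  have h2 : θ * (|x| + |y| + 1) ≤ δ := by
    have : θ ≤ δ / (|x| + |y| + 1) := min_le_right _ _
    rwa [le_div_iff₀ (by positivity)] at this
  have e : a * b - x * y = (a - x) * (b - y) + (a - x) * y + x * (b - y) := by ring
  rw [e]
  refine (abs_add_three _ _ _).trans ?_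
  rw [abs_mul, abs_mul, abs_mul]
  have k1 : |a - x| * |b - y| ≤ θ * 1 := mul_le_mul ha (hb.trans h1) (abs_nonneg _) h0
  have k2 : |a - x| * |y| ≤ θ * |y| := mul_le_mul_of_nonneg_right ha (abs_nonneg _)
  have k3 : |x| * |b - y| ≤ |x| * θ := mul_le_mul_of_nonneg_left hb (abs_nonneg _)
  linarith

lemma perforate0 {Ω : Set E2} (hΩ : Dom Ω) {κ : ℝ} (hκ : 0 < κ)
    (hstar : ∀ b, ‖b‖ < κ → StarConvex ℝ b Ω) (hball : Metric.ball 0 κ ⊆ Ω) (hpos : 0 < nEig1 Ω)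
    {s : ℝ} (hs : 0 < s) (hs1 : s < 1) {θ : ℝ} (hθ : 0 < θ) :
    ∃ (W : Set E2) (N : ℝ), 0 < N ∧ Dom W ∧ (∃ ε > 0, ConeProperty W ε) ∧
      |area W / N^2 - area Ω| ≤ θ ∧ |N^2 * dEig1 W - dEig1 Ω / s^2| ≤ θ ∧
      |N^2 * nEig1 W - nEig1 Ω| ≤ θ := by
  set n := nEig1 Ω with hn
  obtain ⟨η0, hη0, hup⟩ := neumann_upper hΩ hθ
  have hct : Tendsto (fun ε : ℝ => 1 / ((1 + ε)^2 / √n)^2) (nhdsWithin 0 (Ioi 0)) (nhds n) := by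
    have hsq := Real.sqrt_pos.2 hpos
    have : ContinuousAt (fun ε : ℝ => 1 / ((1 + ε)^2 / √n)^2) 0 := by
      apply ContinuousAt.div continuousAt_const (by fun_prop)
      simp [hsq.ne']
    have h2 := this.tendsto
    have e : 1 / ((1 + (0:ℝ))^2 / √n)^2 = n := by
      rw [add_zero, div_pow, Real.sq_sqrt hpos.le]; field_simp
    rw [e] at h2
    exact h2.mono_left nhdsWithin_le_nhds
  obtain ⟨ε, hε1, hε⟩ := ((hct.eventually (lt_mem_nhds (show n - θ < n by linarith))).and
    self_mem_nhdsWithin).exists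
  have hε0 : 0 < ε := hε
  obtain ⟨η1, hη1, hwt⟩ := exists_wt hε0
  have hA := hΩ.pos
  obtain ⟨η, hη, hη8, hηη1, hηs⟩ : ∃ η : ℝ, 0 < η ∧ η ≤ 1/8 ∧ η ≤ η1 ∧ 16 * η^2 * area Ω ≤ min η0 θ := by
    refine ⟨min (1/8) (min η1 (min η0 θ / (2 * area Ω))), by positivity, min_le_left _ _,
      (min_le_right _ _).trans (min_le_left _ _), ?_⟩
    set η := min (1/8) (min η1 (min η0 θ / (2 * area Ω)))
    have h0 : 0 < η := by positivity
    have h1 : η ≤ 1/8 := min_le_left _ _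
    have h2 : η ≤ min η0 θ / (2 * area Ω) := (min_le_right _ _).trans (min_le_right _ _)
    rw [le_div_iff₀ (by positivity)] at h2
    have : 16 * η^2 ≤ 2 * η := by nlinarith
    nlinarith
  obtain ⟨β, hβ⟩ := hwt η hη hηη1
  obtain ⟨A, N1, hA0, hN1, hlow⟩ := neumann_lower hΩ hκ hstar hpos hε0 hη hη8 hβ
  obtain ⟨N2, hN2, hdir⟩ := dir_lower hΩ hκ hstar hs hη hθ
  have hct2 : Tendsto (fun N : ℝ => 1 / (A / N + (1 + ε)^2 / √n)^2) atTop
      (nhds (1 / ((1 + ε)^2 / √n)^2)) := by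
    have hsq := Real.sqrt_pos.2 hpos
    have h1 : Tendsto (fun N : ℝ => A / N + (1 + ε)^2 / √n) atTop (nhds (0 + (1 + ε)^2 / √n)) :=
      (tendsto_const_nhds.div_atTop tendsto_id).add tendsto_const_nhds
    rw [zero_add] at h1
    exact tendsto_const_nhds.div (h1.pow 2) (by positivity)
  obtain ⟨N, hNa, hNb, hNc, hN0⟩ := ((hct2.eventually (lt_mem_nhds hε1)).and
    ((eventually_ge_atTop N1).and ((eventually_ge_atTop N2).and (eventually_gt_atTop 0)))).exists
  have hU := hΩ.smul hN0
  set U := N • Ω with hUdef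
  set P := (goodP_finite hU.bd ((N * s) • Ω)).toFinset with hPdef
  have hP : ∀ p, p ∈ P ↔ Metric.ball (lat p) 2 ⊆ U ∧ Disjoint (Metric.ball (lat p) 2) ((N * s) • Ω) := by
    intro p; rw [hPdef, Set.Finite.mem_toFinset]; rfl
  have hPc : ∀ p ∈ P, cell p ⊆ U := fun p hp => (cell_sub_ball p).trans ((hP p).1 hp).1
  have hsub : (N * s) • Ω ⊆ perf U P η := by
    intro x hx
    refine ⟨?_, fun hcon => ?_⟩
    · obtain ⟨w, hw, rfl⟩ := hx
      refine ⟨s • w, ?_, by simp only [smul_smul]⟩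
      have := hstar 0 (by simpa using hκ) hw (show 0 ≤ 1 - s by linarith) hs.le (by ring)
      simpa using this
    · simp only [mem_iUnion] at hcon
      obtain ⟨p, hp, hxp⟩ := hcon
      exact disjoint_left.1 ((hP p).1 hp).2 (hole_sub_ball (by linarith) hxp) hx
  have hNs : 0 < N * s := by positivity
  have hV := hΩ.smul hNs
  have hW : Dom (perf U P η) := ⟨hV.ne.mono hsub, perf_open hU.op P η, hU.bd.subset sdiff_subset⟩
  set W := perf U P η with hWdef
  have hW' := hW.smul (inv_pos.2 hN0)
  have aW : area (N⁻¹ • W) = area W / N^2 := by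
    rw [area_smul (inv_pos.2 hN0)]; field_simp
  have nW : nEig1 (N⁻¹ • W) = N^2 * nEig1 W := by
    rw [← nEig1_smul hW (inv_pos.2 hN0)]; field_simp
  have hsubΩ : N⁻¹ • W ⊆ Ω := by
    rintro x ⟨w, hw, rfl⟩
    obtain ⟨y, hy, rfl⟩ := hw.1
    simpa [inv_smul_smul₀ hN0.ne'] using hy
  have har := perf_area hU hPc hη
  have har2 : area Ω - area W / N^2 ≤ 16 * η^2 * area Ω := by
    rw [area_smul hN0] at har
    have : area Ω - area W / N^2 = (N^2 * area Ω - area W) / N^2 := by field_simp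
    rw [this, div_le_iff₀ (by positivity)]
    linarith
  have har3 : area W / N^2 ≤ area Ω := by rw [← aW]; exact area_mono hΩ hsubΩ
  refine ⟨W, N, hN0, hW, ?_, ?_, ?_, ?_⟩
  · refine cone_perf hU (κ := N * κ) (by positivity) (star_smul hN0 hstar) ?_ hη hη8
      fun p hp => ((hP p).1 hp).1
    intro x hx
    rw [hUdef, mem_smul_set_iff_inv_smul_mem₀ hN0.ne']
    apply hball
    rw [mem_ball_zero_iff] at hx ⊢
    rwa [norm_smul, Real.norm_of_nonneg (by positivity), inv_mul_lt_iff₀ hN0]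
  · rw [abs_le]
    have := hηs.trans (min_le_right _ _)
    constructor <;> linarith
  · have h1 := hdir N hNc P hP hW
    have h2 := dEig1_mono hV hsub
    have h3 := dEig1_smul hΩ hNs
    have h4 : N^2 * dEig1 ((N * s) • Ω) = dEig1 Ω / s^2 := by rw [← h3]; field_simp
    have h5 := mul_le_mul_of_nonneg_left h2 (sq_nonneg N)
    rw [abs_le]
    constructor <;> linarith
  · have h1 := hup _ hW' hsubΩ (by rw [aW]; exact har2.trans (hηs.trans (min_le_left _ _)))
    rw [nW] at h1
    have hsq := Real.sqrt_pos.2 hpos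
    have h2 := PC.le hW (by positivity) (hlow N hNb P hPc hW)
    have h3 := mul_le_mul_of_nonneg_left h2 (sq_nonneg N)
    have h4 : N^2 * (1 / (A + (1 + ε)^2 * (N / √n))^2) = 1 / (A / N + (1 + ε)^2 / √n)^2 := by
      field_simp
    rw [h4] at h3
    rw [abs_le]
    constructor <;> linarith

lemma perforate {Ω : Set E2} (hΩ : Dom Ω) {κ : ℝ} (hκ : 0 < κ)
    (hstar : ∀ b, ‖b‖ < κ → StarConvex ℝ b Ω) (hball : Metric.ball 0 κ ⊆ Ω) (hpos : 0 < nEig1 Ω)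
    {s : ℝ} (hs : 0 < s) (hs1 : s < 1) {δ : ℝ} (hδ : 0 < δ) :
    ∃ W : Set E2, Dom W ∧ (∃ ε > 0, ConeProperty W ε) ∧
      |area W * dEig1 W - area Ω * (dEig1 Ω / s^2)| ≤ δ ∧ |area W * nEig1 W - area Ω * nEig1 Ω| ≤ δ := by
  obtain ⟨θ1, h1, H1⟩ := mul_close (area Ω) (dEig1 Ω / s^2) hδ
  obtain ⟨θ2, h2, H2⟩ := mul_close (area Ω) (nEig1 Ω) hδ
  obtain ⟨W, N, hN, hW, hc, ha, hd, hn⟩ := perforate0 hΩ hκ hstar hball hpos hs hs1 (lt_min h1 h2)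
  have e : ∀ t : ℝ, area W / N^2 * (N^2 * t) = area W * t := fun t => by field_simp
  refine ⟨W, hW, hc, ?_, ?_⟩
  · rw [← e]; exact H1 _ _ (ha.trans (min_le_left _ _)) (hd.trans (min_le_left _ _))
  · rw [← e]; exact H2 _ _ (ha.trans (min_le_right _ _)) (hn.trans (min_le_right _ _))

lemma cone_star {Ω : Set E2} (hΩ : Dom Ω) {κ : ℝ} (hκ : 0 < κ)
    (hstar : ∀ b, ‖b‖ < κ → StarConvex ℝ b Ω) (hball : Metric.ball 0 κ ⊆ Ω) :
    ∃ ε > 0, ConeProperty Ω ε := by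
  have := cone_perf hΩ hκ hstar hball (P := ∅) (η := 1/8) (by norm_num) le_rfl (by simp)
  simpa [perf] using this

end

/-- The closure of the Blaschke–Santaló diagram `𝓔` is exactly the strip
`[π λ₁(𝔻), +∞) × [0, π μ₁(𝔻)]`. -/
theorem closure_diagE_eq_strip :
    closure diagE =
      { p : ℝ × ℝ | π * dEig1 unitDisc ≤ p.1 ∧ 0 ≤ p.2 ∧ p.2 ≤ π * nEig1 unitDisc } := by
  apply Subset.antisymm
  · apply closure_minimal
    · rintro p ⟨Ω, hne, hop, hbd, -, rfl⟩
      have h : Dom Ω := ⟨hne, hop, hbd⟩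
      exact ⟨faber_krahn h, mul_nonneg ENNReal.toReal_nonneg (nEig1_nonneg Ω), szego_weinberger h⟩
    · exact (isClosed_le continuous_const continuous_fst).inter
        ((isClosed_le continuous_const continuous_snd).inter
          (isClosed_le continuous_snd continuous_const))
  · rintro ⟨x, y⟩ ⟨hx, hy0, hy1⟩
    simp only at hx hy0 hy1
    rw [Metric.mem_closure_iff]
    intro e he
    obtain ⟨Ω, κ, hΩ, hκ, hstar, hball, hpos, hn, hd⟩ := exists_base hy0 hy1 (δ := e / 4) (by positivity)
    have fin : ∀ W : Set E2, Dom W → (∃ ε > 0, ConeProperty W ε) → |area W * dEig1 W - x| < e →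
        |area W * nEig1 W - y| < e → ∃ b ∈ diagE, dist (x, y) b < e := by
      intro W hW hc h1 h2
      refine ⟨_, ⟨W, hW.ne, hW.op, hW.bd, hc, rfl⟩, ?_⟩
      rw [Prod.dist_eq, max_lt_iff, dist_comm, dist_comm y, Real.dist_eq, Real.dist_eq]
      exact ⟨h1, h2⟩
    set t := area Ω * dEig1 Ω with ht
    have ht0 : 0 < t := mul_pos hΩ.pos (dEig1_pos hΩ)
    rcases le_or_gt x t with hxt | hxt
    · refine fin Ω hΩ (cone_star hΩ hκ hstar hball) ?_ (by linarith)
      rw [abs_lt]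
      constructor <;> linarith
    · have hx0 : 0 < x := ht0.trans hxt
      have hs2 : √(t / x)^2 = t / x := Real.sq_sqrt (by positivity)
      obtain ⟨W, hW, hc, h1, h2⟩ := perforate hΩ hκ hstar hball hpos (s := √(t / x))
        (Real.sqrt_pos.2 (by positivity))
        (by rw [Real.sqrt_lt' one_pos, one_pow, div_lt_one hx0]; exact hxt) (δ := e / 4) (by positivity)
      have e1 : area Ω * (dEig1 Ω / √(t / x)^2) = x := by
        rw [hs2, ← mul_div_assoc, ← ht]; field_simp
      rw [e1] at h1
      refine fin W hW hc (by linarith) ?_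
      have := abs_sub_le (area W * nEig1 W) (area Ω * nEig1 Ω) y
      linarith
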